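/- (Gallagher) For every constant c_2 > 0 there exist constants D > 0 and c_3 > 0 such that the following holds: if q > 1 is a good modulus with respect to c_2 (that is, L(s, χ) ≠ 0 for all Dirichlet characters χ mod q and all s = σ + it with σ > 1 − c_2/log(q(|t| + 1))), then for every integer a coprime to q and every x ≥ q^D one has π(x; q, a) ≥ c_3 · x / (φ(q) · log x), where π(x; q, a) denotes the number of primes p ≤ x with p ≡ a (mod q). -/

import Mathlib

open Real Finset

/-- An integer `q > 1` is a good modulus (with respect to the constant `c₂ > 0`) if
`L(s, χ) ≠ 0` for every Dirichlet character `χ mod q` and every `s = σ + it` with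
`σ > 1 - c₂ / log (q(|t| + 1))`. -/
def IsGoodModulus (c₂ : ℝ) (q : ℕ) (hq : 1 < q) : Prop :=
  haveI : NeZero q := ⟨by omega⟩
  ∀ χ : DirichletCharacter ℂ q, ∀ s : ℂ,
    s.re > 1 - c₂ / Real.log (q * (|s.im| + 1)) →
    DirichletCharacter.LFunction χ s ≠ 0

/-- `primeCount x q a = #{p ≤ x : p prime, p ≡ a (mod q)}`. -/
noncomputable def primeCount (x : ℝ) (q a : ℕ) : ℕ :=
  ((Finset.Iic ⌊x⌋₊).filter (fun p => p.Prime ∧ p % q = a % q)).card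

namespace Gal

noncomputable def esy (P : Finset ℕ) (x : ℕ → ℝ) (k : ℕ) : ℝ :=
  ∑ T ∈ P.powersetCard k, ∏ p ∈ T, x p

lemma esy_zero (P : Finset ℕ) (x : ℕ → ℝ) : esy P x 0 = 1 := by simp [esy]

lemma esy_empty (x : ℕ → ℝ) (k : ℕ) : esy ∅ x (k+1) = 0 := by
  unfold esy
  rw [Finset.powersetCard_eq_empty.2 (by simp)]; simp

lemma esy_insert {P : Finset ℕ} {p : ℕ} (hp : p ∉ P) (x : ℕ → ℝ) (k : ℕ) :
    esy (insert p P) x (k+1) = esy P x (k+1) + x p * esy P x k := by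
  unfold esy
  rw [Finset.powersetCard_succ_insert hp, Finset.sum_union, Finset.sum_image, Finset.mul_sum]
  · congr 1
    refine Finset.sum_congr rfl fun T hT => ?_
    rw [Finset.prod_insert]
    intro h; exact hp ((Finset.mem_powersetCard.1 hT).1 h)
  · intro T hT T' hT' h
    have h1 : p ∉ T := fun h => hp ((Finset.mem_powersetCard.1 hT).1 h)
    have h2 : p ∉ T' := fun h => hp ((Finset.mem_powersetCard.1 hT').1 h)
    rw [← Finset.erase_insert h1, ← Finset.erase_insert h2, h]
  · rw [Finset.disjoint_left]
    intro T hT hT'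
    obtain ⟨T', _, rfl⟩ := Finset.mem_image.1 hT'
    exact hp ((Finset.mem_powersetCard.1 hT).1 (Finset.mem_insert_self _ _))

lemma esy_nonneg {P : Finset ℕ} {x : ℕ → ℝ} (hx : ∀ p ∈ P, 0 ≤ x p) (k : ℕ) : 0 ≤ esy P x k :=
  Finset.sum_nonneg fun _ hT => Finset.prod_nonneg fun p hp =>
    hx p ((Finset.mem_powersetCard.1 hT).1 hp)

noncomputable def mtr (P : Finset ℕ) (x : ℕ → ℝ) (b : ℕ) : ℝ :=
  ∑ k ∈ range (b+1), (-1)^k * esy P x k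

lemma mtr_insert {P : Finset ℕ} {p : ℕ} (hp : p ∉ P) (x : ℕ → ℝ) (b : ℕ) :
    mtr (insert p P) x (b+1) = mtr P x (b+1) - x p * mtr P x b := by
  unfold mtr
  rw [Finset.sum_range_succ' _ (b+1), Finset.sum_range_succ' (fun k => (-1)^k * esy P x k) (b+1)]
  simp only [esy_insert hp, esy_zero, mul_add, Finset.sum_add_distrib, Finset.mul_sum]
  have : ∑ i ∈ range (b+1), (-1:ℝ)^(i+1) * (x p * esy P x i) =
      - ∑ i ∈ range (b+1), x p * ((-1)^i * esy P x i) := by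
    rw [← Finset.sum_neg_distrib]; refine Finset.sum_congr rfl fun i _ => by ring
  rw [this]; ring

lemma bonf (P : Finset ℕ) (x : ℕ → ℝ) (h0 : ∀ p ∈ P, 0 ≤ x p) (h1 : ∀ p ∈ P, x p ≤ 1) :
    ∀ b : ℕ, 0 ≤ (-1)^b * (mtr P x b - ∏ p ∈ P, (1 - x p)) ∧
      (-1)^b * (mtr P x b - ∏ p ∈ P, (1 - x p)) ≤ esy P x (b+1) := by
  induction P using Finset.induction_on with
  | empty =>
    intro b
    have : mtr ∅ x b = 1 := by
      unfold mtr
      rw [Finset.sum_range_succ', Finset.sum_eq_zero]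
      · simp [esy]
      · intro i _; rw [esy_empty]; simp
    rw [this, esy_empty]; simp
  | insert p P hp ih =>
    have ih' := ih (fun p hp => h0 p (mem_insert_of_mem hp)) (fun p hp => h1 p (mem_insert_of_mem hp))
    have hp0 := h0 p (mem_insert_self _ _)
    have hV : ∏ p ∈ P, (1 - x p) ≤ 1 := Finset.prod_le_one
      (fun i hi => by linarith [h1 i (mem_insert_of_mem hi)])
      (fun i hi => by linarith [h0 i (mem_insert_of_mem hi)])
    have hV0 : 0 ≤ ∏ p ∈ P, (1 - x p) := Finset.prod_nonneg
      (fun i hi => by linarith [h1 i (mem_insert_of_mem hi)])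
    intro b
    rw [Finset.prod_insert hp, esy_insert hp]
    cases b with
    | zero =>
      have := ih' 0
      simp only [mtr, pow_zero, zero_add, Finset.range_one, Finset.sum_singleton, esy_zero] at this ⊢
      constructor
      · nlinarith
      · nlinarith
    | succ b =>
      obtain ⟨a1, a2⟩ := ih' (b+1)
      obtain ⟨a3, a4⟩ := ih' b
      rw [mtr_insert hp]
      have : (-1:ℝ)^(b+1) * (mtr P x (b+1) - x p * mtr P x b - (1 - x p) * ∏ p ∈ P, (1 - x p)) =
        (-1)^(b+1) * (mtr P x (b+1) - ∏ p ∈ P, (1 - x p)) +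
          x p * ((-1)^b * (mtr P x b - ∏ p ∈ P, (1 - x p))) := by ring
      rw [this]
      constructor
      · have := mul_nonneg hp0 a3
        linarith
      · have := mul_le_mul_of_nonneg_left a4 hp0
        linarith

lemma esy_le (P : Finset ℕ) (x : ℕ → ℝ) (h0 : ∀ p ∈ P, 0 ≤ x p) (k : ℕ) {t : ℝ} (ht : 0 < t) :
    esy P x k ≤ exp (t * ∑ p ∈ P, x p) / t ^ k := by
  rw [le_div_iff₀ (by positivity)]
  have h1 : esy P x k * t^k = ∑ T ∈ P.powersetCard k, ∏ p ∈ T, (t * x p) := by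
    unfold esy; rw [Finset.sum_mul]
    refine Finset.sum_congr rfl fun T hT => ?_
    rw [Finset.prod_mul_distrib, Finset.prod_const, (Finset.mem_powersetCard.1 hT).2]; ring
  rw [h1]
  calc _ ≤ ∑ T ∈ P.powerset, ∏ p ∈ T, (t * x p) := by
        refine Finset.sum_le_sum_of_subset_of_nonneg ?_ ?_
        · intro T hT; exact Finset.mem_powerset.2 (Finset.mem_powersetCard.1 hT).1
        · intro T hT _
          exact Finset.prod_nonneg fun p hp => mul_nonneg ht.le (h0 p (Finset.mem_powerset.1 hT hp))
    _ = ∏ p ∈ P, (1 + t * x p) := (Finset.prod_one_add _).symm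
    _ ≤ ∏ p ∈ P, exp (t * x p) := Finset.prod_le_prod
        (fun i hi => by have := mul_nonneg ht.le (h0 i hi); linarith)
        (fun i hi => by linarith [add_one_le_exp (t * x i)])
    _ = _ := by rw [← Real.exp_sum, Finset.mul_sum]

/-- representation as a divisor sum supported on integers with primes in `P` -/
def Rep (P : Finset ℕ) (g : ℕ → ℝ) (m N : ℝ) : Prop :=
  ∃ (ι : Type) (_ : Fintype ι) (d : ι → ℕ) (c : ι → ℝ),
    (∀ i, d i ≠ 0 ∧ ∀ p, p.Prime → p ∣ d i → p ∈ P) ∧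
    (∀ n, g n = ∑ i, c i * if d i ∣ n then 1 else 0) ∧
    ∑ i, c i / d i = m ∧ ∑ i, |c i| ≤ N

lemma Rep.add {P : Finset ℕ} {g g' : ℕ → ℝ} {m m' N N' : ℝ} (h : Rep P g m N) (h' : Rep P g' m' N') :
    Rep P (fun n => g n + g' n) (m + m') (N + N') := by
  obtain ⟨ι, _, d, c, h1, h2, h3, h4⟩ := h
  obtain ⟨ι', _, d', c', h1', h2', h3', h4'⟩ := h'
  refine ⟨ι ⊕ ι', inferInstance, Sum.elim d d', Sum.elim c c', ?_, ?_, ?_, ?_⟩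
  · rintro (i | i)
    · exact h1 i
    · exact h1' i
  · intro n
    show g n + g' n = _
    rw [h2, h2', Fintype.sum_sum_type]; rfl
  · simp [Fintype.sum_sum_type, h3, h3']
  · simp only [Fintype.sum_sum_type, Sum.elim_inl, Sum.elim_inr]; linarith

lemma Rep.mono {P P' : Finset ℕ} {g : ℕ → ℝ} {m N N' : ℝ} (h : Rep P g m N) (hP : P ⊆ P')
    (hN : N ≤ N') : Rep P' g m N' := by
  obtain ⟨ι, _, d, c, h1, h2, h3, h4⟩ := h
  exact ⟨ι, inferInstance, d, c, fun i => ⟨(h1 i).1, fun p hp hd => hP ((h1 i).2 p hp hd)⟩, h2, h3,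
    h4.trans hN⟩

lemma Rep.mul {P P' : Finset ℕ} {g g' : ℕ → ℝ} {m m' N N' : ℝ} (h : Rep P g m N) (h' : Rep P' g' m' N')
    (hN : 0 ≤ N) (hd : Disjoint P P') :
    Rep (P ∪ P') (fun n => g n * g' n) (m * m') (N * N') := by
  obtain ⟨ι, _, d, c, h1, h2, h3, h4⟩ := h
  obtain ⟨ι', _, d', c', h1', h2', h3', h4'⟩ := h'
  have hcop : ∀ i j, Nat.Coprime (d i) (d' j) := by
    intro i j
    refine Nat.Coprime.symm (Nat.coprime_of_dvd fun p hp h h' => ?_)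
    exact Finset.disjoint_left.1 hd ((h1 i).2 p hp h') ((h1' j).2 p hp h)
  refine ⟨ι × ι', inferInstance, fun i => d i.1 * d' i.2, fun i => c i.1 * c' i.2, ?_, ?_, ?_, ?_⟩
  · rintro ⟨i, j⟩
    refine ⟨mul_ne_zero (h1 i).1 (h1' j).1, fun p hp hdv => ?_⟩
    rcases (Nat.Prime.dvd_mul hp).1 hdv with h | h
    · exact Finset.mem_union_left _ ((h1 i).2 p hp h)
    · exact Finset.mem_union_right _ ((h1' j).2 p hp h)
  · intro n
    show g n * g' n = _
    rw [h2, h2', Finset.sum_mul_sum, Fintype.sum_prod_type]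
    refine Finset.sum_congr rfl fun i _ => Finset.sum_congr rfl fun j _ => ?_
    have : (d i * d' j ∣ n) ↔ (d i ∣ n ∧ d' j ∣ n) :=
      ⟨fun h => ⟨(dvd_mul_right _ _).trans h, (dvd_mul_left _ _).trans h⟩,
       fun h => Nat.Coprime.mul_dvd_of_dvd_of_dvd (hcop i j) h.1 h.2⟩
    simp only [this]
    by_cases ha : d i ∣ n <;> by_cases hb : d' j ∣ n <;> simp [ha, hb]
  · rw [← h3, ← h3', Finset.sum_mul_sum, Fintype.sum_prod_type]
    refine Finset.sum_congr rfl fun i _ => Finset.sum_congr rfl fun j _ => ?_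
    push_cast; rw [mul_div_mul_comm]
  · calc _ = (∑ i, |c i|) * ∑ j, |c' j| := by
          rw [Finset.sum_mul_sum, Fintype.sum_prod_type]
          refine Finset.sum_congr rfl fun i _ => Finset.sum_congr rfl fun j _ => abs_mul _ _
      _ ≤ N * N' := mul_le_mul h4 h4' (Finset.sum_nonneg fun _ _ => abs_nonneg _) hN

/-- divisibility indicator -/
noncomputable def dvi (n : ℕ) (p : ℕ) : ℝ := if p ∣ n then 1 else 0

lemma rep_esy {P : Finset ℕ} (hP : ∀ p ∈ P, p.Prime) (k : ℕ) (c : ℝ) (hc : |c| = 1) :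
    Rep P (fun n => c * esy P (dvi n) k) (c * esy P (fun p => 1 / (p:ℝ)) k) ((P.card : ℝ)^k) := by
  refine ⟨{T // T ∈ P.powersetCard k}, inferInstance, fun T => ∏ p ∈ T.1, p, fun _ => c, ?_, ?_, ?_, ?_⟩
  · rintro ⟨T, hT⟩
    have hT' := (Finset.mem_powersetCard.1 hT).1
    refine ⟨Finset.prod_ne_zero_iff.2 fun p hp => (hP p (hT' hp)).ne_zero, fun p hp hd => ?_⟩
    obtain ⟨r, hr, hpr⟩ := (Prime.dvd_finsetProd_iff hp.prime _).1 hd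
    have := (Nat.prime_dvd_prime_iff_eq hp (hP r (hT' hr))).1 hpr
    exact this ▸ hT' hr
  · intro n
    rw [Finset.sum_coe_sort (P.powersetCard k)
      (fun T : Finset ℕ => (c * if (∏ p ∈ T, p) ∣ n then (1:ℝ) else 0 : ℝ)), ← Finset.mul_sum]
    unfold esy
    refine congrArg (c * ·) ?_
    refine Finset.sum_congr rfl fun T hT => ?_
    have hT' := (Finset.mem_powersetCard.1 hT).1
    unfold dvi
    rw [Finset.prod_ite_zero]
    simp only [Finset.prod_const_one]
    congr 1
    rw [eq_iff_iff]
    constructor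
    · intro h
      exact Finset.prod_primes_dvd n (fun p hp => (hP p (hT' hp)).prime) h
    · intro h p hp
      exact (Finset.dvd_prod_of_mem _ hp).trans h
  · rw [Finset.sum_coe_sort (P.powersetCard k) (fun T : Finset ℕ => (c / ((∏ p ∈ T, p : ℕ) : ℝ) : ℝ))]
    unfold esy
    rw [Finset.mul_sum]
    refine Finset.sum_congr rfl fun T hT => ?_
    push_cast
    rw [Finset.prod_div_distrib]; simp [div_eq_mul_inv]
  · simp only [hc, Finset.sum_const, Finset.card_univ, Fintype.card_coe, Finset.card_powersetCard,
      nsmul_eq_mul, mul_one]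
    exact_mod_cast Nat.choose_le_pow _ _

lemma rep_mtr {P : Finset ℕ} (hP : ∀ p ∈ P, p.Prime) (b : ℕ) :
    Rep P (fun n => mtr P (dvi n) b) (mtr P (fun p => 1 / (p:ℝ)) b) ((P.card + 1 : ℝ)^b) := by
  have key : Rep P (fun n => mtr P (dvi n) b) (mtr P (fun p => 1 / (p:ℝ)) b)
      (∑ k ∈ range (b+1), (P.card : ℝ)^k) := by
    induction b with
    | zero =>
      have := rep_esy hP 0 1 (by simp)
      simpa [mtr] using this
    | succ b ih =>
      have := ih.add (rep_esy hP (b+1) ((-1)^(b+1)) (by simp))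
      unfold mtr at this ⊢
      rw [Finset.sum_range_succ _ (b+1), Finset.sum_range_succ _ (b+1)]
      convert this using 2 with n
      rw [Finset.sum_range_succ _ (b+1)]
  refine key.mono (Finset.Subset.refl _) ?_
  rw [add_pow]
  refine Finset.sum_le_sum fun k hk => ?_
  have : 1 ≤ b.choose k := Nat.choose_pos (by have := Finset.mem_range.1 hk; omega)
  have h2 : (1:ℝ) ≤ b.choose k := by exact_mod_cast this
  simp only [one_pow, mul_one]
  exact le_mul_of_one_le_right (by positivity) h2

end Gal

namespace Gal

def zz (J : ℕ) : ℕ := 2 ^ (2 ^ J)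

lemma zz_succ (J : ℕ) : zz (J+1) = zz J ^ 2 := by
  unfold zz; rw [← pow_mul, pow_succ]

lemma two_le_zz (J : ℕ) : 2 ≤ zz J := by
  unfold zz
  calc 2 = 2 ^ 1 := by norm_num
    _ ≤ _ := Nat.pow_le_pow_right (by norm_num) Nat.one_le_two_pow

lemma zz_le_succ (J : ℕ) : zz J ≤ zz (J+1) := by
  rw [zz_succ]; exact Nat.le_self_pow (by norm_num) _

lemma zz_mono {J J' : ℕ} (h : J ≤ J') : zz J ≤ zz J' :=
  monotone_nat_of_le_succ zz_le_succ h

lemma log_zz (J : ℕ) : Real.log (zz J) = 2 ^ J * Real.log 2 := by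
  unfold zz; push_cast; rw [Real.log_pow]; push_cast; rfl

def PP (q J : ℕ) : Finset ℕ := (range (zz J)).filter (fun p => p.Prime ∧ ¬ p ∣ q)

def BB (q J : ℕ) : Finset ℕ := (Ico (zz J) (zz (J+1))).filter (fun p => p.Prime ∧ ¬ p ∣ q)

lemma PP_succ (q J : ℕ) : PP q (J+1) = PP q J ∪ BB q J := by
  ext p
  have := zz_le_succ J
  simp only [PP, BB, mem_filter, mem_union, mem_range, mem_Ico]
  constructor
  · rintro ⟨h1, h2⟩
    by_cases h : p < zz J
    · exact Or.inl ⟨h, h2⟩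
    · exact Or.inr ⟨⟨by omega, h1⟩, h2⟩
  · rintro (⟨h1, h2⟩ | ⟨h1, h2⟩)
    · exact ⟨by omega, h2⟩
    · exact ⟨h1.2, h2⟩

lemma PP_disj (q J : ℕ) : Disjoint (PP q J) (BB q J) := by
  rw [Finset.disjoint_left]
  intro p h1 h2
  simp only [PP, BB, mem_filter, mem_range, mem_Ico] at h1 h2
  omega

lemma BB_prime {q J p : ℕ} (h : p ∈ BB q J) : p.Prime := (mem_filter.1 h).2.1

lemma PP_prime {q J p : ℕ} (h : p ∈ PP q J) : p.Prime := (mem_filter.1 h).2.1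

lemma dyadic (k : ℕ) (hk : 1 ≤ k) :
    ∑ p ∈ (Ico (2^k) (2^(k+1))).filter Nat.Prime, 1 / (p:ℝ) ≤ 4 / k := by
  have hl2 : 0 < Real.log 2 := Real.log_pos (by norm_num)
  have hk' : (0:ℝ) < k := by exact_mod_cast hk
  have h1 : ∑ p ∈ (Ico (2^k) (2^(k+1))).filter Nat.Prime, 1 / (p:ℝ) ≤
      ∑ p ∈ (Ico (2^k) (2^(k+1))).filter Nat.Prime, Real.log p * (1 / (2^k * (k * Real.log 2))) := by
    refine Finset.sum_le_sum fun p hp => ?_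
    simp only [mem_filter, mem_Ico] at hp
    have hp1 : (2:ℝ)^k ≤ p := by exact_mod_cast hp.1.1
    have h2k : (0:ℝ) < 2^k := by positivity
    have hlog : k * Real.log 2 ≤ Real.log p := by
      rw [← Real.log_pow]; exact Real.log_le_log h2k hp1
    rw [mul_one_div, div_le_div_iff₀ (by linarith) (by positivity)]
    nlinarith [mul_pos hk' hl2]
  have h2 : ∑ p ∈ (Ico (2^k) (2^(k+1))).filter Nat.Prime, Real.log p ≤ Chebyshev.theta ((2:ℝ)^(k+1)) := by
    unfold Chebyshev.theta
    have : ⌊(2:ℝ)^(k+1)⌋₊ = 2^(k+1) := by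
      have : ((2^(k+1) : ℕ) : ℝ) = (2:ℝ)^(k+1) := by push_cast; rfl
      rw [← this, Nat.floor_natCast]
    rw [this]
    refine Finset.sum_le_sum_of_subset_of_nonneg ?_ ?_
    · intro p hp
      simp only [mem_filter, mem_Ico, mem_Ioc] at hp ⊢
      exact ⟨⟨hp.2.pos, by omega⟩, hp.2⟩
    · intro p hp _
      exact Real.log_natCast_nonneg p
  have h3 := Chebyshev.theta_le_log4_mul_x (x := (2:ℝ)^(k+1)) (by positivity)
  have h4 : Real.log 4 = 2 * Real.log 2 := by
    rw [show (4:ℝ) = 2^2 by norm_num, Real.log_pow]; norm_num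
  refine h1.trans ?_
  rw [← Finset.sum_mul, mul_one_div, div_le_div_iff₀ (by positivity) hk']
  have h5 := h2.trans h3
  rw [h4] at h5
  calc _ ≤ 2 * Real.log 2 * 2^(k+1) * k := by gcongr
    _ = _ := by ring

lemma BB_sum (q J : ℕ) : ∑ p ∈ BB q J, 1 / (p:ℝ) ≤ 4 := by
  have h1 : BB q J ⊆ (Ico (2^J) (2^(J+1))).biUnion
      (fun k => (Ico (2^k) (2^(k+1))).filter Nat.Prime) := by
    intro p hp
    simp only [BB, zz, mem_filter, mem_Ico] at hp
    simp only [mem_biUnion, mem_filter, mem_Ico]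
    have hp0 : p ≠ 0 := hp.2.1.ne_zero
    refine ⟨Nat.log 2 p, ⟨Nat.le_log_of_pow_le (by norm_num) hp.1.1,
      Nat.log_lt_of_lt_pow hp0 hp.1.2⟩, ⟨Nat.pow_log_le_self 2 hp0,
      Nat.lt_pow_succ_log_self (by norm_num) p⟩, hp.2.1⟩
  calc _ ≤ ∑ p ∈ ((Ico (2^J) (2^(J+1))).biUnion
          (fun k => (Ico (2^k) (2^(k+1))).filter Nat.Prime)), 1 / (p:ℝ) :=
        Finset.sum_le_sum_of_subset_of_nonneg h1 (fun _ _ _ => by positivity)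
    _ ≤ ∑ k ∈ Ico (2^J) (2^(J+1)), ∑ p ∈ (Ico (2^k) (2^(k+1))).filter Nat.Prime, 1 / (p:ℝ) := by
        rw [Finset.sum_biUnion]
        intro k _ l _ hkl
        rw [Function.onFun, Finset.disjoint_left]
        intro p hp hp'
        simp only [mem_filter, mem_Ico] at hp hp'
        rcases lt_or_gt_of_ne hkl with h | h
        · have : 2^(k+1) ≤ 2^l := Nat.pow_le_pow_right (by norm_num) h
          omega
        · have : 2^(l+1) ≤ 2^k := Nat.pow_le_pow_right (by norm_num) h
          omega
    _ ≤ ∑ k ∈ Ico (2^J) (2^(J+1)), 4 / (2:ℝ)^J := by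
        refine Finset.sum_le_sum fun k hk => ?_
        have hk1 := (mem_Ico.1 hk).1
        have : 1 ≤ 2^J := Nat.one_le_two_pow
        refine (dyadic k (by omega)).trans ?_
        have : (2:ℝ)^J ≤ k := by exact_mod_cast hk1
        gcongr
    _ = 4 := by
        rw [Finset.sum_const, Nat.card_Ico, pow_succ, nsmul_eq_mul,
          show 2^J * 2 - 2^J = 2^J by omega]
        push_cast; field_simp

lemma exp_le_one_sub {x : ℝ} (h0 : 0 ≤ x) (h1 : x ≤ 1/2) : exp (-2*x) ≤ 1 - x := by
  have := Real.add_one_le_exp (2*x)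
  have h2 : exp (-2*x) = (exp (2*x))⁻¹ := by rw [← Real.exp_neg]; ring_nf
  rw [h2, inv_le_comm₀ (by positivity) (by linarith)]
  refine le_trans ?_ this
  rw [inv_le_iff_one_le_mul₀ (by linarith)]; nlinarith

noncomputable def VV (P : Finset ℕ) : ℝ := ∏ p ∈ P, (1 - 1 / (p:ℝ))

lemma prime_inv_le {p : ℕ} (hp : p.Prime) : 1 / (p:ℝ) ≤ 1/2 := by
  have : (2:ℝ) ≤ p := by exact_mod_cast hp.two_le
  gcongr

lemma VV_pos {P : Finset ℕ} (hP : ∀ p ∈ P, p.Prime) : 0 < VV P :=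
  Finset.prod_pos fun p hp => by linarith [prime_inv_le (hP p hp)]

lemma VB_ge (q J : ℕ) : exp (-8) ≤ VV (BB q J) := by
  calc exp (-8) ≤ exp (∑ p ∈ BB q J, -2 * (1/(p:ℝ))) := by
        rw [← Finset.mul_sum]; gcongr; linarith [BB_sum q J]
    _ ≤ _ := by
        rw [Real.exp_sum]
        exact Finset.prod_le_prod (fun _ _ => by positivity)
          (fun p hp => exp_le_one_sub (by positivity) (prime_inv_le (BB_prime hp)))

noncomputable def C0 : ℝ := exp (8 + 4 * exp 16)

lemma esyB (q J b : ℕ) : esy (BB q J) (fun p => 1/(p:ℝ)) (b+1) ≤ C0 * exp (-16*b) * VV (BB q J) := by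
  have h1 := esy_le (BB q J) (fun p => 1/(p:ℝ)) (fun _ _ => by positivity) (b+1) (exp_pos 16)
  have h2 : exp (exp 16 * ∑ p ∈ BB q J, 1/(p:ℝ)) ≤ exp (4 * exp 16) := by
    have := BB_sum q J
    have := exp_pos 16
    refine Real.exp_le_exp.2 ?_
    nlinarith
  have h3 := VB_ge q J
  have h4 : (exp 16)^(b+1) = exp (16 * b) * exp 16 := by
    rw [← Real.exp_nat_mul, ← Real.exp_add]; push_cast; ring_nf
  calc _ ≤ exp (4 * exp 16) / exp (16 * b) := by
        refine h1.trans ?_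
        rw [h4]
        have : (1:ℝ) ≤ exp 16 := Real.one_le_exp (by norm_num)
        have h5 : exp (16 * b) ≤ exp (16*b) * exp 16 := le_mul_of_one_le_right (by positivity) this
        gcongr
    _ = C0 * exp (-16*b) * exp (-8) := by
        unfold C0
        rw [← Real.exp_sub, ← Real.exp_add, ← Real.exp_add]; ring_nf
    _ ≤ _ := by
        have : 0 < C0 := exp_pos _
        gcongr

noncomputable def ind (P : Finset ℕ) (n : ℕ) : ℝ := ∏ p ∈ P, (1 - dvi n p)

lemma dvi_nonneg (n p : ℕ) : 0 ≤ dvi n p := by unfold dvi; split_ifs <;> norm_num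
lemma dvi_le (n p : ℕ) : dvi n p ≤ 1 := by unfold dvi; split_ifs <;> norm_num

lemma ind_nonneg (P : Finset ℕ) (n : ℕ) : 0 ≤ ind P n :=
  Finset.prod_nonneg fun p _ => by linarith [dvi_le n p]

lemma card_BB (q J : ℕ) : ((BB q J).card : ℝ) + 1 ≤ zz (J+1) := by
  have h : (BB q J).card ≤ zz (J+1) - zz J := by
    rw [← Nat.card_Ico]; exact Finset.card_le_card (Finset.filter_subset _ _)
  have h2 := two_le_zz J
  have h3 := two_le_zz (J+1)
  have : (BB q J).card + 1 ≤ zz (J+1) := by omega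
  exact_mod_cast this

set_option maxHeartbeats 1000000 in
lemma fl (q J : ℕ) : ∀ b : ℕ, Even b → C0 * exp (-16*b) ≤ 1 → ∃ U E : ℕ → ℝ, ∃ mU mE : ℝ,
    Rep (PP q J) U mU ((zz J : ℝ)^(2*b+10)) ∧ Rep (PP q J) E mE ((zz J : ℝ)^(2*b+10)) ∧
    (∀ n, 0 ≤ U n - ind (PP q J) n ∧ U n - ind (PP q J) n ≤ E n) ∧
    0 ≤ mU ∧ 0 ≤ mE ∧ mU ≤ (1 + 2 * (C0 * exp (-16*b))) * VV (PP q J) ∧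
    mE ≤ 2 * (C0 * exp (-16*b)) * VV (PP q J) := by
  induction J with
  | zero =>
    intro b _ hb1
    have hP : PP q 0 = ∅ := by
      rw [Finset.eq_empty_iff_forall_notMem]
      intro p hp
      have h1 := PP_prime hp
      have h2 := (mem_filter.1 hp).1
      simp only [zz, mem_range, pow_zero, pow_one] at h2
      exact absurd h1.two_le (by omega)
    have h0 : 0 < C0 * exp (-16*b) := mul_pos (exp_pos _) (exp_pos _)
    have hz : (1:ℝ) ≤ (zz 0 : ℝ)^(2*b+10) := by
      refine one_le_pow₀ ?_
      have := two_le_zz 0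
      exact_mod_cast (by omega : 1 ≤ zz 0)
    rw [hP]
    have r1 := rep_esy (P := ∅) (by simp) 0 1 (by simp)
    have r2 := rep_esy (P := ∅) (by simp) 1 1 (by simp)
    refine ⟨_, _, _, _, r1.mono (Finset.Subset.refl _) (by simpa using hz),
      r2.mono (Finset.Subset.refl _) (by simp), ?_, ?_, ?_, ?_, ?_⟩
    · intro n; simp [esy_zero, esy_empty _ 0, ind]
    · simp [esy_zero]
    · simp [esy_empty _ 0]
    · simp only [esy_zero, VV, prod_empty]; linarith
    · simp only [esy_empty _ 0, VV, prod_empty]; linarith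
  | succ J ih =>
    intro b hb hb1
    set ε := C0 * exp (-16*b) with hε
    have hε0 : 0 < ε := mul_pos (exp_pos _) (exp_pos _)
    have hε' : C0 * exp (-16*((b+2 : ℕ):ℝ)) = ε * exp (-32) := by
      rw [hε, mul_assoc, ← Real.exp_add]; push_cast; ring_nf
    have he32 : exp (-32) ≤ 1/33 := by
      rw [Real.exp_neg, inv_eq_one_div]
      have := Real.add_one_le_exp 32
      gcongr; linarith
    have he0 := exp_pos (-32)
    obtain ⟨U1, E1, m1, e1, rU1, rE1, hn1, m1n, e1n, hm1, he1⟩ := ih (b+2) (hb.add even_two)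
      (by rw [hε']; nlinarith)
    rw [hε'] at hm1 he1
    have rU2 := rep_mtr (P := BB q J) (fun p hp => BB_prime hp) b
    have rE2 := rep_esy (P := BB q J) (fun p hp => BB_prime hp) (b+1) 1 (by simp)
    have hpm : (-1:ℝ)^b = 1 := hb.neg_one_pow
    have hn2 : ∀ n, 0 ≤ mtr (BB q J) (dvi n) b - ind (BB q J) n ∧
        mtr (BB q J) (dvi n) b - ind (BB q J) n ≤ 1 * esy (BB q J) (dvi n) (b+1) := by
      intro n
      have := bonf (BB q J) (dvi n) (fun p _ => dvi_nonneg n p) (fun p _ => dvi_le n p) b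
      rw [hpm] at this
      simpa [ind] using this
    have hm2 := bonf (BB q J) (fun p => 1/(p:ℝ)) (fun _ _ => by positivity)
      (fun p hp => by linarith [prime_inv_le (BB_prime hp)]) b
    rw [hpm, one_mul] at hm2
    have hE2 := esyB q J b
    rw [← hε] at hE2
    have hE2n : 0 ≤ esy (BB q J) (fun p => 1/(p:ℝ)) (b+1) := esy_nonneg (fun _ _ => by positivity) _
    have hV1 : 0 < VV (PP q J) := VV_pos fun p hp => PP_prime hp
    have hV2 : 0 < VV (BB q J) := VV_pos fun p hp => BB_prime hp
    have hVV : VV (PP q (J+1)) = VV (PP q J) * VV (BB q J) := by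
      unfold VV; rw [PP_succ, Finset.prod_union (PP_disj q J)]
    have hind : ∀ n, ind (PP q (J+1)) n = ind (PP q J) n * ind (BB q J) n := by
      intro n; unfold ind; rw [PP_succ, Finset.prod_union (PP_disj q J)]
    have hzJ : (0:ℝ) ≤ (zz J : ℝ)^(2*(b+2)+10) := by positivity
    have rU := rU1.mul rU2 hzJ (PP_disj q J)
    have rE := (rE1.mul rU2 hzJ (PP_disj q J)).add (rU1.mul rE2 hzJ (PP_disj q J))
    rw [← PP_succ] at rU rE
    have hz2 : (2:ℝ) ≤ zz (J+1) := by exact_mod_cast two_le_zz (J+1)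
    set z : ℝ := (zz (J+1) : ℝ) with hz
    have hN1 : (zz J : ℝ)^(2*(b+2)+10) = z^(b+7) := by
      rw [hz, zz_succ]; push_cast; rw [← pow_mul]; ring_nf
    have hcard := card_BB q J
    have hN2 : ((BB q J).card + 1 : ℝ)^b ≤ z^b := by gcongr
    have hN3 : ((BB q J).card : ℝ)^(b+1) ≤ z^(b+1) := by gcongr; linarith
    have hUV : mtr (BB q J) (fun p => 1/(p:ℝ)) b ≤ (1 + ε) * VV (BB q J) := by
      have := hm2.2; unfold VV at *; linarith
    have hUn : 0 ≤ mtr (BB q J) (fun p => 1/(p:ℝ)) b := by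
      have := hm2.1; unfold VV at hV2; linarith
    set V1 := VV (PP q J)
    set V2 := VV (BB q J)
    set m2 := mtr (BB q J) (fun p => 1/(p:ℝ)) b
    set e2 := esy (BB q J) (fun p => 1/(p:ℝ)) (b+1)
    set δ := exp (-32)
    have hx0 : 0 < ε * δ := mul_pos hε0 he0
    have hx1 : ε * δ ≤ ε / 33 := by nlinarith
    have hx2 : ε * δ * ε ≤ ε * δ := mul_le_of_le_one_right hx0.le hb1
    have hV12 : 0 < V1 * V2 := mul_pos hV1 hV2
    refine ⟨_, _, _, _, rU.mono (Finset.Subset.refl _) ?_, rE.mono (Finset.Subset.refl _) ?_,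
      ?_, ?_, ?_, ?_, ?_⟩
    · rw [hN1]
      calc _ ≤ z^(b+7) * z^b := by gcongr
        _ = z^(2*b+7) := by rw [← pow_add]; ring_nf
        _ ≤ _ := pow_le_pow_right₀ (by linarith) (by omega)
    · rw [hN1]
      calc _ ≤ z^(b+7) * z^b + z^(b+7) * z^(b+1) := by gcongr
        _ = z^(2*b+7) * 1 + z^(2*b+7) * z := by ring
        _ ≤ z^(2*b+7) * z + z^(2*b+7) * z := by gcongr; linarith
        _ = z^(2*b+7) * 2 * z := by ring
        _ ≤ z^(2*b+7) * z * z := by gcongr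
        _ = z^(2*b+9) := by ring
        _ ≤ _ := pow_le_pow_right₀ (by linarith) (by omega)
    · intro n
      obtain ⟨a1, a2⟩ := hn1 n
      obtain ⟨a3, a4⟩ := hn2 n
      have i1 := ind_nonneg (PP q J) n
      have i2 := ind_nonneg (BB q J) n
      rw [hind]
      constructor
      · nlinarith
      · have t1 : (U1 n - ind (PP q J) n) * mtr (BB q J) (dvi n) b ≤ E1 n * mtr (BB q J) (dvi n) b :=
          mul_le_mul_of_nonneg_right a2 (by linarith)
        have t2 : ind (PP q J) n * (mtr (BB q J) (dvi n) b - ind (BB q J) n) ≤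
          U1 n * (1 * esy (BB q J) (dvi n) (b+1)) := mul_le_mul (by linarith) a4 a3 (by linarith)
        linarith
    · positivity
    · positivity
    · rw [hVV]
      calc m1 * m2 ≤ ((1 + 2 * (ε*δ)) * V1) * ((1+ε) * V2) := by gcongr
        _ = ((1 + 2 * (ε*δ)) * (1+ε)) * (V1 * V2) := by ring
        _ ≤ _ := by refine mul_le_mul_of_nonneg_right ?_ hV12.le; linarith
    · rw [hVV]
      calc e1 * m2 + m1 * (1 * e2) ≤ (2 * (ε*δ) * V1) * ((1+ε) * V2) +
            ((1 + 2 * (ε*δ)) * V1) * (1 * (ε * V2)) := by gcongr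
        _ = (2 * (ε*δ) * (1+ε) + (1 + 2 * (ε*δ)) * ε) * (V1 * V2) := by ring
        _ ≤ _ := by refine mul_le_mul_of_nonneg_right ?_ hV12.le; linarith

end Gal

namespace Gal

lemma count_ap (q d u : ℕ) (hq : 0 < q) (hd : 0 < d) (hc : Nat.Coprime d q) (a : ZMod q) :
    |∑ n ∈ (Ioc 0 u).filter (fun n : ℕ => (n : ZMod q) = a), (if d ∣ n then (1:ℝ) else 0)
      - u / (d * q)| ≤ 1 := by
  have : NeZero q := ⟨hq.ne'⟩
  obtain ⟨c, hc1, hc2⟩ := Nat.chineseRemainder hc 0 a.val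
  have h1 : ((Ioc 0 u).filter (fun n : ℕ => (n : ZMod q) = a)).filter (fun n => d ∣ n) =
      (Ioc 0 u).filter (fun n => n ≡ c [MOD (d*q)]) := by
    ext n
    simp only [mem_filter, and_assoc, and_congr_right_iff]
    intro _
    rw [← Nat.modEq_and_modEq_iff_modEq_mul hc]
    have e1 : d ∣ n ↔ n ≡ c [MOD d] := by
      rw [← Nat.modEq_zero_iff_dvd]
      exact ⟨fun h => h.trans hc1.symm, fun h => h.trans hc1⟩
    have e2 : (n : ZMod q) = a ↔ n ≡ c [MOD q] := by
      rw [← ZMod.natCast_eq_natCast_iff]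
      have : ((c:ℕ) : ZMod q) = a := by
        rw [(ZMod.natCast_eq_natCast_iff _ _ _).2 hc2, ZMod.natCast_zmod_val]
      rw [this]
    rw [e1, e2, and_comm]
  rw [← Finset.sum_filter, h1, Finset.sum_const, nsmul_eq_mul, mul_one]
  have hdq : 0 < d * q := Nat.mul_pos hd hq
  have h2 := Nat.Ioc_filter_modEq_card 0 u hdq c
  have hdqQ : (0:ℚ) < ((d*q : ℕ) : ℚ) := by exact_mod_cast hdq
  rw [max_eq_left] at h2
  · have h3 := Int.floor_le (((u:ℚ) - c) / ((d*q : ℕ) : ℚ))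
    have h4 := Int.lt_floor_add_one (((u:ℚ) - c) / ((d*q : ℕ) : ℚ))
    have h5 := Int.floor_le ((((0:ℕ):ℚ) - c) / ((d*q : ℕ) : ℚ))
    have h6 := Int.lt_floor_add_one ((((0:ℕ):ℚ) - c) / ((d*q : ℕ) : ℚ))
    have h7 : (((Ioc 0 u).filter (fun n => n ≡ c [MOD (d*q)])).card : ℚ) =
      (⌊((u:ℚ) - c) / ((d*q : ℕ) : ℚ)⌋ : ℚ) - (⌊(((0:ℕ):ℚ) - c) / ((d*q : ℕ) : ℚ)⌋ : ℚ) := by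
      exact_mod_cast h2
    have h8 : |(((Ioc 0 u).filter (fun n => n ≡ c [MOD (d*q)])).card : ℚ) - u / (d * q)| ≤ 1 := by
      rw [h7]
      have e : (u:ℚ) / (d*q) = ((u:ℚ) - c) / ((d*q : ℕ) : ℚ) - (((0:ℕ):ℚ) - c) / ((d*q : ℕ) : ℚ) := by
        push_cast; ring
      rw [e, abs_le]
      constructor <;> linarith
    have h9 := (Rat.cast_le (K := ℝ)).2 h8
    push_cast at h9 ⊢
    exact h9
  · rw [sub_nonneg]
    apply Int.floor_le_floor
    have : (0:ℚ) ≤ u := by positivity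
    gcongr
    exact Nat.zero_le _

lemma repsum {q J u : ℕ} (hq : 0 < q) {g : ℕ → ℝ} {m N : ℝ} (h : Rep (PP q J) g m N) (a : ZMod q) :
    |∑ n ∈ (Ioc 0 u).filter (fun n : ℕ => (n : ZMod q) = a), g n - m * u / q| ≤ N := by
  obtain ⟨ι, _, d, c, h1, h2, h3, h4⟩ := h
  have hcop : ∀ i, Nat.Coprime (d i) q := fun i => Nat.coprime_of_dvd fun p hp hd hd' =>
    (mem_filter.1 ((h1 i).2 p hp hd)).2.2 hd'
  have e : ∑ n ∈ (Ioc 0 u).filter (fun n : ℕ => (n : ZMod q) = a), g n - m * u / q =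
      ∑ i, c i * (∑ n ∈ (Ioc 0 u).filter (fun n : ℕ => (n : ZMod q) = a),
        (if d i ∣ n then (1:ℝ) else 0) - u / (d i * q)) := by
    simp only [h2, mul_sub, Finset.sum_sub_distrib]
    rw [Finset.sum_comm]
    congr 1
    · refine Finset.sum_congr rfl fun i _ => by rw [Finset.mul_sum]
    · rw [← h3, Finset.sum_mul, Finset.sum_div]
      refine Finset.sum_congr rfl fun i _ => ?_
      rw [div_mul_eq_mul_div, div_div, mul_div_assoc]
  rw [e]
  refine (Finset.abs_sum_le_sum_abs _ _).trans (le_trans ?_ h4)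
  refine Finset.sum_le_sum fun i _ => ?_
  rw [abs_mul]
  exact mul_le_of_le_one_right (abs_nonneg _)
    (count_ap q (d i) u hq (Nat.pos_of_ne_zero (h1 i).1) (hcop i) a)

open Classical in
/-- rough-number indicator -/
noncomputable def rr (J n : ℕ) : ℝ := if ∀ p < zz J, p.Prime → ¬ p ∣ n then 1 else 0

lemma rr_nonneg (J n : ℕ) : 0 ≤ rr J n := by unfold rr; split_ifs <;> norm_num
lemma rr_le (J n : ℕ) : rr J n ≤ 1 := by unfold rr; split_ifs <;> norm_num

lemma ind_eq {q J n : ℕ} (h : Nat.Coprime n q) : ind (PP q J) n = rr J n := by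
  unfold ind rr
  split_ifs with h1
  · refine Finset.prod_eq_one fun p hp => ?_
    have := (mem_filter.1 hp)
    simp [dvi, h1 p (mem_range.1 this.1) this.2.1]
  · push Not at h1
    obtain ⟨p, hp, hpp, hpn⟩ := h1
    refine Finset.prod_eq_zero (i := p) ?_ (by simp [dvi, hpn])
    refine mem_filter.2 ⟨mem_range.2 hp, hpp, fun hd => ?_⟩
    exact Nat.not_coprime_of_dvd_of_dvd hpp.one_lt hpn hd h

noncomputable def SS (J q : ℕ) (a : ZMod q) (u : ℕ) : ℝ :=
  ∑ n ∈ (Ioc 0 u).filter (fun n : ℕ => (n : ZMod q) = a), rr J n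

lemma fls (q J b : ℕ) (hq : 0 < q) (hb : Even b) (hb1 : C0 * exp (-16*b) ≤ 1) : ∃ m e : ℝ,
    0 ≤ m ∧ 0 ≤ e ∧ m ≤ 3 * VV (PP q J) ∧ e ≤ 2 * (C0 * exp (-16*b)) * VV (PP q J) ∧
    ∀ a : ZMod q, IsUnit a → ∀ u : ℕ, SS J q a u ≤ m * u / q + (zz J : ℝ)^(2*b+10) ∧
      m * u / q - e * u / q - 2 * (zz J : ℝ)^(2*b+10) ≤ SS J q a u := by
  obtain ⟨U, E, m, e, rU, rE, hn, hm, he, hm1, he1⟩ := fl q J b hb hb1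
  have hV := VV_pos (P := PP q J) fun p hp => PP_prime hp
  refine ⟨m, e, hm, he, ?_, he1, ?_⟩
  · refine hm1.trans ?_; gcongr; linarith
  intro a ha u
  have h1 := abs_le.1 (repsum (u := u) hq rU a)
  have h2 := abs_le.1 (repsum (u := u) hq rE a)
  have hS : SS J q a u = ∑ n ∈ (Ioc 0 u).filter (fun n : ℕ => (n : ZMod q) = a), ind (PP q J) n := by
    refine Finset.sum_congr rfl fun n hn => (ind_eq ?_).symm
    rw [← ZMod.isUnit_iff_coprime, (mem_filter.1 hn).2]; exact ha
  have h3 : 0 ≤ ∑ n ∈ (Ioc 0 u).filter (fun n : ℕ => (n : ZMod q) = a), (U n - ind (PP q J) n) :=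
    Finset.sum_nonneg fun n _ => (hn n).1
  have h4 : ∑ n ∈ (Ioc 0 u).filter (fun n : ℕ => (n : ZMod q) = a), (U n - ind (PP q J) n) ≤
      ∑ n ∈ (Ioc 0 u).filter (fun n : ℕ => (n : ZMod q) = a), E n :=
    Finset.sum_le_sum fun n _ => (hn n).2
  rw [Finset.sum_sub_distrib, ← hS] at h3 h4
  constructor <;> linarith [h1.1, h1.2, h2.1, h2.2]

/-- Euler product lower bound -/
lemma euler_low (z : ℕ) (hz : 1 ≤ z) : Real.log z ≤ ∏ p ∈ z.primesBelow, (1 - 1/(p:ℝ))⁻¹ := by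
  obtain ⟨f, hfe⟩ : ∃ f : ℕ →* ℝ, ∀ n, f n = 1 / (n:ℝ) :=
    ⟨{ toFun := fun n => 1 / (n:ℝ)
       map_one' := by simp
       map_mul' := by intro a b; push_cast; rw [one_div_mul_one_div] }, fun _ => rfl⟩
  have hf : ∀ {p : ℕ}, p.Prime → ‖f p‖ < 1 := by
    intro p hp
    rw [hfe, Real.norm_of_nonneg (by positivity)]
    linarith [prime_inv_le hp]
  have h := (EulerProduct.summable_and_hasSum_smoothNumbers_prod_primesBelow_geometric hf z).2
  have h' := (hasSum_subtype_iff_indicator (f := fun n => f n) (s := z.smoothNumbers)).1 h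
  have h2 := sum_le_hasSum (Ioc 0 (z-1)) (fun i _ => Set.indicator_nonneg
    (fun n _ => by rw [hfe]; positivity) i) h'
  refine le_trans ?_ (h2.trans (le_of_eq (Finset.prod_congr rfl fun p _ => by rw [hfe])))
  have h3 : ∑ i ∈ Ioc 0 (z-1), (z.smoothNumbers).indicator (fun n => f n) i =
      ∑ i ∈ Ioc 0 (z-1), ((i:ℝ))⁻¹ := by
    refine Finset.sum_congr rfl fun i hi => ?_
    have hi' := mem_Ioc.1 hi
    rw [Set.indicator_of_mem]
    · rw [hfe, one_div]
    · exact Nat.mem_smoothNumbers_of_lt hi'.1 (by omega)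
  rw [h3]
  have h4 := log_add_one_le_harmonic (z-1)
  rw [Nat.sub_add_cancel hz] at h4
  refine h4.trans (le_of_eq ?_)
  rw [harmonic_eq_sum_Icc]; push_cast
  refine Finset.sum_congr ?_ fun _ _ => rfl
  ext i; simp [Nat.succ_le_iff]

lemma VV_le {q J : ℕ} (hq : 0 < q) (hqz : q < zz J) :
    VV (PP q J) / q ≤ 1 / (q.totient * Real.log (zz J)) := by
  have hz := two_le_zz J
  have h1 := euler_low (zz J) (by omega)
  have hl : 0 < Real.log (zz J) := Real.log_pos (by exact_mod_cast (by omega : 1 < zz J))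
  have ht : (0:ℝ) < q.totient := by exact_mod_cast Nat.totient_pos.2 hq
  have hq' : (0:ℝ) < q := by exact_mod_cast hq
  have h2 : (q.totient : ℝ) = q * ∏ p ∈ q.primeFactors, (1 - (p:ℝ)⁻¹) := by
    have := Nat.totient_eq_mul_prod_factors q
    have h9 := congrArg (fun x : ℚ => (x:ℝ)) this
    push_cast at h9
    exact h9
  have h3 : (zz J).primesBelow = PP q J ∪ q.primeFactors := by
    ext p
    simp only [Nat.mem_primesBelow, PP, mem_union, mem_filter, mem_range, Nat.mem_primeFactors]
    constructor
    · rintro ⟨a, b⟩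
      by_cases hd : p ∣ q
      · exact Or.inr ⟨b, hd, hq.ne'⟩
      · exact Or.inl ⟨a, b, hd⟩
    · rintro (⟨a, b, _⟩ | ⟨a, b, _⟩)
      · exact ⟨a, b⟩
      · exact ⟨(Nat.le_of_dvd hq b).trans_lt hqz, a⟩
  have h4 : Disjoint (PP q J) q.primeFactors := by
    rw [Finset.disjoint_left]; intro p hp hp'
    exact (mem_filter.1 hp).2.2 (Nat.dvd_of_mem_primeFactors hp')
  rw [Finset.prod_inv_distrib, h3, Finset.prod_union h4] at h1
  have hV := VV_pos (P := PP q J) fun p hp => PP_prime hp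
  have h5 : 0 < ∏ p ∈ q.primeFactors, (1 - 1/(p:ℝ)) := VV_pos (fun p hp => Nat.prime_of_mem_primeFactors hp)
  rw [div_le_div_iff₀ hq' (by positivity), h2]
  simp only [← one_div]
  change Real.log (zz J) ≤ (VV (PP q J) * _)⁻¹ at h1
  rw [le_inv_comm₀ hl (by positivity), le_inv_comm₀ (by positivity) hl] at h1
  have h6 : (VV (PP q J) * ∏ p ∈ q.primeFactors, (1 - 1/(p:ℝ))) * Real.log (zz J) ≤ 1 := by
    calc _ ≤ (VV (PP q J) * ∏ p ∈ q.primeFactors, (1 - 1/(p:ℝ))) *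
        (VV (PP q J) * ∏ p ∈ q.primeFactors, (1 - 1/(p:ℝ)))⁻¹ := by gcongr
      _ = 1 := mul_inv_cancel₀ (by positivity)
  nlinarith

end Gal

namespace Gal

lemma exists_b0 : ∃ b : ℕ, Even b ∧ C0 * exp (-16*b) ≤ 1 := by
  obtain ⟨n, hn⟩ := exists_nat_ge (8 + 4 * exp 16)
  refine ⟨2*n, even_two_mul n, ?_⟩
  unfold C0
  rw [← Real.exp_add]
  rw [Real.exp_le_one_iff]
  push_cast
  have : (0:ℝ) ≤ n := by positivity
  linarith

lemma zz_add (J i : ℕ) : zz (J + i) = zz J ^ (2^i) := by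
  unfold zz; rw [← pow_mul, pow_add]

lemma log_zz_pos (J : ℕ) : 0 < Real.log (zz J) :=
  Real.log_pos (by exact_mod_cast (by have := two_le_zz J; omega : 1 < zz J))

lemma log_zz_add (J i : ℕ) : Real.log (zz (J+i)) = 2^i * Real.log (zz J) := by
  rw [log_zz, log_zz]; ring

lemma SS_nonneg (J q : ℕ) (a : ZMod q) (u : ℕ) : 0 ≤ SS J q a u :=
  Finset.sum_nonneg fun _ _ => rr_nonneg _ _

lemma log_le_self' {x : ℝ} (hx : 0 < x) : Real.log x ≤ x := by
  linarith [Real.log_le_sub_one_of_pos hx]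

lemma rr_anti {J J' : ℕ} (h : J' ≤ J) (n : ℕ) : rr J n ≤ rr J' n := by
  unfold rr
  split_ifs with h1 h2 h3
  · exact le_rfl
  · exact absurd (fun p hp => h1 p (hp.trans_le (zz_mono h))) h2
  · norm_num
  · exact le_rfl

lemma SS_upper : ∃ i : ℕ, 5 ≤ i ∧ ∃ C : ℝ, 0 < C ∧ ∀ q J : ℕ, 0 < q → i ≤ J → q ≤ zz (J - i) →
    ∀ a : ZMod q, IsUnit a → ∀ u : ℕ, zz J ≤ u →
    SS J q a u ≤ C * u / (q.totient * Real.log (zz J)) := by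
  obtain ⟨b, hb, hb1⟩ := exists_b0
  set i0 := 2*b+13 with hi0
  refine ⟨2*i0+2, by omega, 3*2^i0+1, by positivity, ?_⟩
  intro q J hq hJ hqz a ha u hu
  obtain ⟨m, e, hm, he, hm1, -, H⟩ := fls q (J - i0) b hq hb hb1
  have hqw : q < zz (J - i0) := by
    have h1 : zz (J - i0) = zz (J - (2*i0+2)) ^ (2^(i0+2)) := by
      rw [← zz_add]; congr 1; omega
    have h2 := two_le_zz (J - (2*i0+2))
    rw [h1]
    refine hqz.trans_lt ?_
    calc _ = zz (J - (2*i0+2)) ^ 1 := (pow_one _).symm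
      _ < _ := Nat.pow_lt_pow_right (by omega) (Nat.one_lt_two_pow (by omega))
  have hV := VV_le hq hqw
  set w := zz (J - i0) with hw
  have hz : zz J = w ^ (2^i0) := by rw [hw, ← zz_add]; congr 1; omega
  have hlz : Real.log (zz J) = 2^i0 * Real.log w := by
    rw [hw, ← log_zz_add]; congr 3; omega
  have hw2 : 2^i0 ≤ w := by
    rw [hw]; unfold zz
    refine Nat.pow_le_pow_right (by norm_num) ?_
    calc i0 ≤ 2^i0 := Nat.lt_two_pow_self.le
      _ ≤ _ := Nat.pow_le_pow_right (by norm_num) (by omega)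
  have hlw : 0 < Real.log w := log_zz_pos _
  have hlz0 : 0 < Real.log (zz J) := log_zz_pos _
  have hw0 : (2:ℝ) ≤ w := by exact_mod_cast two_le_zz _
  have ht : (0:ℝ) < q.totient := by exact_mod_cast Nat.totient_pos.2 hq
  have htq : (q.totient : ℝ) ≤ w := by
    exact_mod_cast (Nat.totient_le q).trans hqw.le
  have hq' : (0:ℝ) < q := by exact_mod_cast hq
  have hSS : SS J q a u ≤ SS (J - i0) q a u :=
    Finset.sum_le_sum fun n _ => rr_anti (by omega) n
  refine hSS.trans ((H a ha u).1.trans ?_)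
  have hu' : ((zz J : ℕ) : ℝ) ≤ u := by exact_mod_cast hu
  have t1 : m * u / q ≤ 3 * 2^i0 * u / (q.totient * Real.log (zz J)) := by
    calc m * u / q ≤ 3 * VV (PP q (J-i0)) * u / q := by gcongr
      _ = 3 * u * (VV (PP q (J - i0)) / q) := by ring
      _ ≤ 3 * u * (1 / (q.totient * Real.log w)) := by gcongr
      _ = _ := by rw [hlz]; field_simp
  have t2 : (w:ℝ)^(2*b+10) ≤ u / (q.totient * Real.log (zz J)) := by
    rw [le_div_iff₀ (by positivity)]
    refine le_trans ?_ hu'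
    have : (2:ℝ)^i0 ≤ w := by exact_mod_cast hw2
    calc (w:ℝ)^(2*b+10) * (q.totient * Real.log (zz J)) ≤ (w:ℝ)^(2*b+10) * (w * (w * w)) := by
          rw [hlz]
          have := log_le_self' (x := (w:ℝ)) (by linarith)
          gcongr
      _ = (w:ℝ)^i0 := by rw [hi0]; ring
      _ ≤ (w:ℝ)^(2^i0) := pow_le_pow_right₀ (by linarith) Nat.lt_two_pow_self.le
      _ = _ := by rw [hz]; push_cast; rfl
  calc _ ≤ 3 * 2^i0 * u / (q.totient * Real.log (zz J)) + u / (q.totient * Real.log (zz J)) :=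
        add_le_add t1 t2
    _ = _ := by ring

lemma SS_dev : ∃ i : ℕ, 5 ≤ i ∧ ∃ C : ℝ, 0 < C ∧ ∀ q J : ℕ, 0 < q → i ≤ J → q ≤ zz (J - i) →
    ∀ a a' : ZMod q, IsUnit a → IsUnit a' → ∀ u : ℕ, zz J ≤ u →
    |SS J q a u - SS J q a' u| ≤
      C * (u * exp (-2 * (Real.log u / Real.log (zz J)))) / (q.totient * Real.log (zz J)) := by
  obtain ⟨i, hi5, C, hC, Hi⟩ := SS_upper
  set S1 : ℝ := 64 + 4 * exp 16 with hS1
  have hS1p : 64 ≤ S1 := by rw [hS1]; linarith [exp_pos 16]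
  have hC0 : 0 < C0 := exp_pos _
  refine ⟨i, hi5, C * exp (2*S1) + 2 * C0 + 3, by positivity, ?_⟩
  intro q J hq hJ hqz a a' ha ha' u hu
  have hl := log_zz_pos J
  have ht : (0:ℝ) < q.totient := by exact_mod_cast Nat.totient_pos.2 hq
  have hq' : (0:ℝ) < q := by exact_mod_cast hq
  set L := Real.log (zz J) with hL
  set s := Real.log u / L with hs
  have hz2 : (2:ℝ) ≤ zz J := by exact_mod_cast two_le_zz J
  have hu' : ((zz J : ℕ) : ℝ) ≤ u := by exact_mod_cast hu
  have hu0 : (0:ℝ) < u := by linarith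
  have hlogu : Real.log u = s * L := by rw [hs]; field_simp
  have hue : (u:ℝ) = exp (s * L) := by rw [← hlogu, Real.exp_log hu0]
  by_cases hsS : s ≤ S1
  · have h1 := Hi q J hq hJ hqz a ha u hu
    have h2 := Hi q J hq hJ hqz a' ha' u hu
    have h3 := SS_nonneg J q a u
    have h4 := SS_nonneg J q a' u
    have h5 : |SS J q a u - SS J q a' u| ≤ C * u / (q.totient * L) := by
      rw [abs_le]; constructor <;> linarith
    refine h5.trans ?_
    refine div_le_div_of_nonneg_right ?_ (by positivity)
    have h6 : 1 ≤ exp (2*S1) * exp (-2*s) := by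
      rw [← Real.exp_add]; apply Real.one_le_exp; linarith
    calc C * u = C * u * 1 := by ring
      _ ≤ C * u * (exp (2*S1) * exp (-2*s)) := by gcongr
      _ = C * exp (2*S1) * (u * exp (-2*s)) := by ring
      _ ≤ _ := by
        refine mul_le_mul_of_nonneg_right ?_ (by positivity)
        linarith
  · push Not at hsS
    set b := 2 * ⌈s/16⌉₊ with hb
    have hb1 : s/8 ≤ b := by
      have := Nat.le_ceil (s/16); rw [hb]; push_cast; linarith
    have hb2 : (b:ℝ) ≤ s/8 + 2 := by
      have := Nat.ceil_lt_add_one (a := s/16) (by linarith); rw [hb]; push_cast; linarith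
    have heb : exp (-16*b) ≤ exp (-2*s) := Real.exp_le_exp.2 (by linarith)
    have hcb : C0 * exp (-16*b) ≤ 1 := by
      unfold C0; rw [← Real.exp_add, Real.exp_le_one_iff]; linarith
    obtain ⟨m, e, hm, he, -, he1, H⟩ := fls q J b hq (even_two_mul _) hcb
    have hqJ : q < zz J := by
      refine hqz.trans_lt ?_
      have h1 : zz J = zz (J - i) ^ (2^i) := by rw [← zz_add]; congr 1; omega
      have h2 := two_le_zz (J - i)
      rw [h1]
      calc _ = zz (J - i) ^ 1 := (pow_one _).symm
        _ < _ := Nat.pow_lt_pow_right (by omega) (Nat.one_lt_two_pow (by omega))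
    have hV := VV_le hq hqJ
    rw [← hL] at hV
    have h1 := H a ha u
    have h2 := H a' ha' u
    have h3 : |SS J q a u - SS J q a' u| ≤ e * u / q + 3 * (zz J : ℝ)^(2*b+10) := by
      rw [abs_le]; constructor <;> linarith [h1.1, h1.2, h2.1, h2.2]
    refine h3.trans ?_
    have hL16 : 16 ≤ L := by
      rw [hL, log_zz]
      have h5 : (2:ℝ)^5 ≤ 2^J := pow_le_pow_right₀ (by norm_num) (by omega)
      have := Real.log_two_gt_d9
      nlinarith
    have t1 : e * u / q ≤ 2 * C0 * (u * exp (-2*s)) / (q.totient * L) := by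
      calc e * u / q ≤ 2 * (C0 * exp (-2*s)) * VV (PP q J) * u / q := by
            have := VV_pos (P := PP q J) fun p hp => PP_prime hp
            gcongr
            exact he1.trans (by gcongr)
        _ = 2 * (C0 * exp (-2*s)) * u * (VV (PP q J) / q) := by ring
        _ ≤ 2 * (C0 * exp (-2*s)) * u * (1 / (q.totient * L)) := by gcongr
        _ = _ := by ring
    have t2 : (zz J : ℝ)^(2*b+10) ≤ (u * exp (-2*s)) / (q.totient * L) := by
      rw [le_div_iff₀ (by positivity)]
      have e1 : (zz J : ℝ) = exp L := by rw [hL, Real.exp_log (by linarith)]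
      have e2 : (zz J : ℝ)^(2*b+10) = exp ((2*b+10) * L) := by
        rw [e1, ← Real.exp_nat_mul]; push_cast; rfl
      have e3 : (q.totient : ℝ) ≤ exp L := by
        rw [← e1]; exact_mod_cast (Nat.totient_le q).trans hqJ.le
      have e4 : L ≤ exp L := by linarith [Real.add_one_le_exp L]
      calc _ ≤ exp ((2*b+10) * L) * (exp L * exp L) := by rw [e2]; gcongr
        _ = exp ((2*b+10)*L + (L + L)) := by rw [Real.exp_add, Real.exp_add]
        _ ≤ exp (s*L + (-2*s)) := by
          apply Real.exp_le_exp.2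
          nlinarith
        _ = _ := by rw [Real.exp_add, ← hue]
    calc _ ≤ 2 * C0 * (u * exp (-2*s)) / (q.totient * L) + 3 * ((u * exp (-2*s)) / (q.totient * L)) := by
          gcongr
      _ = (2 * C0 + 3) * (u * exp (-2*s)) / (q.totient * L) := by ring
      _ ≤ _ := by
        have : 0 < C * exp (2*S1) := by positivity
        gcongr; linarith

noncomputable def lam (q : ℕ) (a : ZMod q) (u : ℕ) : ℝ :=
  ∑ n ∈ (Ioc 0 u).filter (fun n : ℕ => (n : ZMod q) = a), ArithmeticFunction.vonMangoldt n

lemma brun_tit : ∃ i : ℕ, 5 ≤ i ∧ ∃ C : ℝ, 0 < C ∧ ∀ q J : ℕ, 0 < q → i ≤ J → q ≤ zz (J - i) →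
    ∀ a : ZMod q, IsUnit a → ∀ u : ℕ, zz J ≤ u → lam q a u ≤ C * u / q.totient := by
  obtain ⟨i, hi5, C, hC, Hi⟩ := SS_upper
  refine ⟨i+1, by omega, 4*C+16, by positivity, ?_⟩
  intro q J hq hJ hqz a ha u hu
  have ht : (0:ℝ) < q.totient := by exact_mod_cast Nat.totient_pos.2 hq
  obtain ⟨J', hJ', hu1, hu2⟩ : ∃ J', J ≤ J' ∧ zz J' ≤ u ∧ u < zz (J'+1) := by
    have hu0 : u ≠ 0 := by have := two_le_zz J; omega
    have hne : Nat.log 2 u ≠ 0 := by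
      have := Nat.le_log_of_pow_le (b := 2) (x := 1) (y := u) (by norm_num)
        (by rw [pow_one]; exact (two_le_zz J).trans hu)
      omega
    refine ⟨Nat.log 2 (Nat.log 2 u), ?_, ?_, ?_⟩
    · have h1 : 2^J ≤ Nat.log 2 u := Nat.le_log_of_pow_le (by norm_num) hu
      exact Nat.le_log_of_pow_le (by norm_num) h1
    · exact (Nat.pow_le_pow_right (n := 2) (by norm_num) (Nat.pow_log_le_self 2 hne)).trans
        (Nat.pow_log_le_self 2 hu0)
    · refine (Nat.lt_pow_succ_log_self (b := 2) (by norm_num) u).trans_le ?_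
      exact Nat.pow_le_pow_right (by norm_num) (Nat.lt_pow_succ_log_self (by norm_num) _)
  set K := J' - 1 with hK
  have hK1 : J' = K + 1 := by omega
  rw [hK1] at hu1 hu2
  have hw2 : zz (K+1) = zz K ^ 2 := zz_succ K
  have hw4 : zz (K+1+1) = zz K ^ 4 := by rw [zz_succ, zz_succ]; ring
  have hS := Hi q K hq (by omega) (hqz.trans (zz_mono (by omega))) a ha u ((zz_le_succ K).trans hu1)
  have hwu : (zz K : ℝ)^2 ≤ u := by rw [hw2] at hu1; exact_mod_cast hu1
  have hwr2 : (2:ℝ) ≤ zz K := by exact_mod_cast two_le_zz K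
  have hu4 : (4:ℝ) ≤ u := by nlinarith
  have hlu : Real.log u ≤ 4 * Real.log (zz K) := by
    have : (u:ℝ) ≤ (zz K : ℝ)^4 := by rw [hw4] at hu2; exact_mod_cast hu2.le
    calc _ ≤ Real.log ((zz K : ℝ)^4) := Real.log_le_log (by linarith) this
      _ = _ := by rw [Real.log_pow]; norm_num
  have hlz := log_zz_pos K
  have hlu0 : 0 ≤ Real.log u := Real.log_natCast_nonneg u
  have hsq : (zz K : ℝ) ≤ √u := Real.le_sqrt_of_sq_le hwu
  have hq4 : (q:ℝ)^4 ≤ u := by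
    have h1 : zz (K+1) = zz (K+1-2)^(2^2) := by rw [← zz_add]; congr 1; omega
    have h2 : q ≤ zz (K+1-2) := hqz.trans (zz_mono (by omega))
    have h3 : q^4 ≤ u := by
      calc q^4 ≤ zz (K+1-2)^4 := Nat.pow_le_pow_left h2 4
        _ = zz (K+1) := by rw [h1]; norm_num
        _ ≤ u := hu1
    exact_mod_cast h3
  have hqs : (q:ℝ) ≤ √(√u) := by
    apply Real.le_sqrt_of_sq_le; apply Real.le_sqrt_of_sq_le; rw [← pow_mul]; exact hq4
  -- main decomposition
  have hdec : lam q a u ≤ Real.log u * SS K q a u + Chebyshev.theta (zz K) +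
      (Chebyshev.psi u - Chebyshev.theta u) := by
    have e1 : Chebyshev.psi u - Chebyshev.theta u =
        ∑ n ∈ Ioc 0 u, (ArithmeticFunction.vonMangoldt n - if n.Prime then Real.log n else 0) := by
      unfold Chebyshev.psi Chebyshev.theta
      rw [Nat.floor_natCast, Finset.sum_sub_distrib, Finset.sum_filter]
    have e2 : Chebyshev.theta (zz K) = ∑ n ∈ (Ioc 0 u).filter (fun n => n ≤ zz K),
        if n.Prime then Real.log n else 0 := by
      unfold Chebyshev.theta
      rw [Nat.floor_natCast, Finset.sum_filter]
      refine Finset.sum_congr ?_ fun _ _ => rfl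
      ext n; simp only [mem_Ioc, mem_filter]
      have := (zz_le_succ K).trans hu1
      omega
    rw [e1, e2, lam, SS, Finset.mul_sum, Finset.sum_filter, Finset.sum_filter, Finset.sum_filter,
      ← Finset.sum_add_distrib, ← Finset.sum_add_distrib]
    refine Finset.sum_le_sum fun n hn => ?_
    have hn' := mem_Ioc.1 hn
    have hv0 : (0:ℝ) ≤ ArithmeticFunction.vonMangoldt n := ArithmeticFunction.vonMangoldt_nonneg
    have hrr := mul_nonneg hlu0 (rr_nonneg K n)
    have hln : Real.log n ≤ Real.log u := by
      apply Real.log_le_log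
      · exact_mod_cast hn'.1
      · exact_mod_cast hn'.2
    have hln0 : 0 ≤ Real.log n := Real.log_natCast_nonneg n
    by_cases hp : n.Prime
    · have hv : ArithmeticFunction.vonMangoldt n = Real.log n :=
        ArithmeticFunction.vonMangoldt_apply_prime hp
      simp only [hp, if_true, hv]
      by_cases hna : (n : ZMod q) = a
      · simp only [hna, if_true]
        by_cases hnz : n ≤ zz K
        · simp only [hnz, if_true]; linarith
        · have : rr K n = 1 := by
            unfold rr
            rw [if_pos]
            intro p hpz hpp hd
            have := (Nat.prime_dvd_prime_iff_eq hpp hp).1 hd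
            omega
          simp only [hnz, if_false, this]; linarith
      · simp only [hna, if_false]; split_ifs <;> linarith
    · simp only [hp, if_false]
      split_ifs <;> linarith
  have h1 := Chebyshev.psi_sub_theta_le (x := (u:ℝ)) (by linarith)
  have h2 := Chebyshev.theta_le_log4_mul_x (x := (zz K:ℝ)) (by linarith)
  have hlog4 : Real.log 4 ≤ 2 := by
    rw [show (4:ℝ) = 2^2 by norm_num, Real.log_pow]; have := Real.log_two_lt_d9; push_cast; linarith
  have h3 : Real.log u * SS K q a u ≤ 4 * C * u / q.totient := by
    calc _ ≤ (4 * Real.log (zz K)) * (C * u / (q.totient * Real.log (zz K))) := by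
          have := SS_nonneg K q a u
          gcongr
      _ = _ := by field_simp
  have hs0 : 0 < √(u:ℝ) := Real.sqrt_pos.2 (by linarith)
  have hss : √(√(u:ℝ)) * √(√(u:ℝ)) = √u := Real.mul_self_sqrt hs0.le
  have hss2 : √(u:ℝ) * √(u:ℝ) = u := Real.mul_self_sqrt (by linarith)
  have hss0 : 1 ≤ √(√(u:ℝ)) := by
    apply Real.le_sqrt_of_sq_le; apply Real.le_sqrt_of_sq_le; linarith
  have hlog : Real.log u ≤ 4 * √(√(u:ℝ)) := by
    have e1 : Real.log (√(√(u:ℝ))) = Real.log u / 4 := by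
      rw [Real.log_sqrt hs0.le, Real.log_sqrt (by linarith)]; ring
    have := log_le_self' (x := √(√(u:ℝ))) (by linarith)
    linarith
  have h4 : Real.log 4 * zz K + 2 * √u * Real.log u ≤ 16 * u / q.totient := by
    rw [le_div_iff₀ ht]
    have htq : (q.totient : ℝ) ≤ √(√(u:ℝ)) :=
      le_trans (by exact_mod_cast Nat.totient_le q) hqs
    set v := √(√(u:ℝ)) with hv
    have hv0 : 0 < v := by linarith
    have hx : √(u:ℝ) = v^2 := by rw [← hss]; ring
    have hy : (u:ℝ) = v^4 := by rw [← hss2, hx]; ring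
    rw [hx] at hsq
    calc _ ≤ (2 * v^2 + 2 * v^2 * (4 * v)) * v := by
          rw [hx]; gcongr
      _ ≤ 16 * v^4 := by
        have h5 : v^3 ≤ v^4 := pow_le_pow_right₀ hss0 (by norm_num)
        nlinarith
      _ = 16 * u := by rw [← hy]
  calc _ ≤ 4 * C * u / q.totient + 16 * u / q.totient := by linarith
    _ = _ := by ring

end Gal

namespace Gal

lemma rough_sum (J Y : ℕ) (f : ℕ → ℝ) (hf : ∀ n, 0 ≤ f n) (hm : ∀ a b, f (a*b) = f a * f b) :
    (∑ n ∈ Ioc 0 Y, rr J n * f n) * (∑ m ∈ Ioc 0 (zz J - 1), f m) ≤ ∑ k ∈ Ioc 0 (Y * zz J), f k := by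
  classical
  have e1 : ∑ n ∈ Ioc 0 Y, rr J n * f n =
      ∑ n ∈ (Ioc 0 Y).filter (fun n => ∀ p < zz J, p.Prime → ¬ p ∣ n), f n := by
    rw [Finset.sum_filter]
    refine Finset.sum_congr rfl fun n _ => ?_
    unfold rr; split_ifs <;> simp
  rw [e1, Finset.sum_mul_sum, ← Finset.sum_product']
  have e2 : ∀ x ∈ ((Ioc 0 Y).filter (fun n => ∀ p < zz J, p.Prime → ¬ p ∣ n)) ×ˢ (Ioc 0 (zz J - 1)),
      f x.1 * f x.2 = f (x.1 * x.2) := fun x _ => (hm _ _).symm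
  rw [Finset.sum_congr rfl e2]
  have hinj : Set.InjOn (fun x : ℕ × ℕ => x.1 * x.2)
      (((Ioc 0 Y).filter (fun n => ∀ p < zz J, p.Prime → ¬ p ∣ n)) ×ˢ (Ioc 0 (zz J - 1)) : Finset (ℕ × ℕ)) := by
    have key : ∀ n m n' m' : ℕ, 0 < m' → m' < zz J → (∀ p < zz J, p.Prime → ¬ p ∣ n) →
        n * m = n' * m' → m' ∣ m := by
      intro n m n' m' h0 h1 h2 h3
      have hc : Nat.Coprime m' n := Nat.coprime_of_dvd fun p hp hd hd' =>
        h2 p ((Nat.le_of_dvd h0 hd).trans_lt h1) hp hd'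
      exact hc.dvd_of_dvd_mul_left (h3 ▸ dvd_mul_left m' n')
    rintro ⟨n, m⟩ h ⟨n', m'⟩ h' he
    simp only [coe_product, Set.mem_prod, mem_coe, mem_filter, mem_Ioc] at h h'
    simp only at he
    have d1 := key n m n' m' h'.2.1 (by have := h'.2; omega) h.1.2 he
    have d2 := key n' m' n m h.2.1 (by have := h.2; omega) h'.1.2 he.symm
    have hmm : m = m' := Nat.dvd_antisymm d2 d1
    subst hmm
    have := Nat.eq_of_mul_eq_mul_right h.2.1 he
    rw [this]
  rw [← Finset.sum_image (f := f) hinj]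
  refine Finset.sum_le_sum_of_subset_of_nonneg ?_ (fun k _ _ => hf k)
  intro k hk
  obtain ⟨⟨n, m⟩, h, rfl⟩ := mem_image.1 hk
  simp only [mem_product, mem_filter, mem_Ioc] at h ⊢
  exact ⟨Nat.mul_pos h.1.1.1 h.2.1, Nat.mul_le_mul h.1.1.2 (by have := h.2.2; omega)⟩

lemma harm_low (J : ℕ) : Real.log (zz J) ≤ ∑ m ∈ Ioc 0 (zz J - 1), 1 / (m:ℝ) := by
  have h4 := log_add_one_le_harmonic (zz J-1)
  rw [Nat.sub_add_cancel (by have := two_le_zz J; omega)] at h4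
  refine h4.trans (le_of_eq ?_)
  rw [harmonic_eq_sum_Icc]; push_cast
  refine Finset.sum_congr ?_ fun _ _ => by rw [one_div]
  ext i; simp [Nat.succ_le_iff]

lemma harm_up (n : ℕ) : ∑ m ∈ Ioc 0 n, 1 / (m:ℝ) ≤ 1 + Real.log n := by
  refine le_trans (le_of_eq ?_) (harmonic_le_one_add_log n)
  rw [harmonic_eq_sum_Icc]; push_cast
  refine Finset.sum_congr ?_ fun _ _ => by rw [one_div]
  ext i; simp [Nat.succ_le_iff]

lemma log_zz_ge_one {J : ℕ} (hJ : 1 ≤ J) : 1 ≤ Real.log (zz J) := by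
  rw [log_zz]
  have h5 : (2:ℝ)^1 ≤ 2^J := pow_le_pow_right₀ (by norm_num) hJ
  have := Real.log_two_gt_d9
  nlinarith

/-- sum of `r(n)/n` -/
lemma rough_harm {J Y : ℕ} (hJ : 1 ≤ J) (hY : zz J ≤ Y) :
    ∑ n ∈ Ioc 0 Y, rr J n * (1 / (n:ℝ)) ≤ 3 * Real.log Y / Real.log (zz J) := by
  have h1 := rough_sum J Y (fun n => 1 / (n:ℝ)) (fun n => by positivity)
    (fun a b => by push_cast; rw [one_div_mul_one_div])
  have h2 := harm_low J
  have h3 := harm_up (Y * zz J)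
  have hz := two_le_zz J
  have hL := log_zz_ge_one hJ
  have hz' : (2:ℝ) ≤ zz J := by exact_mod_cast hz
  have hY' : (zz J : ℝ) ≤ Y := by exact_mod_cast hY
  have hlY : Real.log (zz J) ≤ Real.log Y := Real.log_le_log (by linarith) hY'
  rw [Nat.cast_mul, Real.log_mul (by linarith) (by linarith)] at h3
  rw [le_div_iff₀ (by linarith)]
  have h0 : 0 ≤ ∑ n ∈ Ioc 0 Y, rr J n * (1 / (n:ℝ)) :=
    Finset.sum_nonneg fun n _ => mul_nonneg (rr_nonneg _ _) (by positivity)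
  have := mul_le_mul_of_nonneg_left h2 h0
  linarith

lemma zeta_part {η : ℝ} (hη : 0 < η) (N : ℕ) :
    ∑ k ∈ Ioc 0 N, (k:ℝ)^(-(1+η)) ≤ 1 + 1/η := by
  rcases Nat.eq_zero_or_pos N with rfl | hN
  · simp; positivity
  have h1 : AntitoneOn (fun x : ℝ => x^(-(1+η))) (Set.Icc ((1:ℕ):ℝ) (N:ℕ)) := by
    intro x hx y hy hxy
    exact Real.rpow_le_rpow_of_nonpos (by have := hx.1; push_cast at this; linarith) hxy (by linarith)
  have h2 := AntitoneOn.sum_le_integral_Ico hN h1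
  have h3 : ∫ x in ((1:ℕ):ℝ)..(N:ℕ), x^(-(1+η)) = (1 - (N:ℝ)^(-η))/η := by
    rw [integral_rpow]
    · rw [show -(1+η)+1 = -η by ring]; simp; field_simp; ring
    · right
      refine ⟨by linarith, ?_⟩
      rw [Set.uIcc_of_le (by exact_mod_cast hN)]
      intro h; have := h.1; push_cast at this; linarith
  rw [h3] at h2
  have h4 : ∑ k ∈ Ioc 0 N, (k:ℝ)^(-(1+η)) = 1 + ∑ i ∈ Ico 1 N, ((i+1 : ℕ):ℝ)^(-(1+η)) := by
    have : Ioc 0 N = insert 1 ((Ico 1 N).image (fun i => i+1)) := by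
      ext k; simp only [mem_Ioc, mem_insert, mem_image, mem_Ico]
      constructor
      · intro h
        by_cases h1 : k = 1
        · exact Or.inl h1
        · exact Or.inr ⟨k-1, by omega, by omega⟩
      · rintro (rfl | ⟨i, hi, rfl⟩) <;> omega
    rw [this, Finset.sum_insert, Finset.sum_image]
    · simp
    · intro a _ b _ h; simpa using h
    · simp
  rw [h4]
  have h5 : (1 - (N:ℝ)^(-η))/η ≤ 1/η := by
    gcongr; have : 0 ≤ (N:ℝ)^(-η) := by positivity
    linarith
  linarith

/-- sum of `r(n) n^{-1-1/log z}` is bounded -/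
lemma rough_zeta {J : ℕ} (hJ : 1 ≤ J) (Y : ℕ) :
    ∑ n ∈ Ioc 0 Y, rr J n * (n:ℝ)^(-(1+1/Real.log (zz J))) ≤ 6 := by
  have hL := log_zz_ge_one hJ
  set L := Real.log (zz J) with hLd
  have hL0 : 0 < L := by linarith
  have h1 := rough_sum J Y (fun n => (n:ℝ)^(-(1+1/L))) (fun n => by positivity)
    (fun a b => by push_cast; rw [Real.mul_rpow (by positivity) (by positivity)])
  have h2 := zeta_part (η := 1/L) (by positivity) (Y * zz J)
  have h3 : exp (-1) * L ≤ ∑ m ∈ Ioc 0 (zz J - 1), (m:ℝ)^(-(1+1/L)) := by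
    calc exp (-1) * L ≤ exp (-1) * ∑ m ∈ Ioc 0 (zz J - 1), 1 / (m:ℝ) := by
          gcongr; exact harm_low J
      _ ≤ _ := by
        rw [Finset.mul_sum]
        refine Finset.sum_le_sum fun m hm => ?_
        have hm' := mem_Ioc.1 hm
        have hm0 : (0:ℝ) < m := by exact_mod_cast hm'.1
        have hmz : Real.log m ≤ L := by
          apply Real.log_le_log hm0
          have : m ≤ zz J := by omega
          exact_mod_cast this
        rw [Real.rpow_def_of_pos hm0]
        have e : 1 / (m:ℝ) = exp (-Real.log m) := by rw [Real.exp_neg, Real.exp_log hm0, one_div]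
        rw [e, ← Real.exp_add]
        apply Real.exp_le_exp.2
        have : Real.log m / L ≤ 1 := (div_le_one hL0).2 hmz
        have e2 : Real.log m * -(1 + 1/L) = -Real.log m - Real.log m / L := by ring
        rw [e2]; linarith
  rw [one_div_one_div] at h2
  set A := ∑ n ∈ Ioc 0 Y, rr J n * (n:ℝ)^(-(1+1/L))
  have h0 : 0 ≤ A :=
    Finset.sum_nonneg fun n _ => mul_nonneg (rr_nonneg _ _) (by positivity)
  have h4 := mul_le_mul_of_nonneg_left h3 h0
  have h5 : A * (exp (-1) * L) ≤ 2 * L := by linarith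
  have h6 : A * exp (-1) ≤ 2 := by
    by_contra hh; push Not at hh; nlinarith
  have h7 : exp 1 ≤ 3 := by linarith [Real.exp_one_lt_d9]
  have h8 : A = A * exp (-1) * exp 1 := by rw [mul_assoc, ← Real.exp_add]; simp
  rw [h8]
  have : 0 < exp 1 := exp_pos 1
  nlinarith [exp_pos (-1)]

end Gal

namespace Gal

lemma rr_zero {J n : ℕ} (h0 : 0 < n) (h1 : n ≠ 1) (h2 : n < zz J) : rr J n = 0 := by
  unfold rr
  rw [if_neg]
  intro h
  exact h n.minFac ((Nat.minFac_le h0).trans_lt h2) (Nat.minFac_prime h1) (Nat.minFac_dvd n)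

noncomputable def chsum {q : ℕ} (χ : DirichletCharacter ℂ q) (J u : ℕ) : ℂ :=
  ∑ n ∈ Ioc 0 u, χ (n : ZMod q) * (rr J n : ℂ)

lemma chsum_eq {q : ℕ} [NeZero q] (χ : DirichletCharacter ℂ q) (J u : ℕ) :
    chsum χ J u = ∑ a : ZMod q, χ a * (SS J q a u : ℂ) := by
  unfold chsum
  rw [← Finset.sum_fiberwise (s := Ioc 0 u) (g := fun n : ℕ => (n : ZMod q))]
  refine Finset.sum_congr rfl fun a _ => ?_
  unfold SS
  push_cast
  rw [Finset.mul_sum]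
  refine Finset.sum_congr rfl fun n hn => ?_
  rw [(mem_filter.1 hn).2]

lemma chsum_small {q : ℕ} (χ : DirichletCharacter ℂ q) (J u : ℕ) (hu : u < zz J) :
    ‖chsum χ J u‖ ≤ 1 := by
  unfold chsum
  rcases Nat.eq_zero_or_pos u with h | h
  · subst h; simp
  rw [Finset.sum_eq_single_of_mem 1 (by simp; omega)]
  · rw [norm_mul]
    have := χ.norm_le_one (1 : ℕ)
    have h2 := rr_le J 1
    have h3 := rr_nonneg J 1
    rw [Complex.norm_real, Real.norm_of_nonneg h3]
    exact mul_le_one₀ this h3 h2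
  · intro n hn h1
    rw [rr_zero (mem_Ioc.1 hn).1 h1 (by have := mem_Ioc.1 hn; omega)]; simp

lemma chsum_dev : ∃ i, 5 ≤ i ∧ ∃ C : ℝ, 0 < C ∧ ∀ q J : ℕ, 0 < q → i ≤ J → q ≤ zz (J - i) →
    ∀ χ : DirichletCharacter ℂ q, χ ≠ 1 → ∀ u : ℕ, 1 ≤ u →
    ‖chsum χ J u‖ ≤ 1 + C / Real.log (zz J) * (u:ℝ) ^ (1 - 2 / Real.log (zz J)) := by
  obtain ⟨i, hi, C, hC, h⟩ := SS_dev
  refine ⟨i, hi, C, hC, fun q J hq hJ hqz χ hχ u hu => ?_⟩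
  have hL := log_zz_pos J
  have hu0 : (0:ℝ) < u := by exact_mod_cast hu
  have hnn : 0 ≤ C / Real.log (zz J) * (u:ℝ) ^ (1 - 2 / Real.log (zz J)) := by positivity
  rcases lt_or_ge u (zz J) with hz | hz
  · have := chsum_small χ J u hz
    linarith
  have : NeZero q := ⟨hq.ne'⟩
  have e : chsum χ J u = ∑ a : ZMod q, χ a * ((SS J q a u - SS J q 1 u : ℝ) : ℂ) := by
    rw [chsum_eq]
    have h0 : ∑ a : ZMod q, χ a = 0 := MulChar.sum_eq_zero_of_ne_one hχ
    push_cast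
    simp_rw [mul_sub]
    rw [Finset.sum_sub_distrib, ← Finset.sum_mul, h0, zero_mul, sub_zero]
  set M := C * (u * Real.exp (-2 * (Real.log u / Real.log (zz J)))) / (q.totient * Real.log (zz J)) with hM
  have b : ∀ a : ZMod q, ‖χ a * ((SS J q a u - SS J q 1 u : ℝ) : ℂ)‖ ≤ if IsUnit a then M else 0 := by
    intro a
    split_ifs with ha
    · rw [norm_mul, Complex.norm_real, Real.norm_eq_abs]
      have h1 := h q J hq hJ hqz a 1 ha isUnit_one u hz
      have h2 := χ.norm_le_one a
      calc _ ≤ 1 * |SS J q a u - SS J q 1 u| := mul_le_mul_of_nonneg_right h2 (abs_nonneg _)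
        _ ≤ M := by rw [one_mul]; exact h1
    · rw [χ.map_nonunit ha]; simp
  have hcard : ((univ : Finset (ZMod q)).filter IsUnit).card = q.totient := by
    rw [← ZMod.card_units_eq_totient, ← Finset.card_univ, 
      ← Finset.card_map ⟨((↑) : (ZMod q)ˣ → ZMod q), Units.val_injective⟩]
    congr 1
    ext a; simp [IsUnit]
  have tot : (0:ℝ) < q.totient := by exact_mod_cast Nat.totient_pos.2 hq
  have : ‖chsum χ J u‖ ≤ q.totient * M := by
    rw [e]
    refine (norm_sum_le _ _).trans ((Finset.sum_le_sum fun a _ => b a).trans (le_of_eq ?_))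
    rw [← Finset.sum_filter, Finset.sum_const, hcard, nsmul_eq_mul]
  have e2 : (q.totient:ℝ) * M = C / Real.log (zz J) * (u:ℝ) ^ (1 - 2 / Real.log (zz J)) := by
    rw [hM, Real.rpow_def_of_pos hu0]
    have : Real.log u * (1 - 2 / Real.log (zz J)) = Real.log u + (-2 * (Real.log u / Real.log (zz J))) := by
      ring
    rw [this, Real.exp_add, Real.exp_log hu0]
    field_simp
  linarith

noncomputable def QQ (J : ℕ) : ℕ := ∏ p ∈ (zz J).primesBelow, p

lemma QQ_pos (J : ℕ) : 0 < QQ J :=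
  Finset.prod_pos fun p hp => (Nat.prime_of_mem_primesBelow hp).pos

lemma rr_eq_cop (J n : ℕ) : rr J n = if Nat.Coprime n (QQ J) then 1 else 0 := by
  unfold rr
  refine if_congr ?_ rfl rfl
  unfold QQ
  rw [Nat.coprime_prod_right_iff]
  constructor
  · intro h p hp
    exact ((Nat.Prime.coprime_iff_not_dvd (Nat.prime_of_mem_primesBelow hp)).2
      (h p (Nat.lt_of_mem_primesBelow hp) (Nat.prime_of_mem_primesBelow hp))).symm
  · intro h p hp hpp
    exact (Nat.Prime.coprime_iff_not_dvd hpp).1 (h p (Nat.mem_primesBelow.2 ⟨hp, hpp⟩)).symm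

noncomputable def chz {q : ℕ} (χ : DirichletCharacter ℂ q) (J : ℕ) : DirichletCharacter ℂ (q * QQ J) :=
  DirichletCharacter.changeLevel (dvd_mul_right q (QQ J)) χ

lemma chz_apply {q : ℕ} (χ : DirichletCharacter ℂ q) (J n : ℕ) :
    chz χ J (n : ZMod (q * QQ J)) = χ (n : ZMod q) * (rr J n : ℂ) := by
  rw [rr_eq_cop]
  by_cases h : Nat.Coprime n (q * QQ J)
  · have h2 : Nat.Coprime n (QQ J) := Nat.Coprime.coprime_mul_left_right h
    rw [if_pos h2]
    have := DirichletCharacter.changeLevel_eq_cast_of_dvd' χ (dvd_mul_right q (QQ J)) (a := (n:ℤ))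
      (Nat.isCoprime_iff_coprime.2 h)
    simp only [Int.cast_natCast] at this
    simp [chz, this]
  · have h1 : chz χ J (n : ZMod (q * QQ J)) = 0 :=
      (chz χ J).map_nonunit (fun hh => h ((ZMod.isUnit_iff_coprime _ _).1 hh))
    rw [h1]
    split_ifs with h2
    · have h3 : ¬ Nat.Coprime n q := fun h3 => h (Nat.Coprime.mul_right h3 h2)
      rw [χ.map_nonunit (fun hh => h3 ((ZMod.isUnit_iff_coprime _ _).1 hh))]; simp
    · simp

lemma chz_ne_one {q : ℕ} (hq : 0 < q) (χ : DirichletCharacter ℂ q) (hχ : χ ≠ 1) (J : ℕ) : chz χ J ≠ 1 := by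
  have : NeZero (q * QQ J) := ⟨(Nat.mul_pos hq (QQ_pos J)).ne'⟩
  exact fun h => hχ ((DirichletCharacter.changeLevel_eq_one_iff _).1 h)

lemma chz_ne_zero {q : ℕ} [NeZero q] (χ : DirichletCharacter ℂ q) (hχ : χ ≠ 1) (J : ℕ) 
    [NeZero (q * QQ J)] (s : ℂ) (hs : 0 < s.re) (h : DirichletCharacter.LFunction χ s ≠ 0) :
    DirichletCharacter.LFunction (chz χ J) s ≠ 0 := by
  unfold chz
  rw [DirichletCharacter.LFunction_changeLevel _ χ (Or.inl hχ)]
  refine mul_ne_zero h (Finset.prod_ne_zero_iff.2 fun p hp h0 => ?_)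
  have hp' := Nat.prime_of_mem_primeFactors hp
  have h1 : ‖χ p * (p:ℂ) ^ (-s)‖ < 1 := by
    rw [norm_mul, Complex.norm_natCast_cpow_of_pos hp'.pos]
    have a1 := χ.norm_le_one p
    have a2 : (p:ℝ) ^ (-s).re < 1 := 
      Real.rpow_lt_one_of_one_lt_of_neg (by exact_mod_cast hp'.one_lt) (by simpa using hs)
    calc _ ≤ 1 * (p:ℝ) ^ (-s).re := mul_le_mul_of_nonneg_right a1 (by positivity)
      _ < 1 := by rw [one_mul]; exact a2
  rw [← sub_eq_zero.1 h0] at h1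
  simp at h1

lemma chz_inv_bound {q : ℕ} (hq : 0 < q) (χ : DirichletCharacter ℂ q) (J : ℕ) (hJ : 1 ≤ J)
    [NeZero (q * QQ J)] (s : ℂ) (hs : s.re = 1 + 1 / Real.log (zz J)) :
    ‖(DirichletCharacter.LFunction (chz χ J) s)⁻¹‖ ≤ 6 := by
  have hL := log_zz_pos J
  have hs1 : 1 < s.re := by rw [hs]; have : 0 < 1 / Real.log (zz J) := by positivity
                            linarith
  have h1 := DirichletCharacter.LSeries.mul_mu_eq_one (chz χ J) hs1
  rw [DirichletCharacter.LFunction_eq_LSeries _ hs1, ← eq_inv_of_mul_eq_one_right h1]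
  unfold LSeries
  have hsum : LSeriesSummable ((fun n : ℕ => chz χ J n) * fun n : ℕ => ((ArithmeticFunction.moebius n : ℤ) : ℂ)) s :=
    DirichletCharacter.LSeriesSummable_mul _ (ArithmeticFunction.LSeriesSummable_moebius_iff.mpr hs1)
  have b : ∀ n, ‖LSeries.term ((fun n : ℕ => chz χ J n) * fun n : ℕ => ((ArithmeticFunction.moebius n : ℤ) : ℂ)) s n‖ 
      ≤ if n = 0 then 0 else rr J n * (n:ℝ)^(-(1+1/Real.log (zz J))) := by
    intro n
    rw [LSeries.norm_term_eq]
    split_ifs with h0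
    · exact le_rfl
    · have hn : (0:ℝ) < n := by exact_mod_cast Nat.pos_of_ne_zero h0
      rw [Real.rpow_neg hn.le, div_eq_mul_inv, hs]
      refine mul_le_mul_of_nonneg_right ?_ (by positivity)
      simp only [Pi.mul_apply]
      rw [norm_mul, chz_apply, norm_mul, Complex.norm_real, Real.norm_of_nonneg (rr_nonneg J n)]
      have a1 := χ.norm_le_one n
      have a2 : ‖((ArithmeticFunction.moebius n : ℤ) : ℂ)‖ ≤ 1 := by
        rw [Complex.norm_intCast]
        exact_mod_cast ArithmeticFunction.abs_moebius_le_one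
      have a3 := rr_nonneg J n
      calc _ ≤ (1 * rr J n) * 1 := by gcongr
        _ = _ := by ring
  refine (norm_tsum_le_tsum_norm hsum.norm).trans (Real.tsum_le_of_sum_range_le (fun _ => norm_nonneg _) fun N => ?_)
  refine (Finset.sum_le_sum fun n _ => b n).trans (le_trans ?_ (rough_zeta hJ N))
  simp_rw [← ite_not (p := _ = 0)]
  rw [← Finset.sum_filter]
  refine Finset.sum_le_sum_of_subset_of_nonneg ?_ fun n _ _ => mul_nonneg (rr_nonneg J n) (by positivity)
  intro n hn
  simp only [mem_filter, mem_range, mem_Ioc] at hn ⊢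
  omega

end Gal

namespace Gal

open MeasureTheory in
lemma L_int {N : ℕ} [NeZero N] (χ : DirichletCharacter ℂ N) (hχ : χ ≠ 1) (r B : ℝ) (hr : 0 ≤ r) (hr1 : r < 1)
    (hB : ∀ n : ℕ, 1 ≤ n → ‖∑ k ∈ Icc 1 n, χ k‖ ≤ B * (n:ℝ)^r) (s : ℂ) (hs : r < s.re) :
    DirichletCharacter.LFunction χ s = 
      s * ∫ t in Set.Ioi (1 : ℝ), (∑ k ∈ Icc 1 ⌊t⌋₊, χ k) * t ^ (-(s + 1)) := by
  have hB0 : 0 ≤ B := by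
    have := (norm_nonneg _).trans (hB 1 le_rfl)
    simpa using this
  set f : ℝ → ℂ := Set.indicator (Set.Ioi 1) (fun t : ℝ => ∑ k ∈ Icc 1 ⌊t⌋₊, χ k) with hf
  have hmeas : Measurable f := by
    refine Measurable.indicator ?_ measurableSet_Ioi
    exact (measurable_from_nat (f := fun n : ℕ => ∑ k ∈ Icc 1 n, χ k)).comp Nat.measurable_floor
  have hfb : ∀ t : ℝ, 0 < t → ‖f t‖ ≤ B * t ^ r := by
    intro t ht
    rw [hf]
    by_cases h : t ∈ Set.Ioi (1:ℝ)
    · rw [Set.indicator_of_mem h]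
      have h1 : 1 ≤ ⌊t⌋₊ := Nat.one_le_floor_iff _ |>.2 (le_of_lt h)
      refine (hB _ h1).trans (mul_le_mul_of_nonneg_left ?_ hB0)
      exact Real.rpow_le_rpow (Nat.cast_nonneg _) (Nat.floor_le ht.le) hr
    · rw [Set.indicator_of_notMem h]; simp; positivity
  have hint : ∀ s : ℂ, ∫ t in Set.Ioi (1 : ℝ), (∑ k ∈ Icc 1 ⌊t⌋₊, χ k) * (t:ℂ) ^ (-(s + 1)) = mellin f (-s) := by
    intro s
    unfold mellin
    rw [hf]
    have : ∀ t : ℝ, (t:ℂ) ^ (-s - 1) • (Set.indicator (Set.Ioi 1) (fun t : ℝ => ∑ k ∈ Icc 1 ⌊t⌋₊, χ k) t) =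
      Set.indicator (Set.Ioi 1) (fun t : ℝ => (∑ k ∈ Icc 1 ⌊t⌋₊, χ k) * (t:ℂ) ^ (-(s + 1))) t := by
      intro t
      by_cases h : t ∈ Set.Ioi (1:ℝ)
      · rw [Set.indicator_of_mem h, Set.indicator_of_mem h, smul_eq_mul, mul_comm]
        congr 2; ring
      · rw [Set.indicator_of_notMem h, Set.indicator_of_notMem h]; simp
    simp_rw [this]
    rw [setIntegral_indicator measurableSet_Ioi]
    congr 2
    ext t; simp only [Set.mem_Ioi, Set.mem_inter_iff]
    constructor
    · intro h; exact ⟨by linarith, h⟩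
    · exact fun h => h.2
  have hli : LocallyIntegrableOn f (Set.Ioi 0) := by
    have hc : LocallyIntegrableOn (fun t : ℝ => B * t ^ r) (Set.Ioi 0) := by
      refine ContinuousOn.locallyIntegrableOn ?_ measurableSet_Ioi
      refine continuousOn_const.mul (continuousOn_id.rpow_const ?_)
      intro x hx; right; exact hr
    refine hc.mono hmeas.aestronglyMeasurable (Filter.Eventually.of_forall fun t => ?_)
    rcases le_or_gt t 0 with h | h
    · rw [hf, Set.indicator_of_notMem (by simp; linarith), norm_zero]
      exact norm_nonneg _
    · exact (hfb t h).trans (le_abs_self _)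
  have hdiff : ∀ s : ℂ, r < s.re → DifferentiableAt ℂ (fun s => s * mellin f (-s)) s := by
    intro s hs
    have := mellin_differentiableAt_of_isBigO_rpow (a := -r) (b := (-s).re - 1) (f := f) (s := -s) hli ?_ 
      (by simpa using hs) ?_ (by linarith)
    · exact differentiableAt_id.mul (this.comp s differentiableAt_id.neg)
    · refine Asymptotics.IsBigO.of_bound B ?_
      filter_upwards [Filter.eventually_gt_atTop 0] with t ht
      rw [neg_neg, Real.norm_of_nonneg (by positivity : 0 ≤ t ^ r)]
      exact hfb t ht
    · refine Asymptotics.IsBigO.of_bound 1 ?_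
      have : ∀ᶠ t in nhdsWithin (0:ℝ) (Set.Ioi 0), t < 1 := 
        nhdsWithin_le_nhds (gt_mem_nhds one_pos)
      filter_upwards [this] with t ht
      rw [hf, Set.indicator_of_notMem (by simp; exact ht.le)]
      simp
  rw [hint]
  have hU : IsOpen {s : ℂ | r < s.re} := isOpen_lt continuous_const Complex.continuous_re
  have key := AnalyticOnNhd.eqOn_of_preconnected_of_eventuallyEq (𝕜 := ℂ) (U := {s : ℂ | r < s.re}) 
    (f := DirichletCharacter.LFunction χ) (g := fun s => s * mellin f (-s)) (z₀ := 2) ?_ ?_ ?_ ?_ ?_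
  · exact key hs
  · exact (DirichletCharacter.differentiable_LFunction hχ).differentiableOn.analyticOnNhd hU
  · exact DifferentiableOn.analyticOnNhd (fun s hs => (hdiff s hs).differentiableWithinAt) hU
  · exact (convex_halfSpace_re_gt r).isPreconnected
  · simp; linarith
  · have : ∀ᶠ s : ℂ in nhds 2, 1 < s.re := 
      (isOpen_lt continuous_const Complex.continuous_re).mem_nhds (by simp)
    filter_upwards [this] with s hs
    rw [DirichletCharacter.LFunction_eq_LSeries χ hs, 
      LSeries_eq_mul_integral (fun n => χ n) hr (hr1.trans hs) (DirichletCharacter.LSeriesSummable_of_one_lt_re χ hs), hint]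
    refine Asymptotics.IsBigO.of_bound B ?_
    filter_upwards [Filter.eventually_ge_atTop 1] with n hn
    rw [Real.norm_of_nonneg (by positivity)]
    exact hB n hn

open MeasureTheory in
lemma L_bound {N : ℕ} [NeZero N] (χ : DirichletCharacter ℂ N) (hχ : χ ≠ 1) (L C : ℝ) (hL : 2 ≤ L) (hC : 0 < C)
    (hB : ∀ n : ℕ, 1 ≤ n → ‖∑ k ∈ Icc 1 n, χ k‖ ≤ 1 + C / L * (n:ℝ)^(1 - 2 / L)) (s : ℂ) (hs : 1 - 1 / L ≤ s.re) :
    ‖DirichletCharacter.LFunction χ s‖ ≤ ‖s‖ * (2 + C) := by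
  have hL0 : 0 < L := by linarith
  set r := 1 - 2 / L with hr
  have h2L : 2 / L ≤ 1 := (div_le_one hL0).2 hL
  have h1L : 1 / L ≤ 1 / 2 := one_div_le_one_div_of_le (by norm_num) hL
  have h1L0 : 0 < 1 / L := by positivity
  have e2 : 2 / L = 2 * (1 / L) := by ring
  have hr0 : 0 ≤ r := by linarith
  have hsr : 1 / L ≤ s.re - r := by linarith
  have hs2 : 1 / 2 ≤ s.re := by linarith
  rw [L_int χ hχ r (1 + C / L) hr0 (by linarith) ?_ s (by linarith)]
  · rw [norm_mul]
    refine mul_le_mul_of_nonneg_left ?_ (norm_nonneg _)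
    have i1 : IntegrableOn (fun t : ℝ => t ^ (-s.re - 1)) (Set.Ioi 1) := 
      integrableOn_Ioi_rpow_of_lt (by linarith) one_pos
    have i2 : IntegrableOn (fun t : ℝ => t ^ (r - s.re - 1)) (Set.Ioi 1) := 
      integrableOn_Ioi_rpow_of_lt (by linarith) one_pos
    have i3 := i1.add (i2.const_mul (C / L))
    refine (norm_integral_le_of_norm_le i3 ?_).trans ?_
    · refine (ae_restrict_iff' measurableSet_Ioi).2 (Filter.Eventually.of_forall fun t ht => ?_)
      have ht0 : (0:ℝ) < t := lt_trans one_pos ht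
      have h1 : 1 ≤ ⌊t⌋₊ := Nat.one_le_floor_iff _ |>.2 (le_of_lt ht)
      rw [norm_mul, Complex.norm_cpow_eq_rpow_re_of_pos ht0]
      have h3 : (⌊t⌋₊:ℝ) ^ r ≤ t ^ r := Real.rpow_le_rpow (Nat.cast_nonneg _) (Nat.floor_le ht0.le) hr0
      have e3 : (-(s + 1)).re = -s.re - 1 := by simp; ring
      rw [e3]
      simp only [Pi.add_apply]
      have e4 : t ^ (r - s.re - 1) = t ^ r * t ^ (-s.re - 1) := by
        rw [← Real.rpow_add ht0]; congr 1; ring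
      rw [e4]
      calc _ ≤ (1 + C / L * t ^ r) * t ^ (-s.re - 1) := by
            refine mul_le_mul_of_nonneg_right ((hB _ h1).trans ?_) (by positivity)
            gcongr
        _ = _ := by ring
    · simp only [Pi.add_apply]
      rw [integral_add i1 (i2.const_mul (C / L)), integral_const_mul, integral_Ioi_rpow_of_lt (by linarith) one_pos,
        integral_Ioi_rpow_of_lt (by linarith) one_pos]
      simp only [Real.one_rpow, sub_add_cancel]
      have a1 : -1 / -s.re ≤ 2 := by
        rw [neg_div_neg_eq, div_le_iff₀ (by linarith)]; linarith
      have a2 : C / L * (-1 / (r - s.re)) ≤ C := by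
        have : -1 / (r - s.re) ≤ L := by
          rw [← neg_sub s.re r, neg_div_neg_eq, div_le_iff₀ (by linarith)]
          calc (1:ℝ) = L * (1 / L) := by field_simp
            _ ≤ _ := mul_le_mul_of_nonneg_left hsr hL0.le
        calc _ ≤ C / L * L := mul_le_mul_of_nonneg_left this (by positivity)
          _ = C := by field_simp
      linarith
  · intro n hn
    refine (hB n hn).trans ?_
    have : 1 ≤ (n:ℝ) ^ r := Real.one_le_rpow (by exact_mod_cast hn) hr0
    linarith

lemma chz_bound : ∃ i, 5 ≤ i ∧ ∃ C : ℝ, 0 < C ∧ ∀ q J : ℕ, 0 < q → i ≤ J → q ≤ zz (J - i) →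
    ∀ χ : DirichletCharacter ℂ q, χ ≠ 1 → ∀ _ : NeZero (q * QQ J), ∀ s : ℂ, 1 - 1 / Real.log (zz J) ≤ s.re →
    ‖DirichletCharacter.LFunction (chz χ J) s‖ ≤ C * ‖s‖ := by
  obtain ⟨i, hi, C, hC, h⟩ := chsum_dev
  refine ⟨i, hi, 2 + C, by linarith, fun q J hq hJ hqz χ hχ _ s hs => ?_⟩
  refine le_of_le_of_eq ?_ (mul_comm _ _)
  refine L_bound (chz χ J) (chz_ne_one hq χ hχ J) (Real.log (zz J)) C ?_ hC ?_ s hs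
  · rw [log_zz]
    have h5 : (2:ℝ)^5 ≤ 2^J := pow_le_pow_right₀ (by norm_num) (hi.trans hJ)
    have := Real.log_two_gt_d9
    nlinarith
  · intro n hn
    have := h q J hq hJ hqz χ hχ n hn
    unfold chsum at this
    simp_rw [chz_apply]
    exact this

end Gal

namespace Gal

open Metric in
lemma logd0 (f : ℂ → ℂ) (hf : Differentiable ℂ f) (R M : ℝ) (hM : 0 < M) (hR : 0 < R)
    (h0 : ∀ z ∈ ball (0:ℂ) R, f z ≠ 0) (hb : ∀ z ∈ ball (0:ℂ) R, ‖f z‖ ≤ Real.exp M * ‖f 0‖)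
    (w : ℂ) (hw : ‖w‖ < R) : ‖deriv f w / f w‖ ≤ 8 * M * R / (R - ‖w‖)^2 := by
  have hd : DifferentiableOn ℂ (fun z => deriv f z / f z) (ball 0 R) := by
    intro z hz
    refine (DifferentiableAt.div ?_ (hf z) (h0 z hz)).differentiableWithinAt
    exact (hf.contDiff (n := 2)).differentiable_deriv_two z
  obtain ⟨g, hg0, hg⟩ := hd.isExactOn_ball.with_val_at 0 0
  have hgd : DifferentiableOn ℂ g (ball 0 R) := fun z hz => (hg z hz).differentiableAt.differentiableWithinAt
  -- f = f 0 * exp g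
  have hfe : ∀ z ∈ ball (0:ℂ) R, f z = f 0 * Complex.exp (g z) := by
    have hder : ∀ z ∈ ball (0:ℂ) R, HasDerivAt (fun z => f z * Complex.exp (-g z)) 0 z := by
      intro z hz
      have := (hf z).hasDerivAt.mul ((hg z hz).neg.cexp)
      refine this.congr_deriv ?_
      have := h0 z hz
      field_simp
      ring
    intro z hz
    have hc := (convex_ball (0:ℂ) R).is_const_of_fderivWithin_eq_zero (𝕜 := ℂ) (f := fun z => f z * Complex.exp (-g z))
      (fun z hz => (hder z hz).differentiableAt.differentiableWithinAt)
      (fun z hz => by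
        rw [fderivWithin_of_isOpen isOpen_ball hz]
        have := (hder z hz).hasFDerivAt.fderiv
        rw [this]; ext; simp) hz (mem_ball_self hR)
    simp only [hg0, neg_zero, Complex.exp_zero, mul_one] at hc
    rw [← hc, mul_assoc, ← Complex.exp_add]; simp
  have hre : Set.MapsTo g (ball 0 R) {z | z.re ≤ M} := by
    intro z hz
    have h1 := hb z hz
    rw [hfe z hz, norm_mul, Complex.norm_exp, mul_comm] at h1
    have h2 : 0 < ‖f 0‖ := norm_pos_iff.2 (h0 0 (mem_ball_self hR))
    have := le_of_mul_le_mul_right h1 h2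
    exact Real.exp_le_exp.1 this
  set η := R - ‖w‖ with hη
  have hη0 : 0 < η := by linarith
  have hball : ∀ z ∈ closedBall w (η/2), ‖z‖ ≤ R - η/2 := by
    intro z hz
    have : ‖z - w‖ ≤ η/2 := by simpa [dist_eq_norm] using hz
    have h3 := norm_add_le (z - w) w
    rw [sub_add_cancel] at h3
    linarith
  have hsub : closedBall w (η/2) ⊆ ball 0 R := fun z hz => by
    have := hball z hz
    rw [mem_ball_zero_iff]; linarith
  have hwb : w ∈ ball (0:ℂ) R := by rw [mem_ball_zero_iff]; exact hw
  have := Complex.norm_deriv_le_of_forall_mem_sphere_norm_le (c := w) (R := η/2) (f := g) (C := 4 * M * R / η) (by positivity)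
    (DifferentiableOn.diffContOnCl_ball (U := ball 0 R) hgd hsub) ?_
  · rw [(hg w hwb).deriv] at this
    refine this.trans (le_of_eq ?_)
    field_simp
    ring
  · intro z hz
    have hz' := sphere_subset_closedBall hz
    have h5 := hball z hz'
    refine (Complex.borelCaratheodory_zero hM hgd hre hR (hsub hz') hg0).trans ?_
    have h6 : η / 2 ≤ R - ‖z‖ := by linarith
    calc _ ≤ 2 * M * R / (η/2) := by
          gcongr
          linarith
      _ = _ := by field_simp; ring

open Metric in
lemma logd (f : ℂ → ℂ) (hf : Differentiable ℂ f) (c : ℂ) (R M : ℝ) (hM : 0 < M) (hR : 0 < R)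
    (h0 : ∀ z ∈ ball c R, f z ≠ 0) (hb : ∀ z ∈ ball c R, ‖f z‖ ≤ Real.exp M * ‖f c‖)
    (w : ℂ) (hw : ‖w - c‖ < R) : ‖deriv f w / f w‖ ≤ 8 * M * R / (R - ‖w - c‖)^2 := by
  have hm : ∀ z ∈ ball (0:ℂ) R, c + z ∈ ball c R := fun z hz => by
    rw [mem_ball_zero_iff] at hz
    simpa [dist_eq_norm] using hz
  have := logd0 (fun z => f (c + z)) (hf.comp (by fun_prop)) R M hM hR (fun z hz => h0 _ (hm z hz))
    (fun z hz => by simpa using hb _ (hm z hz)) (w - c) hw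
  rw [deriv_comp_const_add] at this
  simpa using this

lemma ld_bound (c₂ : ℝ) (hc₂ : 0 < c₂) : ∃ i, 5 ≤ i ∧ ∃ C : ℝ, 0 < C ∧ ∀ q J : ℕ, 1 < q → i ≤ J → q ≤ zz (J - i) →
    Real.log q + 1 ≤ c₂ * Real.log (zz J) → ∀ χ : DirichletCharacter ℂ q, χ ≠ 1 → ∀ _ : NeZero q, 
    (∀ s : ℂ, s.re > 1 - c₂ / Real.log (q * (|s.im| + 1)) → DirichletCharacter.LFunction χ s ≠ 0) →
    ∀ s : ℂ, 1 < s.re → s.re ≤ 1 + 1 / Real.log (zz J) → 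
    ‖LSeries ((fun n : ℕ => χ n * (rr J n : ℂ)) * fun n => (ArithmeticFunction.vonMangoldt n : ℂ)) s‖ 
      ≤ C * Real.log (zz J) * (1 + |s.im|)^3 := by
  obtain ⟨i, hi, C, hC, h⟩ := chz_bound
  refine ⟨i, hi, 336 * (C + 1), by positivity, fun q J hq1' hJ hqz hqL χ hχ hnz hzf s hs1 hs2 => ?_⟩
  have hq : 0 < q := by omega
  have hnz' : NeZero (q * QQ J) := ⟨(Nat.mul_pos hq (QQ_pos J)).ne'⟩
  set L := Real.log (zz J) with hLd
  have hL : 2 ≤ L := by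
    rw [hLd, log_zz]
    have h5 : (2:ℝ)^5 ≤ 2^J := pow_le_pow_right₀ (by norm_num) (hi.trans hJ)
    have := Real.log_two_gt_d9
    nlinarith
  have hL0 : 0 < L := by linarith
  set T := 1 + |s.im| with hT
  have hT1 : 1 ≤ T := by have := abs_nonneg s.im; linarith
  have hT0 : 0 < T := by linarith
  set f := DirichletCharacter.LFunction (chz χ J) with hf
  have hfd : Differentiable ℂ f := DirichletCharacter.differentiable_LFunction (chz_ne_one hq χ hχ J)
  have e1 : LSeries ((fun n : ℕ => χ n * (rr J n : ℂ)) * fun n => (ArithmeticFunction.vonMangoldt n : ℂ)) s = 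
      - (deriv f s / f s) := by
    have h1 := DirichletCharacter.LSeries_twist_vonMangoldt_eq (chz χ J) hs1
    rw [hf, DirichletCharacter.deriv_LFunction_eq_deriv_LSeries _ hs1, DirichletCharacter.LFunction_eq_LSeries _ hs1, 
      ← neg_div, ← h1]
    congr 1
    ext n
    simp only [Pi.mul_apply, chz_apply]
  rw [e1, norm_neg]
  set c : ℂ := ⟨1 + 1 / L, s.im⟩ with hc
  set η := 1 / (L * T) with hη
  have hη0 : 0 < η := by positivity
  have hηL : η ≤ 1 / L := one_div_le_one_div_of_le hL0 (by nlinarith)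
  have h1L : 1 / L ≤ 1 / 2 := one_div_le_one_div_of_le (by norm_num) hL
  have hre : ∀ z ∈ Metric.ball c (1/L + η), 1 - η < z.re ∧ |z.im| ≤ T ∧ z.re < 1 + 3 / 2 := by
    intro z hz
    have hz' : ‖z - c‖ < 1 / L + η := by simpa [dist_eq_norm] using hz
    have a1 := (Complex.abs_re_le_norm (z - c)).trans_lt hz'
    have a2 := (Complex.abs_im_le_norm (z - c)).trans_lt hz'
    simp only [Complex.sub_re, Complex.sub_im, hc] at a1 a2
    have a3 := abs_lt.1 a1
    refine ⟨by linarith, ?_, by linarith⟩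
    have a4 := abs_sub_abs_le_abs_sub z.im s.im
    linarith
  have hM : 0 < Real.log (6 * (C + 1) * (T + 5 / 2)) := Real.log_pos (by nlinarith)
  have hsc : ‖s - c‖ ≤ 1 / L := by
    have : s - c = ((s.re - (1 + 1 / L) : ℝ) : ℂ) := by
      apply Complex.ext <;> simp [hc]
    rw [this, Complex.norm_real, Real.norm_eq_abs, abs_le]
    constructor <;> linarith
  have key := logd f hfd c (1 / L + η) _ hM (by positivity) ?_ ?_ s (by linarith)
  · refine key.trans ?_
    have hlog : Real.log (6 * (C + 1) * (T + 5 / 2)) ≤ 6 * (C + 1) * (T + 5 / 2) := 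
      Real.log_le_self (by positivity)
    have hlog2 : 6 * (C + 1) * (T + 5 / 2) ≤ 21 * (C + 1) * T := by nlinarith
    have hd : η ^ 2 ≤ (1 / L + η - ‖s - c‖)^2 := by
      refine pow_le_pow_left₀ hη0.le (by linarith) 2
    calc _ ≤ 8 * (21 * (C + 1) * T) * (2 * (1 / L)) / η ^ 2 := by
          gcongr
          · exact hlog.trans hlog2
          · linarith
      _ = _ := by rw [hη]; field_simp; ring
  · intro z hz
    obtain ⟨b1, b2, b3⟩ := hre z hz
    refine chz_ne_zero χ hχ J z (by linarith) (hzf z ?_)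
    have hq1 : (1:ℝ) < q := by exact_mod_cast hq1'
    have hlq : 0 ≤ Real.log q := Real.log_nonneg hq1.le
    have c3 : 0 < Real.log (q * (|z.im| + 1)) := 
      Real.log_pos (by have := abs_nonneg z.im; nlinarith)
    have c1 : Real.log (q * (|z.im| + 1)) ≤ c₂ * L * T := by
      rw [Real.log_mul (by positivity) (by have := abs_nonneg z.im; positivity)]
      have c2 : Real.log (|z.im| + 1) ≤ T := by
        have := Real.log_le_sub_one_of_pos (x := |z.im| + 1) (by have := abs_nonneg z.im; positivity)
        linarith
      calc _ ≤ (Real.log q + 1) * T := by nlinarith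
        _ ≤ _ := by gcongr
    have : η ≤ c₂ / Real.log (q * (|z.im| + 1)) := by
      rw [hη, div_le_div_iff₀ (by positivity) c3]
      linarith
    linarith
  · intro z hz
    obtain ⟨b1, b2, b3⟩ := hre z hz
    have d1 := h q J hq hJ hqz χ hχ hnz' z (by linarith)
    have d2 := chz_inv_bound hq χ J (by omega) c rfl
    rw [Real.exp_log (by positivity)]
    rw [norm_inv] at d2
    have hcne : f c ≠ 0 := by
      refine chz_ne_zero χ hχ J c ?_ (DirichletCharacter.LFunction_ne_zero_of_one_le_re χ (Or.inl hχ) ?_)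
      · show 0 < 1 + 1 / L
        positivity
      · show 1 ≤ 1 + 1 / L
        have : 0 < 1 / L := by positivity
        linarith
    have hcp : 0 < ‖f c‖ := norm_pos_iff.2 hcne
    have d3 : 1 ≤ 6 * ‖f c‖ := by
      have := mul_le_mul_of_nonneg_right d2 hcp.le
      rwa [inv_mul_cancel₀ hcp.ne'] at this
    have d4 : ‖z‖ ≤ T + 5 / 2 := by
      have := Complex.norm_le_abs_re_add_abs_im z
      have : |z.re| ≤ 5/2 := abs_le.2 ⟨by linarith, by linarith⟩
      linarith
    calc ‖f z‖ ≤ C * ‖z‖ := d1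
      _ ≤ (C + 1) * (T + 5/2) := by gcongr; linarith
      _ = (C + 1) * (T + 5/2) * 1 := by ring
      _ ≤ (C + 1) * (T + 5/2) * (6 * ‖f c‖) := mul_le_mul_of_nonneg_left d3 (by positivity)
      _ = _ := by ring

end Gal

namespace Gal

noncomputable def wt (y : ℝ) : ℝ := (max (1 - y) 0)^4

lemma wt_nonneg (y : ℝ) : 0 ≤ wt y := by unfold wt; positivity

lemma wt_zero {y : ℝ} (h : 1 ≤ y) : wt y = 0 := by
  unfold wt; rw [max_eq_right (by linarith)]; norm_num

lemma wt_anti {y y' : ℝ} (h : y ≤ y') : wt y' ≤ wt y := by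
  unfold wt
  exact pow_le_pow_left₀ (le_max_right _ _) (max_le_max (by linarith) le_rfl) 4

lemma wt_le_one {y : ℝ} (h : 0 ≤ y) : wt y ≤ 1 := by
  unfold wt
  exact pow_le_one₀ (le_max_right _ _) (max_le (by linarith) (by norm_num))

lemma wt_cont : Continuous wt := by unfold wt; fun_prop

noncomputable def kb (s : ℂ) : ℂ := 24 / ∏ j ∈ Finset.range 5, (s + j)

open MeasureTheory in
lemma wt_mellin (s : ℂ) (hs : 0 < s.re) :
    MellinConvergent (fun y => (wt y : ℂ)) s ∧ mellin (fun y => (wt y : ℂ)) s = kb s := by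
  have e : ∀ y : ℝ, y ∈ Set.Ioi (0:ℝ) → (y:ℂ)^(s-1) • (wt y : ℂ) = 
      Set.indicator (Set.Ioc 0 1) (fun x : ℝ => (x : ℂ) ^ (s - 1) * (1 - (x : ℂ)) ^ ((5:ℂ) - 1)) y := by
    intro y hy
    by_cases h : y ≤ 1
    · rw [Set.indicator_of_mem (show y ∈ Set.Ioc (0:ℝ) 1 from ⟨hy, h⟩), smul_eq_mul]
      congr 1
      unfold wt
      rw [max_eq_left (by linarith)]
      have : (5:ℂ) - 1 = ((4:ℕ):ℂ) := by norm_num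
      rw [this, Complex.cpow_natCast]
      push_cast; rfl
    · rw [Set.indicator_of_notMem (fun h' => h h'.2), wt_zero (by linarith)]
      simp
  have hb := Complex.betaIntegral_convergent (u := s) (v := 5) hs (by norm_num)
  rw [intervalIntegrable_iff_integrableOn_Ioc_of_le zero_le_one] at hb
  constructor
  · unfold MellinConvergent
    refine IntegrableOn.congr_fun (f := Set.indicator (Set.Ioc 0 1) (fun x : ℝ => (x : ℂ) ^ (s - 1) * (1 - (x : ℂ)) ^ ((5:ℂ) - 1))) 
      ?_ (fun y hy => (e y hy).symm) measurableSet_Ioi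
    exact ((integrable_indicator_iff measurableSet_Ioc).2 hb).integrableOn
  · unfold mellin
    rw [setIntegral_congr_fun measurableSet_Ioi e, setIntegral_indicator measurableSet_Ioc]
    have : Set.Ioi (0:ℝ) ∩ Set.Ioc 0 1 = Set.Ioc 0 1 := by
      ext x; simp
    rw [this, ← intervalIntegral.integral_of_le zero_le_one]
    have h2 := Complex.betaIntegral_eval_nat_add_one_right hs 4
    unfold Complex.betaIntegral at h2
    norm_num at h2 ⊢
    rw [h2]
    unfold kb
    norm_num [Nat.factorial]

lemma kb_bound (σ t : ℝ) (hσ : 1 ≤ σ) : ‖kb (σ + t * Complex.I)‖ ≤ 768 / (1 + |t|)^5 := by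
  unfold kb
  rw [norm_div, norm_prod]
  have h : ∀ j ∈ Finset.range 5, (1 + |t|) / 2 ≤ ‖(σ + t * Complex.I : ℂ) + j‖ := by
    intro j _
    have h1 := Complex.abs_re_le_norm ((σ + t * Complex.I : ℂ) + j)
    have h2 := Complex.abs_im_le_norm ((σ + t * Complex.I : ℂ) + j)
    simp at h1 h2
    have h3 := le_abs_self (σ + j)
    have : (0:ℝ) ≤ j := Nat.cast_nonneg _
    linarith
  have h0 : 0 < 1 + |t| := by positivity
  have := Finset.prod_le_prod (s := Finset.range 5) (f := fun _ => (1 + |t|)/2) (fun i _ => by positivity) h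
  rw [Finset.prod_const, Finset.card_range] at this
  calc _ ≤ ‖(24:ℂ)‖ / ((1 + |t|) / 2)^5 := div_le_div_of_nonneg_left (norm_nonneg _) (by positivity) this
    _ = _ := by norm_num; field_simp; norm_num

lemma one_add_sq_le (t : ℝ) : (1 + |t|)^2 ≥ 1 + t^2 := by
  have := abs_nonneg t
  have := sq_abs t
  nlinarith

lemma kb_cont (σ : ℝ) (hσ : 1 ≤ σ) : Continuous fun t : ℝ => kb (σ + t * Complex.I) := by
  unfold kb
  refine Continuous.div continuous_const (by fun_prop) fun t => ?_
  refine Finset.prod_ne_zero_iff.2 fun j _ h => ?_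
  have := congrArg Complex.re h
  simp at this
  have : (0:ℝ) ≤ j := Nat.cast_nonneg _
  linarith

open MeasureTheory in
lemma kb_int (σ : ℝ) (hσ : 1 ≤ σ) : Integrable fun t : ℝ => kb (σ + t * Complex.I) := by
  refine Integrable.mono' (integrable_inv_one_add_sq.const_mul 768) (kb_cont σ hσ).aestronglyMeasurable
    (Filter.Eventually.of_forall fun t => ?_)
  refine (kb_bound σ t hσ).trans ?_
  rw [div_eq_mul_inv]
  refine mul_le_mul_of_nonneg_left ?_ (by norm_num)
  refine inv_anti₀ (by positivity) ?_
  have h1 : 1 ≤ 1 + |t| := by have := abs_nonneg t; linarith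
  calc _ ≤ (1 + |t|)^2 := one_add_sq_le t
    _ ≤ _ := pow_le_pow_right₀ h1 (by norm_num)

open MeasureTheory in
lemma wt_inv (σ : ℝ) (hσ : 1 ≤ σ) (y : ℝ) (hy : 0 < y) :
    (wt y : ℂ) = (1 / (2 * π) : ℝ) * ∫ t : ℝ, (y : ℂ) ^ (-(σ + t * Complex.I)) * kb (σ + t * Complex.I) := by
  have hre : ∀ t : ℝ, 0 < (σ + t * Complex.I : ℂ).re := fun t => by simp; linarith
  have he : ∀ t : ℝ, mellin (fun y => (wt y : ℂ)) (σ + t * Complex.I) = kb (σ + t * Complex.I) := 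
    fun t => (wt_mellin _ (hre t)).2
  have := mellinInv_mellin_eq σ (fun y => (wt y : ℂ)) hy (wt_mellin σ (by simp; linarith)).1 ?_ ?_
  · rw [← this]
    unfold mellinInv
    rw [Complex.real_smul]
    simp_rw [he, smul_eq_mul]
  · unfold Complex.VerticalIntegrable
    simp_rw [he]
    exact kb_int σ hσ
  · exact (Complex.continuous_ofReal.comp wt_cont).continuousAt

open MeasureTheory in
lemma perron (c : ℕ → ℂ) (σ : ℝ) (hσ : 1 ≤ σ) (hc : LSeriesSummable c σ) (X : ℕ) (hX : 0 < X) :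
    ∑ n ∈ Ioc 0 X, c n * (wt (n / X) : ℂ) = 
    (1 / (2 * π) : ℝ) * ∫ t : ℝ, (X : ℂ) ^ (σ + t * Complex.I) * kb (σ + t * Complex.I) * LSeries c (σ + t * Complex.I) := by
  have hX0 : (0:ℝ) < X := by exact_mod_cast hX
  set G : ℕ → ℝ → ℂ := fun n t => (X : ℂ) ^ (σ + t * Complex.I) * kb (σ + t * Complex.I) * LSeries.term c (σ + t * Complex.I) n with hG
  have hne : ∀ t : ℝ, (σ + t * Complex.I : ℂ) ≠ 0 := fun t h => by
    have := congrArg Complex.re h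
    simp at this; linarith
  have hGc : ∀ n, AEStronglyMeasurable (G n) := by
    intro n
    refine Continuous.aestronglyMeasurable ?_
    refine Continuous.mul (Continuous.mul ?_ (kb_cont σ hσ)) ?_
    · refine Continuous.const_cpow (by fun_prop) (Or.inr hne)
    · rcases eq_or_ne n 0 with h | h
      · subst h; simp [continuous_const]
      · simp_rw [LSeries.term_of_ne_zero h]
        refine Continuous.div continuous_const (Continuous.const_cpow (by fun_prop) (Or.inr hne)) fun t => ?_
        rw [Complex.cpow_ne_zero_iff_of_exponent_ne_zero (hne t)]
        exact_mod_cast h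
  have hGn : ∀ n t, ‖G n t‖ = ((X:ℝ)^σ * ‖LSeries.term c σ n‖) * ‖kb (σ + t * Complex.I)‖ := by
    intro n t
    rw [hG]
    simp only [norm_mul]
    rw [Complex.norm_natCast_cpow_of_pos hX, LSeries.norm_term_eq, LSeries.norm_term_eq]
    simp
    split_ifs <;> ring
  have hGi : ∀ n, Integrable (G n) := fun n => by
    refine Integrable.mono' ((kb_int σ hσ).norm.const_mul ((X:ℝ)^σ * ‖LSeries.term c σ n‖)) (hGc n) 
      (Filter.Eventually.of_forall fun t => (hGn n t).le)
  have hGs : Summable fun n => ∫ t, ‖G n t‖ := by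
    simp_rw [hGn, integral_const_mul]
    exact (hc.norm.mul_left _).mul_right _
  have key := integral_tsum_of_summable_integral_norm hGi hGs
  have e1 : ∀ t, ∑' n, G n t = (X : ℂ) ^ (σ + t * Complex.I) * kb (σ + t * Complex.I) * LSeries c (σ + t * Complex.I) := by
    intro t
    rw [hG]; simp only
    rw [tsum_mul_left]; rfl
  simp_rw [e1] at key
  rw [← key]
  have e2 : ∀ n, (1 / (2 * π) : ℝ) * ∫ t, G n t = if n = 0 then 0 else c n * (wt (n / X) : ℂ) := by
    intro n
    split_ifs with h
    · subst h; simp [hG]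
    · have hn : 0 < n := Nat.pos_of_ne_zero h
      have hn0 : (0:ℝ) < n := by exact_mod_cast hn
      rw [wt_inv σ hσ (n / X) (by positivity), mul_left_comm]
      congr 1
      rw [← integral_const_mul]
      refine integral_congr_ae (Filter.Eventually.of_forall fun t => ?_)
      simp only [hG]
      rw [LSeries.term_of_ne_zero h]
      have : (((n:ℝ) / X : ℝ) : ℂ) ^ (-(σ + t * Complex.I)) = (X:ℂ)^(σ + t * Complex.I) / (n:ℂ)^(σ + t * Complex.I) := by
        rw [Complex.cpow_neg, Complex.ofReal_div, Complex.div_cpow_ofReal_nonneg hn0.le hX0.le, Complex.ofReal_natCast, Complex.ofReal_natCast, inv_div]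
      rw [this]; ring
  rw [← tsum_mul_left]
  simp_rw [e2]
  rw [tsum_eq_sum (s := Ioc 0 X)]
  · refine Finset.sum_congr rfl fun n hn => ?_
    rw [if_neg (by have := (mem_Ioc.1 hn).1; omega)]
  · intro n hn
    split_ifs with h
    · rfl
    · have : X < n := by
        by_contra h'
        exact hn (mem_Ioc.2 ⟨by omega, by omega⟩)
      rw [wt_zero]; · simp
      rw [le_div_iff₀ hX0, one_mul]
      exact_mod_cast this.le

end Gal

namespace Gal

noncomputable def gm (y : ℝ) : ℝ := min y y⁻¹

open MeasureTheory in
lemma gm_mellin (t : ℝ) :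
    MellinConvergent (fun y => (gm y : ℂ)) (t * Complex.I) ∧ 
      mellin (fun y => (gm y : ℂ)) (t * Complex.I) = 2 * ((1 + t^2)⁻¹ : ℝ) := by
  set s : ℂ := t * Complex.I with hs
  have hsre : s.re = 0 := by simp [hs]
  have e1 : Set.EqOn (fun y : ℝ => (y:ℂ)^(s-1) • (gm y : ℂ)) (fun y : ℝ => (y:ℂ)^s) (Set.Ioc 0 1) := by
    intro y hy
    simp only [gm]
    rw [min_eq_left (hy.2.trans ((one_le_inv₀ hy.1).2 hy.2))]
    rw [smul_eq_mul, Complex.cpow_sub _ _ (by exact_mod_cast hy.1.ne'), Complex.cpow_one]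
    have : (y:ℂ) ≠ 0 := by exact_mod_cast hy.1.ne'
    field_simp
  have e2 : Set.EqOn (fun y : ℝ => (y:ℂ)^(s-1) • (gm y : ℂ)) (fun y : ℝ => (y:ℂ)^(s-2)) (Set.Ioi 1) := by
    intro y hy
    have hy1 : (1:ℝ) < y := hy
    have hy0 : 0 < y := by linarith
    have : (y:ℂ) ≠ 0 := by exact_mod_cast hy0.ne'
    simp only [gm]
    rw [min_eq_right ((inv_le_one_of_one_le₀ hy1.le).trans hy1.le), smul_eq_mul]
    have h2 : s - 2 = (s - 1) - 1 := by ring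
    rw [h2, Complex.cpow_sub (s - 1) 1 this, Complex.cpow_one]
    push_cast; rw [div_eq_mul_inv]
  have i1 : IntegrableOn (fun y : ℝ => (y:ℂ)^s) (Set.Ioc 0 1) := by
    rw [← intervalIntegrable_iff_integrableOn_Ioc_of_le zero_le_one]
    exact intervalIntegral.intervalIntegrable_cpow' (by rw [hsre]; norm_num)
  have i2 : IntegrableOn (fun y : ℝ => (y:ℂ)^(s-2)) (Set.Ioi 1) := 
    integrableOn_Ioi_cpow_of_lt (by simp [hsre]) one_pos
  have hU : Set.Ioi (0:ℝ) = Set.Ioc 0 1 ∪ Set.Ioi 1 := (Set.Ioc_union_Ioi_eq_Ioi zero_le_one).symm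
  have j1 := i1.congr_fun e1.symm measurableSet_Ioc
  have j2 := i2.congr_fun e2.symm measurableSet_Ioi
  constructor
  · unfold MellinConvergent
    rw [hU]
    exact j1.union j2
  · unfold mellin
    rw [hU, setIntegral_union (Set.Ioc_disjoint_Ioi le_rfl) measurableSet_Ioi j1 j2, 
      setIntegral_congr_fun measurableSet_Ioc e1, setIntegral_congr_fun measurableSet_Ioi e2,
      ← intervalIntegral.integral_of_le zero_le_one, integral_cpow (Or.inl (by rw [hsre]; norm_num)), 
      integral_Ioi_cpow_of_lt (by simp [hsre]) one_pos]
    have h1 : s + 1 ≠ 0 := fun h => by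
      have := congrArg Complex.re h
      simp [hsre] at this
    have h2 : s - 2 + 1 ≠ 0 := fun h => by
      have := congrArg Complex.re h
      simp [hsre] at this
      norm_num at this
    have h3 : (1 + (t:ℂ)^2) ≠ 0 := by
      have : (0:ℝ) < 1 + t^2 := by positivity
      exact_mod_cast this.ne'
    simp only [Complex.ofReal_one, Complex.one_cpow, Complex.ofReal_zero, Complex.zero_cpow h1, sub_zero]
    push_cast
    rw [div_add_div _ _ h1 h2, ← div_eq_mul_inv, div_eq_div_iff (mul_ne_zero h1 h2) h3, hs]
    ring_nf
    simp only [Complex.I_sq]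
    ring

open MeasureTheory in
lemma cauchy_ft (x : ℝ) (hx : 0 < x) :
    ∫ t : ℝ, (x : ℂ) ^ (-(t * Complex.I)) * ((1 + t^2)⁻¹ : ℝ) = (π * gm x : ℝ) := by
  have := mellinInv_mellin_eq 0 (fun y => (gm y : ℂ)) hx (by simpa using (gm_mellin 0).1) ?_ ?_
  · unfold mellinInv at this
    simp only [Complex.ofReal_zero, zero_add, (gm_mellin _).2, smul_eq_mul, Complex.real_smul] at this
    push_cast at this ⊢
    rw [← this]
    simp_rw [mul_left_comm _ (2:ℂ), integral_const_mul]
    have : (π:ℂ) ≠ 0 := by exact_mod_cast Real.pi_ne_zero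
    field_simp
    simp only [mul_comm]
  · unfold Complex.VerticalIntegrable
    simp only [Complex.ofReal_zero, zero_add, (gm_mellin _).2]
    exact (integrable_inv_one_add_sq.ofReal).const_mul 2
  · refine (Complex.continuous_ofReal.continuousAt).comp ?_
    unfold gm
    exact continuousAt_id.min (continuousAt_inv₀ hx.ne')

end Gal

namespace Gal

noncomputable def PX {q : ℕ} (χ : DirichletCharacter ℂ q) (b : ℕ → ℝ) (X : ℕ) (σ t : ℝ) : ℂ :=
  ∑ n ∈ Ioc 0 X, χ n * (b n : ℂ) * (n:ℂ) ^ (-(σ + t * Complex.I))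

lemma PX_cont {q : ℕ} (χ : DirichletCharacter ℂ q) (b : ℕ → ℝ) (X : ℕ) (σ : ℝ) : Continuous (PX χ b X σ) := by
  unfold PX
  refine continuous_finsetSum _ fun n hn => ?_
  refine continuous_const.mul (Continuous.const_cpow (by fun_prop) (Or.inl ?_))
  have := (mem_Ioc.1 hn).1
  exact_mod_cast this.ne'

lemma PX_bdd {q : ℕ} (χ : DirichletCharacter ℂ q) (b : ℕ → ℝ) (X : ℕ) (σ : ℝ) : 
    ∃ B, ∀ t, ‖PX χ b X σ t‖ ≤ B := by
  refine ⟨∑ n ∈ Ioc 0 X, 1 * ‖b n‖ * (n:ℝ) ^ (-σ), fun t => ?_⟩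
  unfold PX
  refine (norm_sum_le _ _).trans (Finset.sum_le_sum fun n hn => ?_)
  rw [norm_mul, norm_mul, Complex.norm_natCast_cpow_of_pos (mem_Ioc.1 hn).1, Complex.norm_real]
  have := χ.norm_le_one n
  have e : (-(σ + t * Complex.I : ℂ)).re = -σ := by simp
  rw [e]
  gcongr

open MeasureTheory in
lemma PX_int {q : ℕ} (χ : DirichletCharacter ℂ q) (b : ℕ → ℝ) (X : ℕ) (σ : ℝ) : 
    Integrable fun t => ‖PX χ b X σ t‖^2 * (1 + t^2)⁻¹ := by
  obtain ⟨B, hB⟩ := PX_bdd χ b X σ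
  refine Integrable.mono' (integrable_inv_one_add_sq.const_mul (B^2)) 
    (Continuous.aestronglyMeasurable ?_) (Filter.Eventually.of_forall fun t => ?_)
  · refine ((PX_cont χ b X σ).norm.pow 2).mul (Continuous.inv₀ (by fun_prop) fun t => by positivity)
  · rw [Real.norm_of_nonneg (by positivity)]
    have := hB t
    gcongr

lemma conj_chi {q : ℕ} [NeZero q] (χ : DirichletCharacter ℂ q) {a : ZMod q} (ha : IsUnit a) :
    starRingEnd ℂ (χ a) = χ a⁻¹ := by
  have h1 := MulChar.star_apply' χ a
  rw [MulChar.inv_apply_eq_inv'] at h1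
  have h2 : χ a * χ a⁻¹ = 1 := by
    rw [← map_mul, ZMod.mul_inv_of_unit a ha, map_one]
  rw [← RCLike.star_def, h1]
  exact inv_eq_of_mul_eq_one_right h2

lemma PX_orth {q : ℕ} [NeZero q] (b : ℕ → ℝ) (X : ℕ) (σ t : ℝ) :
    ((∑ χ : DirichletCharacter ℂ q, ‖PX χ b X σ t‖^2 : ℝ) : ℂ) = 
    ∑ m ∈ Ioc 0 X, ∑ n ∈ Ioc 0 X, if (n : ZMod q) = m ∧ IsUnit (n : ZMod q) then 
      (q.totient * (b m * b n * ((m:ℝ) * n)^(-σ)) : ℝ) * (((m:ℝ)/n : ℝ) : ℂ) ^ (-(t * Complex.I)) else 0 := by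
  have e1 : ∀ χ : DirichletCharacter ℂ q, ((‖PX χ b X σ t‖^2 : ℝ) : ℂ) = 
      ∑ m ∈ Ioc 0 X, ∑ n ∈ Ioc 0 X, (χ m * starRingEnd ℂ (χ n)) * 
        (((b m * b n * ((m:ℝ) * n)^(-σ)) : ℝ) * (((m:ℝ)/n : ℝ) : ℂ) ^ (-(t * Complex.I))) := by
    intro χ
    rw [Complex.ofReal_pow, ← Complex.mul_conj']
    unfold PX
    rw [map_sum, Finset.sum_mul_sum]
    refine Finset.sum_congr rfl fun m hm => Finset.sum_congr rfl fun n hn => ?_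
    have hm0 : (0:ℝ) < m := by exact_mod_cast (mem_Ioc.1 hm).1
    have hn0 : (0:ℝ) < n := by exact_mod_cast (mem_Ioc.1 hn).1
    have hmc : (m:ℂ) ≠ 0 := by exact_mod_cast hm0.ne'
    have hnc : (n:ℂ) ≠ 0 := by exact_mod_cast hn0.ne'
    rw [map_mul, map_mul, Complex.conj_ofReal]
    have h1 : starRingEnd ℂ ((n:ℂ) ^ (-(σ + t * Complex.I))) = (n:ℂ)^(-(σ - t * Complex.I)) := by
      have h := Complex.cpow_conj (n:ℂ) (-(σ + t * Complex.I)) (by rw [Complex.natCast_arg]; exact Real.pi_pos.ne)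
      rw [Complex.conj_natCast] at h
      rw [← h]
      simp [sub_eq_add_neg]
    have h2 : (((m:ℝ)/n : ℝ) : ℂ) ^ (-(t * Complex.I)) = (m:ℂ)^(-(t * Complex.I)) * (n:ℂ)^(t * Complex.I) := by
      rw [Complex.ofReal_div, Complex.div_cpow_ofReal_nonneg hm0.le hn0.le, Complex.ofReal_natCast, Complex.ofReal_natCast, 
        Complex.cpow_neg (n:ℂ), div_inv_eq_mul]
    have h3 : ((((m:ℝ) * n)^(-σ) : ℝ) : ℂ) = (m:ℂ)^(-σ:ℂ) * (n:ℂ)^(-σ:ℂ) := by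
      rw [Real.mul_rpow hm0.le hn0.le, Complex.ofReal_mul, Complex.ofReal_cpow hm0.le, Complex.ofReal_cpow hn0.le]
      simp
    rw [h1, h2]
    rw [Complex.ofReal_mul, h3]
    have h4 : (m:ℂ) ^ (-(σ + t * Complex.I)) = (m:ℂ)^(-σ:ℂ) * (m:ℂ)^(-(t * Complex.I)) := by
      rw [← Complex.cpow_add _ _ hmc]; ring_nf
    have h5 : (n:ℂ) ^ (-(σ - t * Complex.I)) = (n:ℂ)^(-σ:ℂ) * (n:ℂ)^((t * Complex.I)) := by
      rw [← Complex.cpow_add _ _ hnc]; ring_nf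
    rw [h4, h5]
    push_cast
    ring
  rw [Complex.ofReal_sum]
  simp_rw [e1]
  rw [Finset.sum_comm]
  refine Finset.sum_congr rfl fun m hm => ?_
  rw [Finset.sum_comm]
  refine Finset.sum_congr rfl fun n hn => ?_
  rw [← Finset.sum_mul]
  by_cases hu : IsUnit (n : ZMod q)
  · have : ∑ χ : DirichletCharacter ℂ q, χ m * starRingEnd ℂ (χ n) = if (n : ZMod q) = m then (q.totient : ℂ) else 0 := by
      rw [← DirichletCharacter.sum_char_inv_mul_char_eq ℂ hu]
      refine Finset.sum_congr rfl fun χ _ => ?_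
      rw [mul_comm]
      congr 1
      exact conj_chi χ hu
    rw [this]
    split_ifs with h h' h'
    · push_cast; ring
    · exact absurd ⟨h, hu⟩ h'
    · exact absurd h'.1 h
    · simp
  · rw [if_neg (fun h => hu h.2)]
    have : ∀ χ : DirichletCharacter ℂ q, χ m * starRingEnd ℂ (χ n) = 0 := fun χ => by
      rw [χ.map_nonunit hu]; simp
    simp_rw [this]; simp

open MeasureTheory in
lemma PX_l2 {q : ℕ} [NeZero q] (b : ℕ → ℝ) (X : ℕ) (σ : ℝ) :
    ∑ χ : DirichletCharacter ℂ q, ∫ t, ‖PX χ b X σ t‖^2 * (1 + t^2)⁻¹ = 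
    ∑ m ∈ Ioc 0 X, ∑ n ∈ Ioc 0 X, if (n : ZMod q) = m ∧ IsUnit (n : ZMod q) then 
      (q.totient * (b m * b n * ((m:ℝ) * n)^(-σ)) : ℝ) * (π * gm (m / n)) else 0 := by
  rw [← integral_finsetSum _ (fun χ _ => PX_int χ b X σ)]
  apply Complex.ofReal_injective
  rw [← integral_complex_ofReal]
  have e : ∀ t : ℝ, ((∑ χ : DirichletCharacter ℂ q, ‖PX χ b X σ t‖^2 * (1 + t^2)⁻¹ : ℝ) : ℂ) =
      ∑ m ∈ Ioc 0 X, ∑ n ∈ Ioc 0 X, if (n : ZMod q) = m ∧ IsUnit (n : ZMod q) then 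
      (q.totient * (b m * b n * ((m:ℝ) * n)^(-σ)) : ℝ) * ((((m:ℝ)/n : ℝ) : ℂ) ^ (-(t * Complex.I)) * ((1 + t^2)⁻¹ : ℝ)) else 0 := by
    intro t
    rw [← Finset.sum_mul, Complex.ofReal_mul, PX_orth, Finset.sum_mul]
    refine Finset.sum_congr rfl fun m hm => ?_
    rw [Finset.sum_mul]
    refine Finset.sum_congr rfl fun n hn => ?_
    split_ifs
    · ring
    · simp
  simp_rw [e]
  have hint : ∀ m ∈ Ioc 0 X, ∀ n ∈ Ioc 0 X, Integrable fun t : ℝ => 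
    (if (n : ZMod q) = m ∧ IsUnit (n : ZMod q) then 
      (q.totient * (b m * b n * ((m:ℝ) * n)^(-σ)) : ℝ) * ((((m:ℝ)/n : ℝ) : ℂ) ^ (-(t * Complex.I)) * ((1 + t^2)⁻¹ : ℝ)) else 0 : ℂ) := by
    intro m hm n hn
    have hm0 : (0:ℝ) < m := by exact_mod_cast (mem_Ioc.1 hm).1
    have hn0 : (0:ℝ) < n := by exact_mod_cast (mem_Ioc.1 hn).1
    have hd : 0 < (m:ℝ) / n := by positivity
    split_ifs
    · refine Integrable.const_mul ?_ _
      refine Integrable.mono' integrable_inv_one_add_sq (Continuous.aestronglyMeasurable ?_) (Filter.Eventually.of_forall fun t => ?_)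
      · refine (Continuous.const_cpow (by fun_prop) (Or.inl ?_)).mul (Complex.continuous_ofReal.comp (Continuous.inv₀ (by fun_prop) fun t => by positivity))
        exact_mod_cast hd.ne'
      · rw [norm_mul, Complex.norm_cpow_eq_rpow_re_of_pos hd, Complex.norm_real, Real.norm_of_nonneg (by positivity)]
        simp
    · exact integrable_zero _ _ _
  rw [integral_finsetSum _ (fun m hm => integrable_finsetSum _ (hint m hm)), Complex.ofReal_sum]
  refine Finset.sum_congr rfl fun m hm => ?_
  rw [integral_finsetSum _ (hint m hm), Complex.ofReal_sum]
  refine Finset.sum_congr rfl fun n hn => ?_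
  have hm0 : (0:ℝ) < m := by exact_mod_cast (mem_Ioc.1 hm).1
  have hn0 : (0:ℝ) < n := by exact_mod_cast (mem_Ioc.1 hn).1
  split_ifs
  · rw [integral_const_mul, cauchy_ft _ (by positivity)]
    push_cast; rfl
  · simp

end Gal

namespace Gal

lemma mertens_up (X : ℕ) (hX : 1 ≤ X) : ∑ n ∈ Ioc 0 X, ArithmeticFunction.vonMangoldt n / (n:ℝ) ≤ 2 * Real.log X := by
  have hX0 : (0:ℝ) < X := by exact_mod_cast hX
  have h1 := ArithmeticFunction.sum_Ioc_mul_zeta_eq_sum ArithmeticFunction.vonMangoldt X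
  rw [ArithmeticFunction.vonMangoldt_mul_zeta] at h1
  have h2 : ∑ n ∈ Ioc 0 X, ArithmeticFunction.log n ≤ X * Real.log X := by
    have : ∑ n ∈ Ioc 0 X, ArithmeticFunction.log n ≤ ∑ n ∈ Ioc 0 X, Real.log X := by
      refine Finset.sum_le_sum fun n hn => ?_
      rw [ArithmeticFunction.log_apply]
      have h := mem_Ioc.1 hn
      exact Real.log_le_log (by exact_mod_cast h.1) (by exact_mod_cast h.2)
    simpa using this
  have h3 : X * ∑ n ∈ Ioc 0 X, ArithmeticFunction.vonMangoldt n / (n:ℝ) ≤ 2 * ∑ n ∈ Ioc 0 X, ArithmeticFunction.vonMangoldt n * ((X / n : ℕ) : ℝ) := by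
    rw [Finset.mul_sum, Finset.mul_sum]
    refine Finset.sum_le_sum fun n hn => ?_
    have h := mem_Ioc.1 hn
    have hn0 : (0:ℝ) < n := by exact_mod_cast h.1
    have h4 : (X:ℝ) / n ≤ 2 * ((X / n : ℕ) : ℝ) := by
      have h5 : 1 ≤ X / n := (Nat.one_le_div_iff h.1).2 h.2
      have h6 : (X:ℝ) / n < ((X/n : ℕ) : ℝ) + 1 := by
        rw [div_lt_iff₀ hn0]
        have := Nat.lt_div_mul_add (a := X) h.1
        have h7 : X < (X / n + 1) * n := by linarith [this, add_mul (X/n) 1 n]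
        exact_mod_cast h7
      have h5' : (1:ℝ) ≤ ((X/n : ℕ) : ℝ) := by exact_mod_cast h5
      linarith
    have h0 := ArithmeticFunction.vonMangoldt_nonneg (n := n)
    calc X * (ArithmeticFunction.vonMangoldt n / (n:ℝ)) = ArithmeticFunction.vonMangoldt n * (X / n) := by ring
      _ ≤ ArithmeticFunction.vonMangoldt n * (2 * ((X / n : ℕ) : ℝ)) := mul_le_mul_of_nonneg_left h4 h0
      _ = _ := by ring
  rw [← h1] at h3
  have h4 : X * ∑ n ∈ Ioc 0 X, ArithmeticFunction.vonMangoldt n / (n:ℝ) ≤ X * (2 * Real.log X) := by linarith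
  exact le_of_mul_le_mul_left h4 hX0

noncomputable def lz (J : ℕ) : ArithmeticFunction ℝ := ⟨fun n => rr J n * ArithmeticFunction.vonMangoldt n, by simp⟩

lemma lz_apply (J n : ℕ) : lz J n = rr J n * ArithmeticFunction.vonMangoldt n := rfl

lemma lz_nonneg (J n : ℕ) : 0 ≤ lz J n := mul_nonneg (rr_nonneg J n) ArithmeticFunction.vonMangoldt_nonneg

lemma lz_le (J n : ℕ) : lz J n ≤ ArithmeticFunction.vonMangoldt n := 
  mul_le_of_le_one_left ArithmeticFunction.vonMangoldt_nonneg (rr_le J n)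

lemma lz_zero {J n : ℕ} (h : n < zz J) : lz J n = 0 := by
  rw [lz_apply]
  rcases Nat.eq_zero_or_pos n with rfl | h0
  · simp
  by_cases h1 : n = 1
  · subst h1; simp
  · rw [rr_zero h0 h1 h, zero_mul]

set_option maxHeartbeats 1000000 in
lemma l2_bound : ∃ i : ℕ, 5 ≤ i ∧ ∃ C : ℝ, 0 < C ∧ ∀ q J : ℕ, 0 < q → i ≤ J → q ≤ zz (J - i) → ∀ _ : NeZero q,
    ∀ X : ℕ, 1 ≤ X → ∀ σ : ℝ, 1 ≤ σ →
    ∑ χ : DirichletCharacter ℂ q, ∫ t, ‖PX χ (lz J) X σ t‖^2 * (1 + t^2)⁻¹ ≤ C * Real.log X := by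
  obtain ⟨i, hi, C, hC, H⟩ := brun_tit
  refine ⟨i, hi, 4 * π * C, by positivity, ?_⟩
  intro q J hq hJ hqz _ X hX σ hσ
  have ht : (0:ℝ) < q.totient := by exact_mod_cast Nat.totient_pos.2 hq
  rw [PX_l2]
  set h : ℕ → ℕ → ℝ := fun m n => if m ≤ n ∧ (m : ZMod q) = n ∧ IsUnit (n : ZMod q) then 
    q.totient * π * (lz J n / (n:ℝ)^2) * lz J m else 0 with hh
  have hh0 : ∀ m n, 0 ≤ h m n := by
    intro m n
    simp only [hh]
    have := lz_nonneg J m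
    have := lz_nonneg J n
    split_ifs
    · positivity
    · exact le_rfl
  have e1 : ∀ m ∈ Ioc 0 X, ∀ n ∈ Ioc 0 X, (if (n : ZMod q) = m ∧ IsUnit (n : ZMod q) then 
      (q.totient * (lz J m * lz J n * ((m:ℝ) * n)^(-σ)) : ℝ) * (π * gm (m / n)) else 0) ≤ h m n + h n m := by
    intro m hm n hn
    have hm1 : (1:ℝ) ≤ m := by exact_mod_cast (mem_Ioc.1 hm).1
    have hn1 : (1:ℝ) ≤ n := by exact_mod_cast (mem_Ioc.1 hn).1
    have h1 := lz_nonneg J m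
    have h2 := lz_nonneg J n
    split_ifs with hc
    swap
    · exact add_nonneg (hh0 _ _) (hh0 _ _)
    have hp : ((m:ℝ) * n)^(-σ) ≤ 1 / (m * n) := by
      rw [one_div, ← Real.rpow_neg_one]
      exact Real.rpow_le_rpow_of_exponent_le (by nlinarith) (by linarith)
    have hg0 : 0 ≤ gm ((m:ℝ)/n) := by unfold gm; positivity
    have key : ∀ B : ℝ, gm ((m:ℝ)/n) ≤ B → (q.totient * (lz J m * lz J n * ((m:ℝ) * n)^(-σ)) : ℝ) * (π * gm (m / n)) ≤
        (q.totient * (lz J m * lz J n * (1 / (m * n))) : ℝ) * (π * B) := by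
      intro B hB
      gcongr
    rcases le_total m n with hmn | hmn
    · have e := key (m/n) (min_le_left _ _)
      have : h m n = (q.totient * (lz J m * lz J n * (1 / (m * n))) : ℝ) * (π * (m/n)) := by
        simp only [hh]
        rw [if_pos ⟨hmn, hc.1.symm, hc.2⟩]
        field_simp
      rw [← this] at e
      linarith [hh0 n m]
    · have e := key ((m:ℝ)/n)⁻¹ (min_le_right _ _)
      have : h n m = (q.totient * (lz J m * lz J n * (1 / (m * n))) : ℝ) * (π * ((m:ℝ)/n)⁻¹) := by
        simp only [hh]
        rw [if_pos ⟨hmn, hc.1, hc.1 ▸ hc.2⟩]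
        field_simp
      rw [← this] at e
      linarith [hh0 m n]
  have e2 : ∑ n ∈ Ioc 0 X, ∑ m ∈ Ioc 0 X, h m n ≤ 2 * π * C * Real.log X := by
    have e3 : ∀ n ∈ Ioc 0 X, ∑ m ∈ Ioc 0 X, h m n ≤ π * C * (ArithmeticFunction.vonMangoldt n / (n:ℝ)) := by
      intro n hn
      have hn1 : (1:ℝ) ≤ n := by exact_mod_cast (mem_Ioc.1 hn).1
      have hL := ArithmeticFunction.vonMangoldt_nonneg (n := n)
      have hl := lz_nonneg J n
      by_cases hu : IsUnit (n : ZMod q)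
      swap
      · rw [Finset.sum_eq_zero]
        · positivity
        · intro m _
          simp [hh, hu]
      by_cases hz : n < zz J
      · rw [Finset.sum_eq_zero]
        · positivity
        · intro m _
          simp [hh, lz_zero hz]
      push Not at hz
      have hb := H q J hq hJ hqz n hu n hz
      have e4 : ∑ m ∈ Ioc 0 X, h m n ≤ q.totient * π * (lz J n / (n:ℝ)^2) * lam q n n := by
        unfold lam
        rw [Finset.mul_sum]
        calc ∑ m ∈ Ioc 0 X, h m n = ∑ m ∈ (Ioc 0 X).filter (fun m : ℕ => m ≤ n ∧ (m : ZMod q) = n), q.totient * π * (lz J n / (n:ℝ)^2) * lz J m := by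
              rw [Finset.sum_filter]
              refine Finset.sum_congr rfl fun m _ => ?_
              simp [hh, hu]
          _ ≤ ∑ m ∈ (Ioc 0 X).filter (fun m : ℕ => m ≤ n ∧ (m : ZMod q) = n), q.totient * π * (lz J n / (n:ℝ)^2) * ArithmeticFunction.vonMangoldt m := by
              refine Finset.sum_le_sum fun m _ => ?_
              exact mul_le_mul_of_nonneg_left (lz_le J m) (by positivity)
          _ ≤ _ := by
              refine Finset.sum_le_sum_of_subset_of_nonneg ?_ ?_
              · intro m hm
                simp only [mem_filter, mem_Ioc] at hm ⊢
                exact ⟨⟨hm.1.1, hm.2.1⟩, hm.2.2⟩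
              · intro m _ _
                exact mul_nonneg (by positivity) ArithmeticFunction.vonMangoldt_nonneg
      refine e4.trans ?_
      calc q.totient * π * (lz J n / (n:ℝ)^2) * lam q n n ≤ q.totient * π * (ArithmeticFunction.vonMangoldt n / (n:ℝ)^2) * (C * n / q.totient) := by
            have := lz_le J n
            have hl0 : 0 ≤ lam q n n := Finset.sum_nonneg fun _ _ => ArithmeticFunction.vonMangoldt_nonneg
            gcongr
        _ = _ := by field_simp
    refine (Finset.sum_le_sum e3).trans ?_
    rw [← Finset.mul_sum]
    have := mertens_up X hX
    calc _ ≤ π * C * (2 * Real.log X) := by gcongr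
      _ = _ := by ring
  calc _ ≤ ∑ m ∈ Ioc 0 X, ∑ n ∈ Ioc 0 X, (h m n + h n m) := 
        Finset.sum_le_sum fun m hm => Finset.sum_le_sum fun n hn => e1 m hm n hn
    _ = ∑ n ∈ Ioc 0 X, ∑ m ∈ Ioc 0 X, h m n + ∑ n ∈ Ioc 0 X, ∑ m ∈ Ioc 0 X, h m n := by
        simp_rw [Finset.sum_add_distrib]
        rw [Finset.sum_comm]
    _ ≤ _ := by linarith

end Gal

namespace Gal

lemma tw_mul {q : ℕ} (χ : DirichletCharacter ℂ q) (X : ℕ) (F G : ArithmeticFunction ℂ) (f g : ArithmeticFunction ℝ)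
    (hF : ∀ n ≤ X, F n = χ n * (f n : ℂ)) (hG : ∀ n ≤ X, G n = χ n * (g n : ℂ)) :
    ∀ n ≤ X, (F * G) n = χ n * ((f * g) n : ℂ) := by
  intro n hn
  rw [ArithmeticFunction.mul_apply, ArithmeticFunction.mul_apply, Complex.ofReal_sum, Finset.mul_sum]
  refine Finset.sum_congr rfl fun p hp => ?_
  have h := Nat.mem_divisorsAntidiagonal.1 hp
  have h0 : 0 < n := Nat.pos_of_ne_zero h.2
  have h1 : p.1 ≤ n := Nat.le_of_dvd h0 ⟨p.2, h.1.symm⟩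
  have h2 : p.2 ≤ n := Nat.le_of_dvd h0 ⟨p.1, by rw [mul_comm]; exact h.1.symm⟩
  rw [hF _ (h1.trans hn), hG _ (h2.trans hn), ← h.1]
  push_cast
  rw [map_mul]
  ring

noncomputable def At {q : ℕ} (χ : DirichletCharacter ℂ q) (J : ℕ) : ArithmeticFunction ℂ := 
  ⟨fun n => χ n * (lz J n : ℂ), by simp⟩

noncomputable def Bt {q : ℕ} (χ : DirichletCharacter ℂ q) (J X : ℕ) : ArithmeticFunction ℂ := 
  ⟨fun n => if n ≤ X then χ n * (lz J n : ℂ) else 0, by simp⟩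

lemma At_summable {q : ℕ} (χ : DirichletCharacter ℂ q) (J : ℕ) {s : ℂ} (hs : 1 < s.re) :
    LSeriesSummable (fun n => At χ J n) s := by
  have h := ArithmeticFunction.LSeriesSummable_vonMangoldt hs
  refine .of_norm <| h.norm.of_nonneg_of_le (fun _ ↦ norm_nonneg _) fun n ↦ LSeries.norm_term_le s ?_
  change ‖χ n * (lz J n : ℂ)‖ ≤ _
  rw [norm_mul, Complex.norm_real, Complex.norm_real, Real.norm_of_nonneg (lz_nonneg J n), 
    Real.norm_of_nonneg ArithmeticFunction.vonMangoldt_nonneg]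
  exact (mul_le_of_le_one_left (lz_nonneg J n) (χ.norm_le_one n)).trans (lz_le J n)

lemma Bt_summable {q : ℕ} (χ : DirichletCharacter ℂ q) (J X : ℕ) (s : ℂ) :
    LSeriesSummable (fun n => Bt χ J X n) s := by
  refine summable_of_hasFiniteSupport ((Set.finite_Iic X).subset fun n hn => ?_)
  by_contra hc
  apply hn
  simp only [Set.mem_Iic] at hc
  rw [LSeries.term_def]
  split_ifs
  · rfl
  · change (if n ≤ X then χ n * (lz J n : ℂ) else 0) / _ = 0
    rw [if_neg hc, zero_div]

lemma Bt_L {q : ℕ} (χ : DirichletCharacter ℂ q) (J X : ℕ) (σ t : ℝ) :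
    LSeries (fun n => Bt χ J X n) (σ + t * Complex.I) = PX χ (lz J) X σ t := by
  unfold LSeries PX
  rw [tsum_eq_sum (s := Ioc 0 X)]
  · refine Finset.sum_congr rfl fun n hn => ?_
    have h := mem_Ioc.1 hn
    rw [LSeries.term_def, if_neg h.1.ne', Complex.cpow_neg, ← div_eq_mul_inv]
    congr 1
    change (if n ≤ X then χ n * (lz J n : ℂ) else 0) = _
    rw [if_pos h.2]
  · intro n hn
    rw [LSeries.term_def]
    split_ifs with h0
    · rfl
    · change (if n ≤ X then χ n * (lz J n : ℂ) else 0) / _ = 0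
      rw [if_neg, zero_div]
      intro h
      exact hn (mem_Ioc.2 ⟨Nat.pos_of_ne_zero h0, h⟩)

noncomputable def l3 (J : ℕ) : ArithmeticFunction ℝ := lz J * lz J * lz J

noncomputable def Sχ {q : ℕ} (χ : DirichletCharacter ℂ q) (J X : ℕ) : ℂ :=
  ∑ n ∈ Ioc 0 X, χ n * (l3 J n : ℂ) * (wt (n / X) : ℂ)

open MeasureTheory in
set_option maxHeartbeats 1000000 in
lemma S_bound {q : ℕ} (χ : DirichletCharacter ℂ q) (J X : ℕ) (hX : 3 ≤ X) (B : ℝ) (hB : 0 ≤ B)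
    (hL : ∀ s : ℂ, s.re = 1 + 1 / Real.log X → ‖LSeries (fun n => At χ J n) s‖ ≤ B * (1 + |s.im|)^3) :
    ‖Sχ χ J X‖ ≤ 1000 * B * X * ∫ t, ‖PX χ (lz J) X (1 + 1 / Real.log X) t‖^2 * (1 + t^2)⁻¹ := by
  have hX0 : (0:ℝ) < X := by positivity
  have hlX : 0 < Real.log X := Real.log_pos (by exact_mod_cast (by omega : 1 < X))
  set σ : ℝ := 1 + 1 / Real.log X with hσ
  have hσ1 : 1 < σ := by rw [hσ]; linarith [one_div_pos.2 hlX]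
  set c : ArithmeticFunction ℂ := At χ J * Bt χ J X * Bt χ J X with hc
  have hre : ∀ t : ℝ, ((σ:ℂ) + t * Complex.I).re = σ := fun t => by simp
  have him : ∀ t : ℝ, ((σ:ℂ) + t * Complex.I).im = t := fun t => by simp
  have hs : ∀ t : ℝ, 1 < ((σ:ℂ) + t * Complex.I).re := fun t => by rw [hre]; exact hσ1
  have hA : ∀ s : ℂ, 1 < s.re → LSeriesSummable (fun n => (At χ J * Bt χ J X) n) s := fun s h =>
    ArithmeticFunction.LSeriesSummable_mul (At_summable χ J h) (Bt_summable χ J X _)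
  have hcs : LSeriesSummable (fun n => c n) (σ:ℂ) := 
    ArithmeticFunction.LSeriesSummable_mul (hA _ (by simpa using hσ1)) (Bt_summable χ J X _)
  have hp := perron (fun n => c n) σ hσ1.le hcs X (by omega)
  have hcl : ∀ t : ℝ, LSeries (fun n => c n) (σ + t * Complex.I) = LSeries (fun n => At χ J n) (σ + t * Complex.I) * (PX χ (lz J) X σ t)^2 := by
    intro t
    rw [hc, ArithmeticFunction.LSeries_mul' (hA _ (hs t)) (Bt_summable χ J X _), 
      ArithmeticFunction.LSeries_mul' (At_summable χ J (hs t)) (Bt_summable χ J X _), Bt_L]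
    ring
  have hS : Sχ χ J X = ∑ n ∈ Ioc 0 X, c n * (wt (n / X) : ℂ) := by
    refine Finset.sum_congr rfl fun n hn => ?_
    have hB1 : ∀ n ≤ X, Bt χ J X n = χ n * (lz J n : ℂ) := fun n hn => if_pos hn
    rw [hc, tw_mul χ X _ _ _ _ (tw_mul χ X (At χ J) _ (lz J) _ (fun _ _ => rfl) hB1) hB1 n (mem_Ioc.1 hn).2]
    rfl
  rw [hS, hp, norm_mul, Complex.norm_real]
  have hpt : ∀ t : ℝ, ‖(X:ℂ)^((σ:ℂ) + t * Complex.I) * kb (σ + t * Complex.I) * LSeries (fun n => c n) (σ + t * Complex.I)‖ ≤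
      (X * Real.exp 1 * 768 * B) * (‖PX χ (lz J) X σ t‖^2 * (1 + t^2)⁻¹) := by
    intro t
    rw [hcl, norm_mul, norm_mul, norm_mul, norm_pow, Complex.norm_natCast_cpow_of_pos (by omega), hre]
    have h1 : (X:ℝ)^σ = X * Real.exp 1 := by
      rw [hσ, Real.rpow_add hX0, Real.rpow_one, Real.rpow_def_of_pos hX0]
      congr 2
      field_simp
    have h2 := kb_bound σ t hσ1.le
    have h3 := hL _ (hre t)
    rw [him] at h3
    have h4 : 768 / (1 + |t|)^5 * (1 + |t|)^3 ≤ 768 * (1 + t^2)⁻¹ := by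
      have e : 768 / (1 + |t|)^5 * (1 + |t|)^3 = 768 * ((1 + |t|)^2)⁻¹ := by
        have : 0 < 1 + |t| := by positivity
        field_simp
      rw [e]
      have := one_add_sq_le t
      gcongr
    rw [h1]
    calc _ ≤ X * Real.exp 1 * (768 / (1 + |t|)^5) * (B * (1 + |t|)^3 * ‖PX χ (lz J) X σ t‖^2) := by
          gcongr
      _ = X * Real.exp 1 * (768 / (1 + |t|)^5 * (1 + |t|)^3) * B * ‖PX χ (lz J) X σ t‖^2 := by ring
      _ ≤ X * Real.exp 1 * (768 * (1 + t^2)⁻¹) * B * ‖PX χ (lz J) X σ t‖^2 := by gcongr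
      _ = _ := by ring
  have hi := norm_integral_le_of_norm_le ((PX_int χ (lz J) X σ).const_mul (X * Real.exp 1 * 768 * B)) 
    (Filter.Eventually.of_forall hpt)
  rw [integral_const_mul] at hi
  have hI0 : 0 ≤ ∫ t, ‖PX χ (lz J) X σ t‖^2 * (1 + t^2)⁻¹ := integral_nonneg fun t => by positivity
  rw [Real.norm_of_nonneg (by positivity)]
  have hexp : Real.exp 1 ≤ 3 := by linarith [Real.exp_one_lt_d9]
  have hpi : 1 / (2 * π) ≤ 1 / 6 := by
    have := Real.pi_gt_three
    exact one_div_le_one_div_of_le (by norm_num) (by linarith)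
  calc _ ≤ 1 / 6 * ((X * 3 * 768 * B) * ∫ t, ‖PX χ (lz J) X σ t‖^2 * (1 + t^2)⁻¹) := by
        refine mul_le_mul hpi (hi.trans ?_) (norm_nonneg _) (by norm_num)
        gcongr
    _ = 384 * (B * X * ∫ t, ‖PX χ (lz J) X σ t‖^2 * (1 + t^2)⁻¹) := by ring
    _ ≤ 1000 * (B * X * ∫ t, ‖PX χ (lz J) X σ t‖^2 * (1 + t^2)⁻¹) := by
        refine mul_le_mul_of_nonneg_right (by norm_num) (by positivity)
    _ = _ := by ring

noncomputable def TT (J q X : ℕ) (a : ZMod q) : ℝ :=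
  ∑ n ∈ (Ioc 0 X).filter (fun n : ℕ => (n : ZMod q) = a), l3 J n * wt (n / X)

lemma TT_orth {J q X : ℕ} [NeZero q] (a : ZMod q) (ha : IsUnit a) : 
    (q.totient * TT J q X a : ℂ) = ∑ χ : DirichletCharacter ℂ q, χ a⁻¹ * Sχ χ J X := by
  unfold Sχ TT
  simp_rw [Finset.mul_sum]
  rw [Finset.sum_comm, Finset.sum_filter]
  push_cast
  rw [Finset.mul_sum]
  refine Finset.sum_congr rfl fun n _ => ?_
  have h := DirichletCharacter.sum_char_inv_mul_char_eq ℂ ha (n : ZMod q)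
  calc _ = (if a = n then (q.totient : ℂ) else 0) * ((l3 J n : ℂ) * (wt (n / X) : ℂ)) := by
        by_cases hh : (n : ZMod q) = a
        · simp [hh]
        · simp [hh, Ne.symm hh]
    _ = _ := by
        rw [← h, Finset.sum_mul]
        refine Finset.sum_congr rfl fun χ _ => by ring

set_option maxHeartbeats 1000000 in
lemma TT_dev (c₂ : ℝ) (hc₂ : 0 < c₂) : ∃ i : ℕ, 5 ≤ i ∧ ∃ C : ℝ, 0 < C ∧ ∀ q J : ℕ, 1 < q → i ≤ J → q ≤ zz (J - i) → 
    Real.log q + 1 ≤ c₂ * Real.log (zz J) → ∀ _ : NeZero q, 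
    (∀ χ : DirichletCharacter ℂ q, ∀ s : ℂ, s.re > 1 - c₂ / Real.log (q * (|s.im| + 1)) → DirichletCharacter.LFunction χ s ≠ 0) →
    ∀ X : ℕ, zz J ≤ X → ∀ a b : ZMod q, IsUnit a → IsUnit b → 
    |TT J q X a - TT J q X b| ≤ C * X * Real.log (zz J) * Real.log X / q.totient := by
  obtain ⟨i1, hi1, C1, hC1, H1⟩ := ld_bound c₂ hc₂
  obtain ⟨i2, hi2, C2, hC2, H2⟩ := l2_bound
  refine ⟨max i1 i2, by omega, 2 * (1000 * C1 * C2), by positivity, ?_⟩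
  intro q J hq hJ hqz hl _ hgood X hX a b ha hb
  have ht : (0:ℝ) < q.totient := by exact_mod_cast Nat.totient_pos.2 (by omega)
  have hz1 : q ≤ zz (J - i1) := hqz.trans (zz_mono (by omega))
  have hz2 : q ≤ zz (J - i2) := hqz.trans (zz_mono (by omega))
  have hLp := log_zz_pos J
  have hzz : (2:ℝ) ≤ zz J := by exact_mod_cast two_le_zz J
  have hX3 : 3 ≤ X := by
    have := zz_mono (show 1 ≤ J by omega)
    have h : zz 1 = 4 := by norm_num [zz]
    omega
  have hlX : Real.log (zz J) ≤ Real.log X := Real.log_le_log (by linarith) (by exact_mod_cast hX)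
  set σ : ℝ := 1 + 1 / Real.log X with hσ
  have hσ1 : 1 < σ := by rw [hσ]; linarith [one_div_pos.2 (hLp.trans_le hlX)]
  have hσ2 : σ ≤ 1 + 1 / Real.log (zz J) := by
    rw [hσ]
    linarith [one_div_le_one_div_of_le hLp hlX]
  have hS : ∀ χ : DirichletCharacter ℂ q, χ ≠ 1 → ‖Sχ χ J X‖ ≤ 1000 * (C1 * Real.log (zz J)) * X * ∫ t, ‖PX χ (lz J) X σ t‖^2 * (1 + t^2)⁻¹ := by
    intro χ hχ
    refine S_bound χ J X hX3 _ (by positivity) fun s hs => ?_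
    have h := H1 q J hq (by omega) hz1 hl χ hχ inferInstance (hgood χ) s (by rw [hs]; exact hσ1) (by rw [hs]; exact hσ2)
    have e : ((fun n : ℕ => χ n * (rr J n : ℂ)) * fun n => (ArithmeticFunction.vonMangoldt n : ℂ)) = fun n => At χ J n := by
      funext n
      change _ = χ n * ((rr J n * ArithmeticFunction.vonMangoldt n : ℝ) : ℂ)
      simp only [Pi.mul_apply]
      push_cast; ring
    rw [e] at h
    exact h
  have h1 := TT_orth (J := J) (X := X) a ha
  have h2 := TT_orth (J := J) (X := X) b hb
  have h3 : ((q.totient * (TT J q X a - TT J q X b) : ℝ) : ℂ) = ∑ χ : DirichletCharacter ℂ q, (χ a⁻¹ - χ b⁻¹) * Sχ χ J X := by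
    push_cast
    rw [mul_sub, h1, h2, ← Finset.sum_sub_distrib]
    refine Finset.sum_congr rfl fun χ _ => by ring
  have h4 : q.totient * |TT J q X a - TT J q X b| ≤ 2 * (1000 * C1 * C2) * X * Real.log (zz J) * Real.log X := by
    have e : q.totient * |TT J q X a - TT J q X b| = ‖((q.totient * (TT J q X a - TT J q X b) : ℝ) : ℂ)‖ := by
      rw [Complex.norm_real, Real.norm_eq_abs, abs_mul, abs_of_pos ht]
    rw [e, h3]
    refine (norm_sum_le _ _).trans ?_
    calc _ ≤ ∑ χ : DirichletCharacter ℂ q, 2 * (1000 * (C1 * Real.log (zz J)) * X * ∫ t, ‖PX χ (lz J) X σ t‖^2 * (1 + t^2)⁻¹) := by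
          refine Finset.sum_le_sum fun χ _ => ?_
          have hI0 : 0 ≤ ∫ t, ‖PX χ (lz J) X σ t‖^2 * (1 + t^2)⁻¹ := MeasureTheory.integral_nonneg fun t => by positivity
          by_cases hχ : χ = 1
          · have ha' : IsUnit a⁻¹ := by
              exact IsUnit.of_mul_eq_one _ (ZMod.inv_mul_of_unit a ha)
            have hb' : IsUnit b⁻¹ := by
              exact IsUnit.of_mul_eq_one _ (ZMod.inv_mul_of_unit b hb)
            rw [hχ, MulChar.one_apply ha', MulChar.one_apply hb', sub_self, zero_mul, norm_zero]
            rw [hχ] at hI0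
            positivity
          · rw [norm_mul]
            refine mul_le_mul ?_ (hS χ hχ) (norm_nonneg _) (by norm_num)
            refine (norm_sub_le _ _).trans ?_
            linarith [χ.norm_le_one a⁻¹, χ.norm_le_one b⁻¹]
      _ = 2 * (1000 * (C1 * Real.log (zz J)) * X) * ∑ χ : DirichletCharacter ℂ q, ∫ t, ‖PX χ (lz J) X σ t‖^2 * (1 + t^2)⁻¹ := by
          rw [Finset.mul_sum]
          refine Finset.sum_congr rfl fun χ _ => by ring
      _ ≤ 2 * (1000 * (C1 * Real.log (zz J)) * X) * (C2 * Real.log X) := by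
          refine mul_le_mul_of_nonneg_left ?_ (by positivity)
          exact H2 q J (by omega) (by omega) hz2 inferInstance X (by omega) σ hσ1.le
      _ = _ := by ring
  rw [le_div_iff₀ ht, mul_comm]
  exact h4

end Gal

namespace Gal

open ArithmeticFunction in
noncomputable def DD (f : ArithmeticFunction ℝ) : ArithmeticFunction ℝ := pmul ArithmeticFunction.log f

lemma DD_apply (f : ArithmeticFunction ℝ) (n : ℕ) : DD f n = Real.log n * f n := rfl

lemma DD_mul (f g : ArithmeticFunction ℝ) : DD (f * g) = DD f * g + f * DD g := by
  ext n
  rw [DD_apply, ArithmeticFunction.add_apply, ArithmeticFunction.mul_apply, ArithmeticFunction.mul_apply, 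
    ArithmeticFunction.mul_apply, Finset.mul_sum, ← Finset.sum_add_distrib]
  refine Finset.sum_congr rfl fun p hp => ?_
  have h := Nat.mem_divisorsAntidiagonal.1 hp
  rw [DD_apply, DD_apply, ← h.1]
  have h0 : p.1 * p.2 ≠ 0 := h.1 ▸ h.2
  have h1 : (p.1:ℝ) ≠ 0 := by exact_mod_cast left_ne_zero_of_mul h0
  have h2 : (p.2:ℝ) ≠ 0 := by exact_mod_cast right_ne_zero_of_mul h0
  push_cast
  rw [Real.log_mul h1 h2]
  ring

lemma DD_add (f g : ArithmeticFunction ℝ) : DD (f + g) = DD f + DD g := by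
  ext n
  simp only [DD_apply, ArithmeticFunction.add_apply]; ring

open ArithmeticFunction in
lemma vm_identity : DD (DD (vonMangoldt)) = 
    3 * (DD (moebius : ArithmeticFunction ℝ) * DD (DD (zeta : ArithmeticFunction ℝ))) + 
      (moebius : ArithmeticFunction ℝ) * DD (DD (DD (zeta : ArithmeticFunction ℝ))) + 2 * (vonMangoldt * vonMangoldt * vonMangoldt) := by
  set M : ArithmeticFunction ℝ := (moebius : ArithmeticFunction ℝ) with hM
  set Z : ArithmeticFunction ℝ := (zeta : ArithmeticFunction ℝ) with hZ
  have hlog : DD Z = ArithmeticFunction.log := by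
    ext n
    rw [DD_apply, hZ, ArithmeticFunction.natCoe_apply, ArithmeticFunction.zeta_apply, ArithmeticFunction.log_apply]
    by_cases h : n = 0 <;> simp [h]
  have hL : M * DD Z = vonMangoldt := by rw [hlog]; exact moebius_mul_log_eq_vonMangoldt
  have hMZ : M * Z = 1 := coe_moebius_mul_coe_zeta
  have hD1 : DD (1 : ArithmeticFunction ℝ) = 0 := by
    ext n
    rw [DD_apply, ArithmeticFunction.one_apply]
    by_cases h : n = 1 <;> simp [h]
  have h1 : DD M * Z + M * DD Z = 0 := by rw [← DD_mul, hMZ, hD1]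
  have hDM : DD M = - (M * vonMangoldt) := by
    linear_combination M * h1 - (DD M + 0) * hMZ - M * hL
  have e1 := DD_mul M (DD Z)
  rw [hL] at e1
  have e2 : DD vonMangoldt = M * DD (DD Z) - vonMangoldt * vonMangoldt := by
    linear_combination e1 + DD Z * hDM - vonMangoldt * hL
  have e3 := DD_mul (DD M) (DD Z)
  have e4 := DD_mul M (DD (DD Z))
  have e5 : DD (DD vonMangoldt) + DD (vonMangoldt * vonMangoldt) = DD M * DD (DD Z) + M * DD (DD (DD Z)) := by
    rw [← DD_add, ← e4, e2]
    congr 1; ring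
  rw [DD_mul] at e5
  linear_combination e5 - 2 * vonMangoldt * e2 - 2 * DD (DD Z) * hDM

noncomputable def RR (J : ℕ) (f : ArithmeticFunction ℝ) : ArithmeticFunction ℝ := ⟨fun n => rr J n * f n, by simp⟩

lemma RR_apply (J : ℕ) (f : ArithmeticFunction ℝ) (n : ℕ) : RR J f n = rr J n * f n := rfl

lemma rr_mul (J m n : ℕ) : rr J (m * n) = rr J m * rr J n := by
  rw [rr_eq_cop, rr_eq_cop, rr_eq_cop]
  simp only [Nat.coprime_mul_iff_left]
  split_ifs <;> simp_all

lemma RR_mul (J : ℕ) (f g : ArithmeticFunction ℝ) : RR J (f * g) = RR J f * RR J g := by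
  ext n
  rw [RR_apply, ArithmeticFunction.mul_apply, ArithmeticFunction.mul_apply, Finset.mul_sum]
  refine Finset.sum_congr rfl fun p hp => ?_
  have h := Nat.mem_divisorsAntidiagonal.1 hp
  rw [RR_apply, RR_apply, ← h.1, rr_mul]
  ring

noncomputable def hw (d m : ℕ) : ℝ := Real.log m ^ 2 * (3 * Real.log d + Real.log m)

lemma lz_identity (J n : ℕ) : lz J n * Real.log n ^ 2 = 
    ∑ p ∈ n.divisorsAntidiagonal, rr J p.1 * (ArithmeticFunction.moebius p.1 : ℝ) * rr J p.2 * hw p.1 p.2 + 2 * l3 J n := by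
  have h := congrArg (fun f : ArithmeticFunction ℝ => rr J n * f n) vm_identity
  have hl3 : RR J (ArithmeticFunction.vonMangoldt * ArithmeticFunction.vonMangoldt * ArithmeticFunction.vonMangoldt) = l3 J := by
    rw [RR_mul, RR_mul]; rfl
  have h3 := congrArg (fun f : ArithmeticFunction ℝ => f n) hl3
  simp only [RR_apply] at h3
  have c2 : ∀ f : ArithmeticFunction ℝ, (2 * f) n = 2 * f n := fun f => by rw [two_mul, two_mul]; rfl
  have c3 : ∀ f : ArithmeticFunction ℝ, (3 * f) n = 3 * f n := fun f => by
    have : (3 : ArithmeticFunction ℝ) * f = f + f + f := by ring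
    rw [this, ArithmeticFunction.add_apply, ArithmeticFunction.add_apply]; ring
  simp only [ArithmeticFunction.add_apply, c2, c3, DD_apply] at h
  rw [lz_apply, ← h3]
  have e : rr J n * (3 * (DD (ArithmeticFunction.moebius : ArithmeticFunction ℝ) * DD (DD (ArithmeticFunction.zeta : ArithmeticFunction ℝ))) n + 
      ((ArithmeticFunction.moebius : ArithmeticFunction ℝ) * DD (DD (DD (ArithmeticFunction.zeta : ArithmeticFunction ℝ)))) n) = 
      ∑ p ∈ n.divisorsAntidiagonal, rr J p.1 * (ArithmeticFunction.moebius p.1 : ℝ) * rr J p.2 * hw p.1 p.2 := by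
    rw [ArithmeticFunction.mul_apply, ArithmeticFunction.mul_apply, Finset.mul_sum, ← Finset.sum_add_distrib, Finset.mul_sum]
    refine Finset.sum_congr rfl fun p hp => ?_
    have h := Nat.mem_divisorsAntidiagonal.1 hp
    have h0 : p.1 * p.2 ≠ 0 := h.1 ▸ h.2
    have h2 : p.2 ≠ 0 := right_ne_zero_of_mul h0
    have : rr J n = rr J p.1 * rr J p.2 := by rw [← h.1, rr_mul]
    simp only [DD_apply, ArithmeticFunction.natCoe_apply, ArithmeticFunction.intCoe_apply, ArithmeticFunction.zeta_apply, if_neg h2]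
    rw [this]
    unfold hw
    push_cast
    ring
  rw [← e]
  linear_combination h

lemma abel_id (w f : ℕ → ℝ) (N : ℕ) : ∑ n ∈ Ioc 0 N, w n * f n = 
    w N * ∑ n ∈ Ioc 0 N, f n + ∑ k ∈ range N, (w k - w (k+1)) * ∑ n ∈ Ioc 0 k, f n := by
  induction N with
  | zero => simp
  | succ N ih =>
    have e : ∀ g : ℕ → ℝ, ∑ n ∈ Ioc 0 (N+1), g n = ∑ n ∈ Ioc 0 N, g n + g (N+1) := fun g => by
      rw [← Finset.insert_Ioc_right_eq_Ioc_add_one (by omega), Finset.sum_insert (by simp)]; ring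
    rw [e, e, ih, Finset.sum_range_succ]
    ring

lemma abel_anti (w f : ℕ → ℝ) (N : ℕ) (M : ℝ) (hw : Antitone w) (h0 : ∀ n, 0 ≤ w n) 
    (hf : ∀ u ≤ N, |∑ n ∈ Ioc 0 u, f n| ≤ M) : |∑ n ∈ Ioc 0 N, w n * f n| ≤ w 0 * M := by
  rw [abel_id]
  refine (abs_add_le _ _).trans ?_
  have h1 : |w N * ∑ n ∈ Ioc 0 N, f n| ≤ w N * M := by
    rw [abs_mul, abs_of_nonneg (h0 N)]
    exact mul_le_mul_of_nonneg_left (hf N le_rfl) (h0 N)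
  have h2 : |∑ k ∈ range N, (w k - w (k+1)) * ∑ n ∈ Ioc 0 k, f n| ≤ (w 0 - w N) * M := by
    refine (Finset.abs_sum_le_sum_abs _ _).trans ?_
    rw [← Finset.sum_range_sub' w N, Finset.sum_mul]
    refine Finset.sum_le_sum fun k hk => ?_
    have : 0 ≤ w k - w (k+1) := sub_nonneg.2 (hw (Nat.le_succ k))
    rw [abs_mul, abs_of_nonneg this]
    exact mul_le_mul_of_nonneg_left (hf k (Finset.mem_range.1 hk).le) this
  linarith

lemma abel_mono (w f : ℕ → ℝ) (N : ℕ) (M : ℝ) (hw : Monotone w) (h0 : ∀ n, 0 ≤ w n) 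
    (hf : ∀ u ≤ N, |∑ n ∈ Ioc 0 u, f n| ≤ M) : |∑ n ∈ Ioc 0 N, w n * f n| ≤ 2 * w N * M := by
  have hM : 0 ≤ M := (abs_nonneg _).trans (hf 0 (Nat.zero_le _))
  rw [abel_id]
  refine (abs_add_le _ _).trans ?_
  have h1 : |w N * ∑ n ∈ Ioc 0 N, f n| ≤ w N * M := by
    rw [abs_mul, abs_of_nonneg (h0 N)]
    exact mul_le_mul_of_nonneg_left (hf N le_rfl) (h0 N)
  have h2 : |∑ k ∈ range N, (w k - w (k+1)) * ∑ n ∈ Ioc 0 k, f n| ≤ (w N - w 0) * M := by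
    refine (Finset.abs_sum_le_sum_abs _ _).trans ?_
    rw [← Finset.sum_range_sub w N, Finset.sum_mul]
    refine Finset.sum_le_sum fun k hk => ?_
    have : w k - w (k+1) ≤ 0 := sub_nonpos.2 (hw (Nat.le_succ k))
    rw [abs_mul, abs_of_nonpos this, neg_sub]
    exact mul_le_mul_of_nonneg_left (hf k (Finset.mem_range.1 hk).le) (by linarith)
  have := mul_nonneg (h0 0) hM
  nlinarith

lemma sum_antidiag (X : ℕ) (F : ℕ → ℕ → ℝ) : ∑ n ∈ Ioc 0 X, ∑ p ∈ n.divisorsAntidiagonal, F p.1 p.2 = 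
    ∑ d ∈ Ioc 0 X, ∑ m ∈ Ioc 0 X, if d * m ≤ X then F d m else 0 := by
  have e : ∀ n ∈ Ioc 0 X, ∑ p ∈ n.divisorsAntidiagonal, F p.1 p.2 = ∑ p ∈ Ioc 0 X ×ˢ Ioc 0 X with p.1 * p.2 = n, F p.1 p.2 := by
    intro n hn
    simp only [mem_Ioc] at hn
    rw [Nat.divisorsAntidiagonal_eq_prod_filter_of_le hn.1.ne' hn.2]
  rw [Finset.sum_congr rfl e]
  simp_rw [sum_filter]
  rw [sum_comm, Finset.sum_product]
  refine Finset.sum_congr rfl fun d hd => Finset.sum_congr rfl fun m hm => ?_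
  rw [Finset.sum_ite_eq]
  have : 0 < d * m := Nat.mul_pos (mem_Ioc.1 hd).1 (mem_Ioc.1 hm).1
  simp [this]

end Gal

namespace Gal

lemma hw_nonneg (d m : ℕ) : 0 ≤ hw d m := by
  have h1 := Real.log_natCast_nonneg d
  have h2 := Real.log_natCast_nonneg m
  unfold hw; positivity

lemma log_nat_mono {m n : ℕ} (h : m ≤ n) : Real.log m ≤ Real.log n := by
  rcases Nat.eq_zero_or_pos m with rfl | h0
  · simpa using Real.log_natCast_nonneg n
  · exact Real.log_le_log (by exact_mod_cast h0) (by exact_mod_cast h)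

lemma hw_mono (d : ℕ) : Monotone (hw d) := by
  intro m n h
  have h1 := Real.log_natCast_nonneg d
  have h2 := Real.log_natCast_nonneg m
  have h3 := log_nat_mono h
  unfold hw; gcongr

/-- the main summand -/
noncomputable def FF (J q X : ℕ) (a : ZMod q) (d m : ℕ) : ℝ :=
  if ((d * m : ℕ) : ZMod q) = a then rr J d * (ArithmeticFunction.moebius d : ℝ) * rr J m * hw d m * wt ((d * m : ℕ) / X) else 0

noncomputable def II (J q X : ℕ) (a : ZMod q) : ℝ :=
  ∑ d ∈ Ioc 0 X, ∑ m ∈ Ioc 0 X, if d * m ≤ X then FF J q X a d m else 0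

noncomputable def AA (J q X : ℕ) (a : ZMod q) : ℝ :=
  ∑ n ∈ (Ioc 0 X).filter (fun n : ℕ => (n : ZMod q) = a), lz J n * Real.log n ^ 2 * wt (n / X)

lemma AA_eq (J q X : ℕ) (a : ZMod q) : AA J q X a = II J q X a + 2 * TT J q X a := by
  unfold AA II TT
  rw [← sum_antidiag, Finset.sum_filter, Finset.sum_filter, Finset.mul_sum, ← Finset.sum_add_distrib]
  refine Finset.sum_congr rfl fun n hn => ?_
  have e : ∑ p ∈ n.divisorsAntidiagonal, FF J q X a p.1 p.2 = if (n : ZMod q) = a then 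
      (∑ p ∈ n.divisorsAntidiagonal, rr J p.1 * (ArithmeticFunction.moebius p.1 : ℝ) * rr J p.2 * hw p.1 p.2) * wt (n / X) else 0 := by
    split_ifs with h
    · rw [Finset.sum_mul]
      refine Finset.sum_congr rfl fun p hp => ?_
      have hp := Nat.mem_divisorsAntidiagonal.1 hp
      unfold FF
      rw [hp.1, if_pos h]
    · refine Finset.sum_eq_zero fun p hp => ?_
      have hp := Nat.mem_divisorsAntidiagonal.1 hp
      unfold FF
      rw [hp.1, if_neg h]
  rw [e]
  split_ifs with h
  · rw [lz_identity]; ring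
  · simp

lemma cong_iff {q : ℕ} {a c x : ZMod q} (hc : IsUnit c) : c * x = a ↔ x = a * c⁻¹ := by
  constructor
  · rintro rfl
    rw [mul_comm c x, mul_assoc, ZMod.mul_inv_of_unit c hc, mul_one]
  · rintro rfl
    rw [mul_comm, mul_assoc, ZMod.inv_mul_of_unit c hc, mul_one]

lemma unit_div {q : ℕ} {a c : ZMod q} (ha : IsUnit a) (hc : IsUnit c) : IsUnit (a * c⁻¹) :=
  ha.mul (IsUnit.of_mul_eq_one _ (ZMod.inv_mul_of_unit c hc))

/-- part with small m -/
lemma II_small : ∃ i : ℕ, 5 ≤ i ∧ ∃ C : ℝ, 0 < C ∧ ∀ q J : ℕ, 0 < q → i ≤ J → q ≤ zz (J - i) →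
    ∀ s X : ℕ, 1 ≤ s → zz J ^ (s + 1) ≤ X → ∀ a : ZMod q, IsUnit a → 
    |∑ d ∈ Ioc 0 X, ∑ m ∈ Ioc 0 X, if d * m ≤ X ∧ m ≤ zz J ^ s then FF J q X a d m else 0| ≤
      C * (X * Real.log X * ((s:ℝ)^3 * Real.log (zz J))) / q.totient := by
  obtain ⟨i, hi, C, hC, H⟩ := SS_upper
  refine ⟨i, hi, 12 * C, by positivity, ?_⟩
  intro q J hq hJ hqz s X hs hX a ha
  have ht : (0:ℝ) < q.totient := by exact_mod_cast Nat.totient_pos.2 hq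
  have hL := log_zz_pos J
  have hz2 := two_le_zz J
  set y := zz J ^ s with hy
  have hyz : zz J ≤ y := by
    calc zz J = zz J ^ 1 := (pow_one _).symm
      _ ≤ _ := Nat.pow_le_pow_right (by omega) hs
  have hyX : y ≤ X := le_trans (Nat.pow_le_pow_right (by omega) (by omega)) hX
  have hlX := Real.log_natCast_nonneg X
  have hly : Real.log y = s * Real.log (zz J) := by rw [hy]; push_cast; rw [Real.log_pow]
  have hly0 := Real.log_natCast_nonneg y
  rw [Finset.sum_comm]
  refine (Finset.abs_sum_le_sum_abs _ _).trans ?_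
  have key : ∀ m ∈ Ioc 0 X, |∑ d ∈ Ioc 0 X, if d * m ≤ X ∧ m ≤ y then FF J q X a d m else 0| ≤ 
      if m ≤ y then (4 * Real.log X * Real.log y ^ 2 * (C * X / (q.totient * Real.log (zz J)))) * (rr J m * (1 / (m:ℝ))) else 0 := by
    intro m hm
    have hm1 := (mem_Ioc.1 hm).1
    have hm0 : (0:ℝ) < m := by exact_mod_cast hm1
    split_ifs with hmy
    swap
    · rw [Finset.sum_eq_zero]
      · simp
      · intro d _
        rw [if_neg (fun h => hmy h.2)]
    have hr := rr_nonneg J m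
    by_cases hu : IsUnit (m : ZMod q)
    swap
    · rw [Finset.sum_eq_zero]
      · rw [abs_zero]; positivity
      · intro d _
        split_ifs
        · unfold FF
          rw [if_neg]
          intro h
          apply hu
          rw [Nat.cast_mul] at h
          exact isUnit_of_mul_isUnit_right (h ▸ ha)
        · rfl
    have hXm : zz J ≤ X / m := by
      rw [Nat.le_div_iff_mul_le hm1]
      calc zz J * m ≤ zz J * zz J ^ s := Nat.mul_le_mul_left _ hmy
        _ = zz J ^ (s+1) := by ring
        _ ≤ X := hX
    have hS := H q J hq hJ hqz (a * (m : ZMod q)⁻¹) (unit_div ha hu) (X / m) hXm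
    have hXm' : ((X / m : ℕ) : ℝ) ≤ X / m := Nat.cast_div_le
    have e1 : |∑ d ∈ Ioc 0 X, if d * m ≤ X ∧ m ≤ y then FF J q X a d m else 0| ≤ 
        (rr J m * (Real.log y ^ 2 * (4 * Real.log X))) * SS J q (a * (m : ZMod q)⁻¹) (X / m) := by
      refine (Finset.abs_sum_le_sum_abs _ _).trans ?_
      unfold SS
      rw [Finset.mul_sum]
      calc _ = ∑ d ∈ (Ioc 0 X).filter (fun d => d * m ≤ X ∧ ((d * m : ℕ) : ZMod q) = a), |FF J q X a d m| := by
            rw [Finset.sum_filter]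
            refine Finset.sum_congr rfl fun d _ => ?_
            by_cases h1 : d * m ≤ X
            · by_cases h2 : ((d * m : ℕ) : ZMod q) = a
              · rw [if_pos ⟨h1, hmy⟩, if_pos ⟨h1, h2⟩]
              · rw [if_pos ⟨h1, hmy⟩, if_neg (fun h => h2 h.2)]
                unfold FF
                rw [if_neg h2, abs_zero]
            · rw [if_neg (fun h => h1 h.1), if_neg (fun h => h1 h.1), abs_zero]
        _ ≤ ∑ d ∈ (Ioc 0 X).filter (fun d => d * m ≤ X ∧ ((d * m : ℕ) : ZMod q) = a), (rr J m * (Real.log y ^ 2 * (4 * Real.log X))) * rr J d := by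
            refine Finset.sum_le_sum fun d hd => ?_
            simp only [mem_filter, mem_Ioc] at hd
            unfold FF
            rw [if_pos hd.2.2, abs_mul, abs_mul, abs_mul, abs_mul, abs_of_nonneg (rr_nonneg J d), abs_of_nonneg hr, 
              abs_of_nonneg (hw_nonneg d m), abs_of_nonneg (wt_nonneg _)]
            have hmu : |(ArithmeticFunction.moebius d : ℝ)| ≤ 1 := by
              exact_mod_cast ArithmeticFunction.abs_moebius_le_one (n := d)
            have hh : hw d m ≤ Real.log y ^ 2 * (4 * Real.log X) := by
              unfold hw
              have h1 := log_nat_mono hmy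
              have h2 := log_nat_mono hd.1.2
              have h3 := log_nat_mono (hmy.trans hyX)
              have h4 := Real.log_natCast_nonneg m
              have h5 := Real.log_natCast_nonneg d
              gcongr
              linarith
            have hw1 : wt ((d * m : ℕ) / X) ≤ 1 := wt_le_one (by positivity)
            have hrd := rr_nonneg J d
            calc _ ≤ rr J d * 1 * rr J m * (Real.log y ^ 2 * (4 * Real.log X)) * 1 := by
                  have := hw_nonneg d m
                  have := wt_nonneg ((d * m : ℕ) / X)
                  gcongr
              _ = _ := by ring
        _ ≤ _ := by
            refine Finset.sum_le_sum_of_subset_of_nonneg ?_ ?_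
            · intro d hd
              simp only [mem_filter, mem_Ioc] at hd ⊢
              refine ⟨⟨hd.1.1, (Nat.le_div_iff_mul_le hm1).2 hd.2.1⟩, ?_⟩
              rw [← cong_iff hu, mul_comm]
              exact_mod_cast hd.2.2
            · intro d _ _
              have := rr_nonneg J d
              positivity
    refine e1.trans ?_
    calc _ ≤ (rr J m * (Real.log y ^ 2 * (4 * Real.log X))) * (C * (X / m) / (q.totient * Real.log (zz J))) := by
          refine mul_le_mul_of_nonneg_left (hS.trans ?_) (by positivity)
          gcongr
      _ = _ := by field_simp
  refine (Finset.sum_le_sum key).trans ?_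
  rw [← Finset.sum_filter, ← Finset.mul_sum]
  have hh : ∑ m ∈ (Ioc 0 X).filter (fun m => m ≤ y), rr J m * (1 / (m:ℝ)) ≤ 3 * Real.log y / Real.log (zz J) := by
    have := rough_harm (J := J) (Y := y) (by omega) hyz
    refine le_trans (le_of_eq ?_) this
    congr 1
    ext m; simp only [mem_filter, mem_Ioc]; omega
  calc _ ≤ (4 * Real.log X * Real.log y ^ 2 * (C * X / (q.totient * Real.log (zz J)))) * (3 * Real.log y / Real.log (zz J)) := by
        refine mul_le_mul_of_nonneg_left hh (by positivity)
    _ = _ := by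
        rw [hly]
        field_simp
        ring

/-- part with large m -/
lemma II_large : ∃ i : ℕ, 5 ≤ i ∧ ∃ C : ℝ, 0 < C ∧ ∀ q J : ℕ, 0 < q → i ≤ J → q ≤ zz (J - i) →
    ∀ s X : ℕ, 1 ≤ s → zz J ≤ X → ∀ a b : ZMod q, IsUnit a → IsUnit b → 
    |∑ d ∈ Ioc 0 X, ∑ m ∈ Ioc 0 X, if d * m ≤ X ∧ ¬ m ≤ zz J ^ s then FF J q X a d m - FF J q X b d m else 0| ≤
      C * (X * Real.log X * (Real.exp (-2 * s) * Real.log X ^ 3 / Real.log (zz J) ^ 2)) / q.totient := by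
  obtain ⟨i, hi, C, hC, H⟩ := SS_dev
  refine ⟨i, hi, 48 * C, by positivity, ?_⟩
  intro q J hq hJ hqz s X hs hX a b ha hb
  have ht : (0:ℝ) < q.totient := by exact_mod_cast Nat.totient_pos.2 hq
  have hL := log_zz_pos J
  have hz2 := two_le_zz J
  set y := zz J ^ s with hy
  have hyz : zz J ≤ y := by
    calc zz J = zz J ^ 1 := (pow_one _).symm
      _ ≤ _ := Nat.pow_le_pow_right (by omega) hs
  have hlX := Real.log_natCast_nonneg X
  have hX0 : (0:ℝ) < X := by exact_mod_cast (by omega : 0 < X)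
  have hly : Real.log y = s * Real.log (zz J) := by rw [hy]; push_cast; rw [Real.log_pow]
  refine (Finset.abs_sum_le_sum_abs _ _).trans ?_
  have key : ∀ d ∈ Ioc 0 X, |∑ m ∈ Ioc 0 X, if d * m ≤ X ∧ ¬ m ≤ y then FF J q X a d m - FF J q X b d m else 0| ≤ 
      (16 * Real.log X ^ 3 * (C * (X * Real.exp (-2 * s)) / (q.totient * Real.log (zz J)))) * (rr J d * (1 / (d:ℝ))) := by
    intro d hd
    have hd1 := (mem_Ioc.1 hd).1
    have hd0 : (0:ℝ) < d := by exact_mod_cast hd1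
    have hr := rr_nonneg J d
    by_cases hu : IsUnit (d : ZMod q)
    swap
    · rw [Finset.sum_eq_zero]
      · rw [abs_zero]; positivity
      · intro m _
        split_ifs
        · unfold FF
          rw [if_neg, if_neg, sub_zero]
          all_goals
            intro h
            apply hu
            rw [Nat.cast_mul] at h
          · exact isUnit_of_mul_isUnit_left (h ▸ hb)
          · exact isUnit_of_mul_isUnit_left (h ▸ ha)
        · rfl
    set N := X / d with hN
    set a' := a * (d : ZMod q)⁻¹ with ha'
    set b' := b * (d : ZMod q)⁻¹ with hb'
    set f : ℕ → ℝ := fun m => if m ≤ y then 0 else ((if (m : ZMod q) = a' then rr J m else 0) - (if (m : ZMod q) = b' then rr J m else 0)) with hf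
    have hNX : (N : ℝ) ≤ X / d := Nat.cast_div_le
    have hM : ∀ u ≤ N, |∑ n ∈ Ioc 0 u, f n| ≤ 2 * (C * ((X / d) * Real.exp (-2 * s)) / (q.totient * Real.log (zz J))) := by
      intro u hu1
      rcases le_total u y with huy | huy
      · rw [Finset.sum_eq_zero]
        · rw [abs_zero]; positivity
        · intro n hn
          simp only [hf]
          rw [if_pos ((mem_Ioc.1 hn).2.trans huy)]
      have hdev : ∀ v, y ≤ v → v ≤ u → |SS J q a' v - SS J q b' v| ≤ C * ((X / d) * Real.exp (-2 * s)) / (q.totient * Real.log (zz J)) := by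
        intro v hv1 hv2
        refine (H q J hq hJ hqz a' b' (unit_div ha hu) (unit_div hb hu) v (hyz.trans hv1)).trans ?_
        have hvN : (v:ℝ) ≤ X / d := le_trans (by exact_mod_cast hv2.trans hu1) hNX
        have hls : (s:ℝ) ≤ Real.log v / Real.log (zz J) := by
          rw [le_div_iff₀ hL, ← hly]
          exact log_nat_mono hv1
        have he : Real.exp (-2 * (Real.log v / Real.log (zz J))) ≤ Real.exp (-2 * s) := Real.exp_le_exp.2 (by linarith)
        gcongr
      have e : ∑ n ∈ Ioc 0 u, f n = (SS J q a' u - SS J q b' u) - (SS J q a' y - SS J q b' y) := by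
        have e1 : ∑ n ∈ Ioc 0 u, f n + ∑ n ∈ Ioc 0 y, ((if (n : ZMod q) = a' then rr J n else 0) - (if (n : ZMod q) = b' then rr J n else 0)) = 
          ∑ n ∈ Ioc 0 u, ((if (n : ZMod q) = a' then rr J n else 0) - (if (n : ZMod q) = b' then rr J n else 0)) := by
          have e2 : Ioc 0 y = (Ioc 0 u).filter (fun n => n ≤ y) := by
            ext n; simp only [mem_filter, mem_Ioc]; omega
          rw [e2, Finset.sum_filter, ← Finset.sum_add_distrib]
          refine Finset.sum_congr rfl fun n _ => ?_
          simp only [hf]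
          by_cases h : n ≤ y
          · rw [if_pos h, if_pos h, zero_add]
          · rw [if_neg h, if_neg h, add_zero]
        unfold SS
        simp only [Finset.sum_filter]
        rw [← Finset.sum_sub_distrib, ← Finset.sum_sub_distrib]
        linarith
      rw [e]
      have h1 := hdev u huy le_rfl
      have h2 := hdev y le_rfl huy
      exact (abs_sub _ _).trans (by linarith)
    have hA1 : ∀ u ≤ N, |∑ n ∈ Ioc 0 u, hw d n * f n| ≤ 8 * Real.log X ^ 3 * (2 * (C * ((X / d) * Real.exp (-2 * s)) / (q.totient * Real.log (zz J)))) := by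
      intro u hu1
      refine (abel_mono (hw d) f u _ (hw_mono d) (hw_nonneg d) (fun v hv => hM v (hv.trans hu1))).trans ?_
      have hh : hw d u ≤ 4 * Real.log X ^ 3 := by
        have h1 : Real.log u ≤ Real.log X := log_nat_mono (hu1.trans (Nat.div_le_self _ _))
        have h2 : Real.log d ≤ Real.log X := log_nat_mono (mem_Ioc.1 hd).2
        have h4 := Real.log_natCast_nonneg u
        have h5 := Real.log_natCast_nonneg d
        unfold hw
        calc _ ≤ Real.log X ^ 2 * (3 * Real.log X + Real.log X) := by gcongr
          _ = _ := by ring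
      refine mul_le_mul_of_nonneg_right (by linarith) (by positivity)
    have hA2 := abel_anti (fun m => wt ((d * m : ℕ) / X)) (fun n => hw d n * f n) N _ (fun m n h => ?_) (fun _ => wt_nonneg _) hA1
    swap
    · refine wt_anti ?_
      gcongr
    have hS : ∑ m ∈ Ioc 0 X, (if d * m ≤ X ∧ ¬ m ≤ y then FF J q X a d m - FF J q X b d m else 0) = 
        rr J d * (ArithmeticFunction.moebius d : ℝ) * ∑ m ∈ Ioc 0 N, wt ((d * m : ℕ) / X) * (hw d m * f m) := by
      rw [Finset.mul_sum]
      have e2 : Ioc 0 N = (Ioc 0 X).filter (fun m => d * m ≤ X) := by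
        ext m; simp only [mem_filter, mem_Ioc, hN, Nat.le_div_iff_mul_le hd1, mul_comm m d]
        constructor
        · rintro ⟨h1, h2⟩
          exact ⟨⟨h1, le_trans (Nat.le_mul_of_pos_left m hd1) h2⟩, h2⟩
        · rintro ⟨h1, h2⟩
          exact ⟨h1.1, h2⟩
      rw [e2, Finset.sum_filter]
      refine Finset.sum_congr rfl fun m _ => ?_
      by_cases h1 : d * m ≤ X
      swap
      · rw [if_neg h1, if_neg (fun h => h1 h.1)]
      rw [if_pos h1]
      by_cases h2 : m ≤ y
      · rw [if_neg (fun h => h.2 h2)]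
        simp [hf, h2]
      rw [if_pos ⟨h1, h2⟩]
      simp only [hf, if_neg h2]
      unfold FF
      have c1 : ((d * m : ℕ) : ZMod q) = a ↔ (m : ZMod q) = a' := by rw [Nat.cast_mul]; exact cong_iff hu
      have c2 : ((d * m : ℕ) : ZMod q) = b ↔ (m : ZMod q) = b' := by rw [Nat.cast_mul]; exact cong_iff hu
      simp only [c1, c2]
      split_ifs <;> ring
    rw [hS, abs_mul, abs_mul, abs_of_nonneg hr]
    have hmu : |(ArithmeticFunction.moebius d : ℝ)| ≤ 1 := by
      exact_mod_cast ArithmeticFunction.abs_moebius_le_one (n := d)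
    have hw1 : wt ((d * 0 : ℕ) / X) ≤ 1 := wt_le_one (by positivity)
    calc _ ≤ rr J d * 1 * (1 * (8 * Real.log X ^ 3 * (2 * (C * ((X / d) * Real.exp (-2 * s)) / (q.totient * Real.log (zz J)))))) := by
          refine mul_le_mul (by gcongr) (hA2.trans ?_) (abs_nonneg _) (by positivity)
          exact mul_le_mul_of_nonneg_right hw1 (by positivity)
      _ = _ := by field_simp; ring
  refine (Finset.sum_le_sum key).trans ?_
  rw [← Finset.mul_sum]
  have hh := rough_harm (J := J) (Y := X) (by omega) hX
  calc _ ≤ (16 * Real.log X ^ 3 * (C * (X * Real.exp (-2 * s)) / (q.totient * Real.log (zz J)))) * (3 * Real.log X / Real.log (zz J)) := by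
        refine mul_le_mul_of_nonneg_left hh (by positivity)
    _ = _ := by
        field_simp
        ring

lemma II_dev : ∃ i : ℕ, 5 ≤ i ∧ ∃ C : ℝ, 0 < C ∧ ∀ q J : ℕ, 0 < q → i ≤ J → q ≤ zz (J - i) →
    ∀ s X : ℕ, 1 ≤ s → zz J ^ (s + 1) ≤ X → ∀ a b : ZMod q, IsUnit a → IsUnit b → 
    |II J q X a - II J q X b| ≤ C * (X * Real.log X * ((s:ℝ)^3 * Real.log (zz J) + Real.exp (-2 * s) * Real.log X ^ 3 / Real.log (zz J) ^ 2)) / q.totient := by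
  obtain ⟨i1, hi1, C1, hC1, H1⟩ := II_small
  obtain ⟨i2, hi2, C2, hC2, H2⟩ := II_large
  refine ⟨max i1 i2, by omega, 2 * C1 + C2, by positivity, ?_⟩
  intro q J hq hJ hqz s X hs hX a b ha hb
  have ht : (0:ℝ) < q.totient := by exact_mod_cast Nat.totient_pos.2 hq
  have hL := log_zz_pos J
  have hlX := Real.log_natCast_nonneg X
  have hzX : zz J ≤ X := by
    refine le_trans ?_ hX
    calc zz J = zz J ^ 1 := (pow_one _).symm
      _ ≤ _ := Nat.pow_le_pow_right (by have := two_le_zz J; omega) (by omega)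
  have hz1 : q ≤ zz (J - i1) := hqz.trans (zz_mono (by omega))
  have hz2 : q ≤ zz (J - i2) := hqz.trans (zz_mono (by omega))
  have h1 := H1 q J hq (by omega) hz1 s X hs hX a ha
  have h1' := H1 q J hq (by omega) hz1 s X hs hX b hb
  have h2 := H2 q J hq (by omega) hz2 s X hs hzX a b ha hb
  set y := zz J ^ s
  have e : II J q X a - II J q X b = 
      (∑ d ∈ Ioc 0 X, ∑ m ∈ Ioc 0 X, if d * m ≤ X ∧ m ≤ y then FF J q X a d m else 0) - 
      (∑ d ∈ Ioc 0 X, ∑ m ∈ Ioc 0 X, if d * m ≤ X ∧ m ≤ y then FF J q X b d m else 0) + 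
      ∑ d ∈ Ioc 0 X, ∑ m ∈ Ioc 0 X, if d * m ≤ X ∧ ¬ m ≤ y then FF J q X a d m - FF J q X b d m else 0 := by
    unfold II
    rw [← Finset.sum_sub_distrib, ← Finset.sum_sub_distrib, ← Finset.sum_add_distrib]
    refine Finset.sum_congr rfl fun d _ => ?_
    rw [← Finset.sum_sub_distrib, ← Finset.sum_sub_distrib, ← Finset.sum_add_distrib]
    refine Finset.sum_congr rfl fun m _ => ?_
    by_cases h1 : d * m ≤ X <;> by_cases h2 : m ≤ y <;> simp [h1, h2]
  rw [e]
  refine (abs_add_le _ _).trans ((add_le_add_left (abs_sub _ _) _).trans ?_)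
  set u := X * Real.log X * ((s:ℝ)^3 * Real.log (zz J)) with hu
  set v := X * Real.log X * (Real.exp (-2 * s) * Real.log X ^ 3 / Real.log (zz J) ^ 2) with hv
  have hu0 : 0 ≤ u := by positivity
  have hv0 : 0 ≤ v := by positivity
  have e2 : X * Real.log X * ((s:ℝ)^3 * Real.log (zz J) + Real.exp (-2 * s) * Real.log X ^ 3 / Real.log (zz J) ^ 2) = u + v := by
    rw [hu, hv]; ring
  rw [e2]
  calc _ ≤ C1 * u / q.totient + C1 * u / q.totient + C2 * v / q.totient := by linarith
    _ = (2 * C1 * u + C2 * v) / q.totient := by ring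
    _ ≤ _ := by
        gcongr
        nlinarith [mul_nonneg hC1.le hv0, mul_nonneg hC2.le hu0]

end Gal

namespace Gal

lemma big_X : ∃ X0 : ℕ, ∀ X : ℕ, X0 ≤ X → ∃ r : ℝ, 2048 ≤ r ∧ r ^ 4 = X ∧ Real.log X ≤ r / 2048 := by
  have h1 : ∀ᶠ x : ℝ in Filter.atTop, ‖Real.log x‖ ≤ (1/2048) * ‖x ^ (1/4:ℝ)‖ := 
    (isLittleO_log_rpow_atTop (by norm_num : (0:ℝ) < 1/4)).bound (by norm_num)
  have h2 : ∀ᶠ x : ℝ in Filter.atTop, (2048:ℝ) ≤ x ^ (1/4:ℝ) := 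
    (tendsto_rpow_atTop (by norm_num : (0:ℝ) < 1/4)).eventually_ge_atTop 2048
  have h3 := tendsto_natCast_atTop_atTop (R := ℝ) |>.eventually (h1.and h2)
  obtain ⟨X0, h⟩ := Filter.eventually_atTop.1 h3
  refine ⟨X0, fun X hX => ⟨(X:ℝ)^(1/4:ℝ), (h X hX).2, ?_, ?_⟩⟩
  · rw [← Real.rpow_natCast, ← Real.rpow_mul (by positivity)]; norm_num
  · have := (h X hX).1
    rw [Real.norm_of_nonneg (Real.log_natCast_nonneg X), Real.norm_of_nonneg (by positivity)] at this
    linarith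

lemma theta_diff (X : ℕ) (r : ℝ) (hr : 2048 ≤ r) (hrX : r ^ 4 = X) (hl : Real.log X ≤ r / 2048) :
    (X:ℝ) / 4 ≤ Chebyshev.theta (X / 2) - Chebyshev.theta (Nat.sqrt X) := by
  have hX1 : (1000:ℝ) ≤ X := by
    rw [← hrX]
    nlinarith [pow_le_pow_left₀ (by norm_num) hr 4]
  have h1 := Chebyshev.theta_ge' (x := (X:ℝ)/2) (by linarith)
  have h2 := Chebyshev.theta_le_log4_mul_x (x := ((Nat.sqrt X : ℕ):ℝ)) (by positivity)
  have hs : √(X:ℝ) = r^2 := by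
    rw [← hrX, show r^4 = (r^2)^2 by ring, Real.sqrt_sq (by positivity)]
  have h3 : ((Nat.sqrt X : ℕ):ℝ) ≤ r^2 := by rw [← hs]; exact Real.nat_sqrt_le_real_sqrt
  have h4 : √((X:ℝ)/2) ≤ r^2 := by rw [← hs]; exact Real.sqrt_le_sqrt (by linarith)
  have h5 : Real.log ((X:ℝ)/2 + 2) ≤ r / 2048 := (Real.log_le_log (by linarith) (by linarith)).trans hl
  have h6 : Real.log ((X:ℝ)/2) ≤ r / 2048 := (Real.log_le_log (by linarith) (by linarith)).trans hl
  have h60 : 0 ≤ Real.log ((X:ℝ)/2) := Real.log_nonneg (by linarith)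
  have h7 : Real.log 4 ≤ 2 := by
    rw [show (4:ℝ) = 2^2 by norm_num, Real.log_pow]
    have := Real.log_two_lt_d9
    push_cast; linarith
  have h8 : 2 * √((X:ℝ)/2) * Real.log ((X:ℝ)/2) ≤ 2 * r^2 * (r/2048) := by gcongr
  have h9 : Real.log 4 * ((Nat.sqrt X : ℕ):ℝ) ≤ 2 * r^2 := by gcongr
  have h10 : ((X:ℝ)/2 - 1) * 0.69 ≤ ((X:ℝ)/2 - 1) * Real.log 2 := by
    have := Real.log_two_gt_d9
    exact mul_le_mul_of_nonneg_left (by linarith) (by linarith)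
  rw [← hrX] at *
  have h11 : 2048 * r^3 ≤ r^4 := by nlinarith [pow_pos (by linarith : 0 < r) 3]
  have h12 : 2048 * r^2 ≤ r^3 := by nlinarith [pow_pos (by linarith : 0 < r) 2]
  have h13 : 2048 * r ≤ r^2 := by nlinarith
  nlinarith

lemma rr_prime {J p : ℕ} (hp : p.Prime) (h : zz J ≤ p) : rr J p = 1 := by
  unfold rr
  rw [if_pos]
  intro l hl hlp hd
  have := (Nat.prime_dvd_prime_iff_eq hlp hp).1 hd
  omega

lemma main_lower (q J X : ℕ) [NeZero q] (hqz : q ≤ zz J) (hX : zz J ^ 2 ≤ X) (r : ℝ) (hr : 2048 ≤ r) (hrX : r ^ 4 = X) (hl : Real.log X ≤ r / 2048) :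
    X * Real.log X ^ 2 / 256 ≤ ∑ b : (ZMod q)ˣ, AA J q X b := by
  have hX1 : 1000 ≤ X := by
    have : (1000:ℝ) ≤ X := by
      rw [← hrX]
      nlinarith [pow_le_pow_left₀ (by norm_num) hr 4]
    exact_mod_cast this
  have hX0 : (0:ℝ) < X := by exact_mod_cast (by omega : 0 < X)
  set w := Nat.sqrt X with hw
  have hzw : zz J ≤ w := Nat.le_sqrt'.2 hX
  set S := ((Ioc 0 ⌊(X:ℝ)/2⌋₊).filter Nat.Prime).filter (fun p => w < p) with hS
  set g : ℕ → ℝ := fun n => lz J n * Real.log n ^ 2 * wt (n / X) with hg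
  have hg0 : ∀ n, 0 ≤ g n := fun n => by
    have := lz_nonneg J n
    have := wt_nonneg (n / X)
    simp only [hg]; positivity
  have hSm : ∀ p ∈ S, p.Prime ∧ w < p ∧ p ≤ X ∧ (p:ℝ) ≤ X / 2 := by
    intro p hp
    simp only [hS, mem_filter, mem_Ioc] at hp
    have h1 : (p:ℝ) ≤ X / 2 := (Nat.le_floor_iff (by positivity)).1 hp.1.1.2
    refine ⟨hp.1.2, hp.2, ?_, h1⟩
    have : (p:ℝ) ≤ X := by linarith
    exact_mod_cast this
  have e1 : ∑ p ∈ S, g p ≤ ∑ b : (ZMod q)ˣ, AA J q X b := by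
    unfold AA
    simp only [Finset.sum_filter]
    rw [Finset.sum_comm]
    calc ∑ p ∈ S, g p ≤ ∑ p ∈ S, ∑ b : (ZMod q)ˣ, (if (p : ZMod q) = b then g p else 0) := by
          refine Finset.sum_le_sum fun p hp => ?_
          have h := hSm p hp
          have hc : Nat.Coprime p q := by
            rw [Nat.Prime.coprime_iff_not_dvd h.1]
            intro hd
            have := Nat.le_of_dvd (Nat.pos_of_neZero q) hd
            omega
          have := Finset.single_le_sum (f := fun b : (ZMod q)ˣ => if (p : ZMod q) = b then g p else 0) 
            (fun b _ => by split_ifs; exacts [hg0 p, le_rfl]) (mem_univ (ZMod.unitOfCoprime p hc))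
          simpa using this
      _ ≤ _ := by
          refine Finset.sum_le_sum_of_subset_of_nonneg ?_ ?_
          · intro p hp
            have h := hSm p hp
            exact mem_Ioc.2 ⟨h.1.pos, h.2.2.1⟩
          · intro p _ _
            refine Finset.sum_nonneg fun b _ => ?_
            split_ifs
            · exact hg0 p
            · exact le_rfl
  have e2 : ∀ p ∈ S, Real.log X ^ 2 / 64 * Real.log p ≤ g p := by
    intro p hp
    have h := hSm p hp
    have hp0 : (0:ℝ) < p := by exact_mod_cast h.1.pos
    have hlz : lz J p = Real.log p := by
      rw [lz_apply, rr_prime h.1 (by omega), one_mul, ArithmeticFunction.vonMangoldt_apply_prime h.1]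
    have hlp : Real.log X / 2 ≤ Real.log p := by
      have h1 : X < p * p := Nat.sqrt_lt.1 h.2.1
      have h2 : Real.log X ≤ Real.log ((p * p : ℕ) : ℝ) := log_nat_mono h1.le
      push_cast at h2
      rw [Real.log_mul hp0.ne' hp0.ne'] at h2
      linarith
    have hwt : 1 / 16 ≤ wt (p / X) := by
      have : wt (1/2) = 1/16 := by unfold wt; norm_num
      rw [← this]
      refine wt_anti ?_
      rw [div_le_iff₀ hX0]; linarith
    simp only [hg]
    rw [hlz]
    have hl0 := Real.log_natCast_nonneg p
    have hlX := Real.log_natCast_nonneg X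
    calc _ = Real.log p * (Real.log X / 2)^2 * (1/16) := by ring
      _ ≤ _ := by gcongr
  have e3 : (X:ℝ) / 4 ≤ ∑ p ∈ S, Real.log p := by
    have h := theta_diff X r hr hrX hl
    have h1 : Chebyshev.theta (X/2) ≤ ∑ p ∈ S, Real.log p + Chebyshev.theta w := by
      unfold Chebyshev.theta
      rw [hS, ← Finset.sum_filter_add_sum_filter_not _ (fun p => w < p)]
      refine add_le_add le_rfl ?_
      refine Finset.sum_le_sum_of_subset_of_nonneg ?_ fun p _ _ => Real.log_natCast_nonneg p
      intro p hp
      simp only [mem_filter, mem_Ioc, Nat.floor_natCast] at hp ⊢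
      exact ⟨⟨hp.1.1.1, by omega⟩, hp.1.2⟩
    linarith
  calc X * Real.log X ^ 2 / 256 = Real.log X ^ 2 / 64 * (X / 4) := by ring
    _ ≤ Real.log X ^ 2 / 64 * ∑ p ∈ S, Real.log p := by gcongr
    _ ≤ ∑ p ∈ S, g p := by rw [Finset.mul_sum]; exact Finset.sum_le_sum e2
    _ ≤ _ := e1

lemma AA_upper (J q X : ℕ) (hX : 1 ≤ X) (a : ZMod q) : AA J q X a ≤ Real.log X ^ 2 * 
    (Real.log X * (((Finset.Iic X).filter (fun p : ℕ => p.Prime ∧ (p : ZMod q) = a)).card : ℝ) + 2 * √(X:ℝ) * Real.log X) := by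
  have hlX := Real.log_natCast_nonneg X
  have hX0 : (0:ℝ) < X := by exact_mod_cast hX
  have h1 : AA J q X a ≤ Real.log X ^ 2 * ∑ n ∈ (Ioc 0 X).filter (fun n : ℕ => (n : ZMod q) = a), ArithmeticFunction.vonMangoldt n := by
    unfold AA
    rw [Finset.mul_sum]
    refine Finset.sum_le_sum fun n hn => ?_
    simp only [mem_filter, mem_Ioc] at hn
    have h2 := log_nat_mono hn.1.2
    have h3 := Real.log_natCast_nonneg n
    have h4 : wt (n / X) ≤ 1 := wt_le_one (by positivity)
    have h5 := lz_le J n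
    have h6 := lz_nonneg J n
    have h7 := wt_nonneg (n / X)
    have h8 := ArithmeticFunction.vonMangoldt_nonneg (n := n)
    calc _ ≤ ArithmeticFunction.vonMangoldt n * Real.log X ^ 2 * 1 := by gcongr
      _ = _ := by ring
  refine h1.trans (mul_le_mul_of_nonneg_left ?_ (by positivity))
  rw [← Finset.sum_filter_add_sum_filter_not _ Nat.Prime]
  refine add_le_add ?_ ?_
  · calc _ ≤ ∑ p ∈ (Finset.Iic X).filter (fun p : ℕ => p.Prime ∧ (p : ZMod q) = a), Real.log X := by
          refine (Finset.sum_le_sum (g := fun _ => Real.log X) fun n hn => ?_).trans ?_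
          · simp only [mem_filter, mem_Ioc] at hn
            rw [ArithmeticFunction.vonMangoldt_apply_prime hn.2]
            exact log_nat_mono hn.1.1.2
          · refine Finset.sum_le_sum_of_subset_of_nonneg ?_ fun _ _ _ => hlX
            intro n hn
            simp only [mem_filter, mem_Ioc, mem_Iic] at hn ⊢
            exact ⟨hn.1.1.2, hn.2, hn.1.2⟩
      _ = _ := by rw [Finset.sum_const, nsmul_eq_mul]; ring
  · refine le_trans ?_ (Chebyshev.psi_sub_theta_le (x := X) (by exact_mod_cast hX))
    rw [Chebyshev.psi_sub_theta_eq_sum_not_prime, Nat.floor_natCast]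
    refine Finset.sum_le_sum_of_subset_of_nonneg ?_ fun _ _ _ => ArithmeticFunction.vonMangoldt_nonneg
    intro n hn
    simp only [mem_filter, mem_Ioc] at hn ⊢
    exact ⟨hn.1.1, hn.2⟩

end Gal

namespace Gal

lemma choose_s (C1 C2 : ℝ) : ∃ s : ℕ, 2 ≤ s ∧ 
    C2 * (1 / (s:ℝ) + 4 * ((s:ℝ)^8 * Real.exp (-s))) + 2 * C1 * (1 / (s:ℝ)) ≤ 1 / 512 := by
  have h1 := tendsto_one_div_atTop_nhds_zero_nat (𝕜 := ℝ)
  have h2 := (tendsto_pow_mul_exp_neg_atTop_nhds_zero 8).comp (tendsto_natCast_atTop_atTop (R := ℝ))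
  have h3 := ((h1.add (h2.const_mul 4)).const_mul C2).add (h1.const_mul (2 * C1))
  simp only [mul_zero, add_zero] at h3
  have h4 := h3.eventually (ge_mem_nhds (show (0:ℝ) < 1/512 by norm_num))
  obtain ⟨s, hs1, hs2⟩ := (h4.and (Filter.eventually_ge_atTop 2)).exists
  exact ⟨s, hs2, hs1⟩

set_option maxHeartbeats 1000000 in
lemma core (c₂ : ℝ) (hc₂ : 0 < c₂) : ∃ K i X0 : ℕ, 4 ≤ K ∧ ∀ q J X : ℕ, 1 < q → i ≤ J → q ≤ zz (J - i) → 
    Real.log q + 1 ≤ c₂ * Real.log (zz J) → ∀ _ : NeZero q, 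
    (∀ χ : DirichletCharacter ℂ q, ∀ s : ℂ, s.re > 1 - c₂ / Real.log (q * (|s.im| + 1)) → DirichletCharacter.LFunction χ s ≠ 0) →
    zz J ^ K ≤ X → X ≤ zz J ^ (2 * K) → X0 ≤ X → ∀ a : ZMod q, IsUnit a → 
    (X:ℝ) / (1024 * q.totient) ≤ Real.log X * (((Finset.Iic X).filter (fun p : ℕ => p.Prime ∧ (p : ZMod q) = a)).card : ℝ) := by
  obtain ⟨i1, hi1, C1, hC1, H1⟩ := TT_dev c₂ hc₂
  obtain ⟨i2, hi2, C2, hC2, H2⟩ := II_dev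
  obtain ⟨s, hs2, hs⟩ := choose_s C1 C2
  obtain ⟨X0, hX0⟩ := big_X
  have hs4 : 16 ≤ s^4 := by
    calc 16 = 2^4 := by norm_num
      _ ≤ _ := Nat.pow_le_pow_left hs2 4
  have hss : s + 1 ≤ s^4 := by nlinarith [Nat.pow_le_pow_left hs2 3, pow_succ s 3]
  refine ⟨s^4, max i1 i2, X0, by omega, ?_⟩
  intro q J X hq hJ hqz hlq _ hgood hXK hX2K hXX a ha
  obtain ⟨r, hr, hrX, hrl⟩ := hX0 X hXX
  have htn : 0 < q.totient := Nat.totient_pos.2 (by omega)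
  have ht : (0:ℝ) < q.totient := by exact_mod_cast htn
  have hz1 : q ≤ zz (J - i1) := hqz.trans (zz_mono (by omega))
  have hz2 : q ≤ zz (J - i2) := hqz.trans (zz_mono (by omega))
  have hqJ : q ≤ zz J := hqz.trans (zz_mono (by omega))
  have hzp : 0 < zz J := by have := two_le_zz J; omega
  have hzs : zz J ^ (s+1) ≤ X := (Nat.pow_le_pow_right hzp hss).trans hXK
  have hzz2 : zz J ^ 2 ≤ X := (Nat.pow_le_pow_right hzp (by omega)).trans hXK
  have hz4 : zz J ^ 4 ≤ X := (Nat.pow_le_pow_right hzp (by omega)).trans hXK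
  have hzX : zz J ≤ X := by
    refine le_trans ?_ hzz2
    exact Nat.le_self_pow (by norm_num) _
  have hL := log_zz_pos J
  set L := Real.log (zz J) with hLd
  have hlX1 : (s:ℝ)^4 * L ≤ Real.log X := by
    have := log_nat_mono hXK
    push_cast at this
    rw [Real.log_pow] at this
    push_cast at this
    exact this
  have hlX2 : Real.log X ≤ 2 * (s:ℝ)^4 * L := by
    have := log_nat_mono hX2K
    push_cast at this
    rw [Real.log_pow] at this
    push_cast at this
    exact this
  set l := Real.log X with hld
  have hs0 : (2:ℝ) ≤ s := by exact_mod_cast hs2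
  have hsp : (0:ℝ) < s := by linarith
  have hl0 : 0 < l := lt_of_lt_of_le (by positivity) hlX1
  have hXp : (0:ℝ) < X := by rw [← hrX]; positivity
  -- deviation
  have hdev : ∀ b : ZMod q, IsUnit b → AA J q X b - (X * l^2 / 512) / q.totient ≤ AA J q X a := by
    intro b hb
    have d1 := H1 q J hq (by omega) hz1 hlq inferInstance hgood X hzX a b ha hb
    have d2 := H2 q J (by omega) (by omega) hz2 s X (by omega) hzs a b ha hb
    rw [AA_eq, AA_eq]
    have b1 : L ≤ l / (s:ℝ)^4 := by rw [le_div_iff₀ (by positivity)]; linarith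
    have b2 : l^3 / L^2 ≤ 4 * (s:ℝ)^8 * l := by
      rw [div_le_iff₀ (by positivity)]
      have : l^2 ≤ (2 * (s:ℝ)^4 * L)^2 := pow_le_pow_left₀ hl0.le hlX2 2
      calc l^3 = l * l^2 := by ring
        _ ≤ l * (2 * (s:ℝ)^4 * L)^2 := by gcongr
        _ = _ := by ring
    have b3 : C1 * X * L * l / q.totient ≤ C1 * X * (l / s) * l / q.totient := by
      have : L ≤ l / s := by
        refine b1.trans ?_
        refine div_le_div_of_nonneg_left hl0.le hsp ?_
        calc (s:ℝ) = s^1 := (pow_one _).symm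
          _ ≤ s^4 := pow_le_pow_right₀ (by linarith) (by norm_num)
      gcongr
    have b4 : C2 * (X * l * ((s:ℝ)^3 * L + Real.exp (-2 * s) * l ^ 3 / L ^ 2)) / q.totient ≤ 
        C2 * (X * l * (l / s + 4 * (s:ℝ)^8 * Real.exp (-s) * l)) / q.totient := by
      have c1 : (s:ℝ)^3 * L ≤ l / s := by
        calc (s:ℝ)^3 * L ≤ (s:ℝ)^3 * (l / (s:ℝ)^4) := by gcongr
          _ = _ := by field_simp
      have c2 : Real.exp (-2 * s) * l ^ 3 / L ^ 2 ≤ 4 * (s:ℝ)^8 * Real.exp (-s) * l := by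
        have : Real.exp (-2 * (s:ℝ)) ≤ Real.exp (-s) := Real.exp_le_exp.2 (by linarith)
        calc _ = Real.exp (-2 * s) * (l ^ 3 / L ^ 2) := by ring
          _ ≤ Real.exp (-s) * (4 * (s:ℝ)^8 * l) := by gcongr
          _ = _ := by ring
      gcongr
    have b5 : C2 * (X * l * (l / s + 4 * (s:ℝ)^8 * Real.exp (-s) * l)) / q.totient + 2 * (C1 * X * (l / s) * l / q.totient) ≤ 
        (X * l^2 / 512) / q.totient := by
      calc _ = (X * l^2 * (C2 * (1 / (s:ℝ) + 4 * ((s:ℝ)^8 * Real.exp (-s))) + 2 * C1 * (1 / (s:ℝ)))) / q.totient := by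
            field_simp
        _ ≤ (X * l^2 * (1/512)) / q.totient := by gcongr
        _ = _ := by ring
    have a1 := neg_le_of_abs_le d1
    have a2 := neg_le_of_abs_le d2
    linarith
  have hmain := main_lower q J X hqJ hzz2 r hr hrX hrl
  have hsum : ∑ b : (ZMod q)ˣ, AA J q X b ≤ q.totient * AA J q X a + X * l^2 / 512 := by
    have : ∑ b : (ZMod q)ˣ, AA J q X b ≤ ∑ b : (ZMod q)ˣ, (AA J q X a + (X * l^2 / 512) / q.totient) := by
      refine Finset.sum_le_sum fun b _ => ?_
      linarith [hdev b b.isUnit]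
    refine this.trans (le_of_eq ?_)
    rw [Finset.sum_const, Finset.card_univ, ZMod.card_units_eq_totient, nsmul_eq_mul, mul_add, mul_div_cancel₀ _ ht.ne']
  have hup := AA_upper J q X (by exact_mod_cast hXp) a
  set P : ℝ := (((Finset.Iic X).filter (fun p : ℕ => p.Prime ∧ (p : ZMod q) = a)).card : ℝ) with hP
  have h1 : X * l^2 / 512 ≤ q.totient * (l^2 * (l * P + 2 * √(X:ℝ) * l)) := by
    have := mul_le_mul_of_nonneg_left hup ht.le
    linarith
  have h2 : (X:ℝ) / 512 ≤ q.totient * (l * P + 2 * √(X:ℝ) * l) := by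
    have hl2 : 0 < l^2 := by positivity
    refine le_of_mul_le_mul_left ?_ hl2
    linarith
  have hsq : √(X:ℝ) = r^2 := by
    rw [← hrX, show r^4 = (r^2)^2 by ring, Real.sqrt_sq (by positivity)]
  have htr : (q.totient : ℝ) ≤ r := by
    have e1 : q.totient ≤ zz J := (Nat.totient_le q).trans hqJ
    have e2 : ((zz J : ℕ):ℝ)^4 ≤ r^4 := by rw [hrX]; exact_mod_cast hz4
    have e3 : ((zz J : ℕ):ℝ) ≤ r := le_of_pow_le_pow_left₀ (by norm_num) (by linarith) e2
    exact le_trans (by exact_mod_cast e1) e3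
  have h3 : q.totient * (2 * √(X:ℝ) * l) ≤ X / 1024 := by
    rw [hsq, ← hrX]
    calc (q.totient:ℝ) * (2 * r^2 * l) ≤ r * (2 * r^2 * (r / 2048)) := by gcongr
      _ = _ := by ring
  rw [div_le_iff₀ (by positivity)]
  rw [mul_add] at h2
  nlinarith

end Gal

/-- (Gallagher) For every `c₂ > 0` there exist `D > 0` and `c₃ > 0` such that for every
good modulus `q` (with respect to `c₂`), every `a` coprime to `q`, and every `x ≥ q^D`,
one has `π(x; q, a) ≥ c₃ · x / (φ(q) log x)`. -/
theorem gallagher_primes_in_progressions_good_modulus (c₂ : ℝ) (hc₂ : 0 < c₂) :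
    ∃ D > (0 : ℝ), ∃ c₃ > (0 : ℝ), ∀ q : ℕ, ∀ hq : 1 < q, IsGoodModulus c₂ q hq →
      ∀ a : ℕ, Nat.Coprime a q → ∀ x : ℝ, (q : ℝ) ^ D ≤ x →
        (primeCount x q a : ℝ) ≥ c₃ * x / (Nat.totient q * Real.log x) := by
  obtain ⟨K, i, X0, hK, H⟩ := Gal.core c₂ hc₂
  have hKR : (4:ℝ) ≤ K := by exact_mod_cast hK
  set M : ℕ := 2 * K + 2 * X0 + 4 with hM
  obtain ⟨D, hD1, hD2, hD3⟩ : ∃ D : ℝ, (M : ℝ) ≤ D ∧ 4 * K * 2 ^ i ≤ D ∧ 12 * K / c₂ ≤ D :=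
    ⟨max (M:ℝ) (max (4 * K * 2 ^ i) (12 * K / c₂)), le_max_left _ _,
      (le_max_left _ _).trans (le_max_right _ _), (le_max_right _ _).trans (le_max_right _ _)⟩
  have hMR : (M:ℝ) = 2 * K + 2 * X0 + 4 := by rw [hM]; push_cast; ring
  have hDp : 0 < D := by
    have : (0:ℝ) ≤ X0 := Nat.cast_nonneg _
    linarith
  refine ⟨D, hDp, 1 / 2048, by norm_num, fun q hq hgood a ha x hx => ?_⟩
  have hqR : (2:ℝ) ≤ q := by exact_mod_cast hq
  have hlq : 1 / 2 ≤ Real.log q := by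
    have h1 := Real.log_two_gt_d9
    have h2 : Real.log 2 ≤ Real.log q := Real.log_le_log (by norm_num) hqR
    linarith
  have hl2 : Real.log 2 ≤ Real.log q := Real.log_le_log (by norm_num) hqR
  -- `x` is large
  have hxM : (2:ℝ) ^ M ≤ x := by
    calc (2:ℝ) ^ M = (2:ℝ) ^ (M:ℝ) := (Real.rpow_natCast _ _).symm
      _ ≤ (2:ℝ) ^ D := Real.rpow_le_rpow_of_exponent_le (by norm_num) hD1
      _ ≤ (q:ℝ) ^ D := Real.rpow_le_rpow (by norm_num) hqR hDp.le
      _ ≤ x := hx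
  have hx4 : 4 ≤ x := by
    have : (2:ℝ) ^ 2 ≤ 2 ^ M := pow_le_pow_right₀ (by norm_num) (by omega)
    linarith
  set X : ℕ := ⌊x⌋₊ with hX
  have hXle : (X:ℝ) ≤ x := Nat.floor_le (by linarith)
  have hXlt : x < X + 1 := Nat.lt_floor_add_one x
  have hXM : 2 ^ M ≤ X := Nat.le_floor (by exact_mod_cast hxM)
  have hX0 : X0 ≤ X := by
    have h1 : X0 < 2 ^ X0 := Nat.lt_two_pow_self
    have h2 : 2 ^ X0 ≤ 2 ^ M := Nat.pow_le_pow_right (by norm_num) (by omega)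
    omega
  have hXK : 2 ^ K ≤ X := (Nat.pow_le_pow_right (by norm_num) (by omega)).trans hXM
  have hX4 : (3:ℝ) < X := by linarith
  have hXx : x / 2 ≤ X := by linarith
  have hlogx : D * Real.log q ≤ Real.log x := by
    rw [← Real.log_rpow (by linarith)]
    exact Real.log_le_log (by positivity) hx
  have hlogX : D / 2 * Real.log q ≤ Real.log X := by
    have h1 : x ≤ (X:ℝ) ^ 2 := by nlinarith
    have h2 : Real.log x ≤ Real.log ((X:ℝ)^2) := Real.log_le_log (by linarith) h1
    rw [Real.log_pow] at h2
    push_cast at h2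
    linarith
  -- choice of `J`
  have hex : ∃ n, X < Gal.zz n ^ K := by
    refine ⟨X, ?_⟩
    have h1 : X < 2 ^ X := Nat.lt_two_pow_self
    have h2 : 2 ^ X < 2 ^ 2 ^ X := Nat.pow_lt_pow_right (by norm_num) h1
    have h3 : Gal.zz X ≤ Gal.zz X ^ K := Nat.le_self_pow (by omega) _
    have h4 : Gal.zz X = 2 ^ 2 ^ X := rfl
    omega
  obtain ⟨J, hJ1, hJ2⟩ : ∃ J, Gal.zz J ^ K ≤ X ∧ X < Gal.zz (J+1) ^ K := by
    classical
    have hs := Nat.find_spec hex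
    have hm := fun m => Nat.find_min hex (m := m)
    rcases hn : Nat.find hex with _ | n
    · rw [hn] at hs
      have : Gal.zz 0 = 2 := by simp [Gal.zz]
      rw [this] at hs
      omega
    · rw [hn] at hs hm
      exact ⟨n, not_lt.mp (hm n (by omega)), hs⟩
  have hJ3 : X ≤ Gal.zz J ^ (2*K) := by
    rw [Gal.zz_succ, ← pow_mul] at hJ2
    exact hJ2.le
  have hL := Gal.log_zz_pos J
  set L := Real.log (Gal.zz J) with hLdef
  have hXL : Real.log X ≤ 2 * K * L := by
    have h1 : Real.log X ≤ Real.log ((Gal.zz J : ℝ) ^ (2*K)) :=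
      Real.log_le_log (by linarith) (by exact_mod_cast hJ3)
    rw [Real.log_pow] at h1
    push_cast at h1
    exact h1
  have hKp : (0:ℝ) < K := by linarith
  have hLq : D * Real.log q ≤ 4 * K * L := by linarith
  have hLi : 2 ^ i * Real.log q ≤ L := by
    have h1 : 4 * K * 2 ^ i * Real.log q ≤ D * Real.log q := by gcongr
    refine le_of_mul_le_mul_left ?_ (show (0:ℝ) < 4 * K by positivity)
    linarith
  have hiJ : i ≤ J := by
    have h0 : (0:ℝ) < Real.log 2 := Real.log_pos (by norm_num)
    have h1 : (2:ℝ) ^ i * Real.log 2 ≤ 2 ^ J * Real.log 2 := by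
      have h3 : L = 2 ^ J * Real.log 2 := Gal.log_zz J
      rw [← h3]
      refine le_trans ?_ hLi
      gcongr
    have h2 : (2:ℝ) ^ i ≤ 2 ^ J := le_of_mul_le_mul_right h1 h0
    exact (pow_le_pow_iff_right₀ (by norm_num : (1:ℝ) < 2)).mp h2
  have hqz : q ≤ Gal.zz (J - i) := by
    have h1 := Gal.log_zz_add (J - i) i
    rw [Nat.sub_add_cancel hiJ, ← hLdef] at h1
    rw [h1] at hLi
    have h2 : Real.log q ≤ Real.log (Gal.zz (J - i)) := le_of_mul_le_mul_left hLi (by positivity)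
    have h3 : (0:ℝ) < Gal.zz (J - i) := by
      have := Gal.two_le_zz (J - i)
      exact_mod_cast (by omega : 0 < Gal.zz (J - i))
    exact_mod_cast (Real.log_le_log_iff (by linarith) h3).mp h2
  have hcL : Real.log q + 1 ≤ c₂ * L := by
    have h1 : 12 * K / c₂ * Real.log q ≤ D * Real.log q := by gcongr
    have h2 : 12 * K / c₂ * Real.log q ≤ 4 * K * L := h1.trans hLq
    have h3 : 12 * K * Real.log q ≤ 4 * K * L * c₂ := by
      have h4 := mul_le_mul_of_nonneg_right h2 hc₂.le
      have h5 : 12 * K / c₂ * Real.log q * c₂ = 12 * K * Real.log q := by field_simp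
      linarith
    have h6 : 3 * Real.log q ≤ c₂ * L := by
      refine le_of_mul_le_mul_left ?_ (show (0:ℝ) < 4 * K by positivity)
      linarith
    linarith
  have hfin := H q J X hq hiJ hqz hcL ⟨by omega⟩ hgood hJ1 hJ3 hX0 (a : ZMod q)
    ((ZMod.isUnit_iff_coprime a q).mpr ha)
  have hcount : ((Finset.Iic X).filter (fun p : ℕ => p.Prime ∧ (p : ZMod q) = (a : ZMod q))).card
      = primeCount x q a := by
    rw [primeCount]
    congr 1
    ext p
    simp only [Finset.mem_filter, ZMod.natCast_eq_natCast_iff']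
    rfl
  rw [hcount] at hfin
  have hphi : (0:ℝ) < q.totient := by exact_mod_cast Nat.totient_pos.mpr (by omega)
  have hlx : 0 < Real.log x := Real.log_pos (by linarith)
  have hlX : Real.log X ≤ Real.log x := Real.log_le_log (by linarith) hXle
  have hP : (0:ℝ) ≤ primeCount x q a := Nat.cast_nonneg _
  have h1 : Real.log X * (primeCount x q a : ℝ) ≤ Real.log x * primeCount x q a := by gcongr
  have h2 := hfin.trans h1
  rw [div_le_iff₀ (by positivity)] at h2
  rw [ge_iff_le, div_le_iff₀ (by positivity)]
  linarith
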